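/- arXiv:1311.6903 — 4 statements merged into one kernel-verified Lean document; each statement's English description precedes it below -/
import Mathlib

section
/- If G is a subgroup of the symmetric group Sym_n on n letters, then the number of nonabelian composition factors of G is at most (n-1)/4, i.e. η(G) ≤ (n-1)/4. -/
/-- A composition series of a group `G` with `m` factors: a chain of subgroups
`⊥ = G_0 ≤ G_1 ≤ ... ≤ G_m = ⊤` in which each `G_i` is normal in `G_{i+1}`
with simple factor group `G_{i+1}/G_i`. -/
structure CompositionSeriesOf (G : Type*) [Group G] (m : ℕ) where
  ser : Fin (m + 1) → Subgroup G
  bot_eq : ser 0 = ⊥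
  top_eq : ser (Fin.last m) = ⊤
  mono : Monotone ser
  normal : ∀ i : Fin m, ((ser i.castSucc).subgroupOf (ser i.succ)).Normal
  simple : ∀ i : Fin m,
    @IsSimpleGroup ((ser i.succ : Subgroup G) ⧸ (ser i.castSucc).subgroupOf (ser i.succ))
      (@QuotientGroup.Quotient.group _ _ _ (normal i))

/-- The factor `G_{i+1}/G_i` of a composition series is nonabelian: some commutator of
elements of `G_{i+1}` lies outside `G_i`. -/
def CompositionSeriesOf.NonabelianFactor {G : Type*} [Group G] {m : ℕ}
    (s : CompositionSeriesOf G m) (i : Fin m) : Prop :=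
  ∃ a ∈ s.ser i.succ, ∃ b ∈ s.ser i.succ, a * b * a⁻¹ * b⁻¹ ∉ s.ser i.castSucc

universe u v w

/-- `HasEta G k`: the group `G` has a subnormal series at least `k` of whose factors
are not solvable. -/
inductive HasEta : (G : Type u) → [Group G] → ℕ → Prop
  | zero (G : Type u) [Group G] : HasEta G 0
  | up {G : Type u} [Group G] {k : ℕ} (N : Subgroup G) (hN : N.Normal) (h : HasEta N k) :
      HasEta G k
  | step {G : Type u} [Group G] {k : ℕ} (N : Subgroup G) [hN : N.Normal] (h : HasEta N k)
      (hs : ¬ Group.IsSolvable (G ⧸ N)) : HasEta G (k + 1)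

theorem HasEta.of_surjective {G : Type u} {Q : Type v} [Group G] [Group Q] {k : ℕ}
    (h : HasEta Q k) (f : G →* Q) (hf : Function.Surjective f) : HasEta G k := by
  induction h generalizing G with
  | zero => exact .zero G
  | up N hN h ih =>
    exact .up (N.comap f) (hN.comap f) (ih (f.subgroupComap N)
      (f.subgroupComap_surjective_of_surjective N hf))
  | step N h hs ih =>
    refine .step (N.comap f) (ih (f.subgroupComap N)
      (f.subgroupComap_surjective_of_surjective N hf)) fun hsol => hs ?_
    refine Group.isSolvable_of_surjective
      (f := QuotientGroup.map (N.comap f) N f le_rfl) fun q => ?_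
    obtain ⟨q, rfl⟩ := QuotientGroup.mk_surjective q
    obtain ⟨g, rfl⟩ := hf q
    exact ⟨g, rfl⟩

theorem HasEta.of_injective {K : Type u} {G : Type v} [Group K] [Group G] {k : ℕ}
    (h : HasEta K k) (i : K →* G) (hi : Function.Injective i) (hn : i.range.Normal) :
    HasEta G k :=
  .up i.range hn (h.of_surjective (MonoidHom.ofInjective hi).symm.toMonoidHom
    (MonoidHom.ofInjective hi).symm.surjective)

theorem HasEta.add {K : Type u} {G : Type v} {Q : Type w} [Group K] [Group G] [Group Q]
    {a b : ℕ} (hK : HasEta K a) (hQ : HasEta Q b) (i : K →* G) (hi : Function.Injective i)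
    (f : G →* Q) (hf : Function.Surjective f) (hif : i.range = f.ker) :
    HasEta G (a + b) := by
  have key : ∀ {Q : Type w} [Group Q] (N : Subgroup Q) {G : Type v} [Group G] (i : K →* G)
      (_ : Function.Injective i) (f : G →* Q) (_ : i.range = f.ker),
      ∃ i' : K →* N.comap f, Function.Injective i' ∧ i'.range = (f.subgroupComap N).ker := by
    intro Q _ N G _ i hi f hif
    refine ⟨i.codRestrict (N.comap f) fun x => ?_, fun x y h => hi (congrArg Subtype.val h), ?_⟩
    · have : i x ∈ f.ker := hif ▸ ⟨x, rfl⟩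
      rw [Subgroup.mem_comap, MonoidHom.mem_ker.1 this]
      exact N.one_mem
    · ext ⟨g, hg⟩
      have : g ∈ i.range ↔ g ∈ f.ker := by rw [hif]
      rw [MonoidHom.mem_ker, Subtype.ext_iff]
      change _ ↔ f g = 1
      rw [← MonoidHom.mem_ker, ← this]
      exact ⟨fun ⟨x, hx⟩ => ⟨x, congrArg Subtype.val hx⟩, fun ⟨x, hx⟩ => ⟨x, Subtype.ext hx⟩⟩
  induction hQ generalizing G with
  | zero => exact hK.of_injective i hi (hif ▸ inferInstance)
  | up N hN h ih =>
    obtain ⟨i', h1, h2⟩ := key N i hi f hif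
    exact .up (N.comap f) (hN.comap f) (ih i' h1 (f.subgroupComap N)
      (f.subgroupComap_surjective_of_surjective N hf) h2)
  | step N h hs ih =>
    obtain ⟨i', h1, h2⟩ := key N i hi f hif
    refine .step (N.comap f) (ih i' h1 (f.subgroupComap N)
      (f.subgroupComap_surjective_of_surjective N hf) h2) fun hsol => hs ?_
    refine Group.isSolvable_of_surjective
      (f := QuotientGroup.map (N.comap f) N f le_rfl) fun q => ?_
    obtain ⟨q, rfl⟩ := QuotientGroup.mk_surjective q
    obtain ⟨g, rfl⟩ := hf q
    exact ⟨g, rfl⟩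

theorem HasEta.split {K : Type u} {G : Type v} {Q : Type w} [Group K] [Group G] [Group Q]
    {k : ℕ} (h : HasEta G k) (i : K →* G) (hi : Function.Injective i)
    (f : G →* Q) (hf : Function.Surjective f) (hif : i.range = f.ker) :
    ∃ a b, a + b = k ∧ HasEta K a ∧ HasEta Q b := by
  have key : ∀ {G : Type v} [Group G] (N : Subgroup G) {K : Type u} [Group K] {Q : Type w}
      [Group Q] (i : K →* G) (f : G →* Q) (_ : i.range = f.ker),
      (i.subgroupComap N).range = (f.subgroupMap N).ker := by
    intro G _ N K _ Q _ i f hif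
    ext ⟨g, hg⟩
    have : g ∈ i.range ↔ g ∈ f.ker := by rw [hif]
    rw [MonoidHom.mem_ker, Subtype.ext_iff]
    change _ ↔ f g = 1
    rw [← MonoidHom.mem_ker, ← this]
    constructor
    · rintro ⟨x, hx⟩
      exact ⟨x, congrArg Subtype.val hx⟩
    · rintro ⟨x, rfl⟩
      exact ⟨⟨x, hg⟩, rfl⟩
  induction h generalizing K Q with
  | zero => exact ⟨0, 0, rfl, .zero _, .zero _⟩
  | up N hN h ih =>
    obtain ⟨a, b, hab, ha, hb⟩ := ih (i.subgroupComap N)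
      (fun x y hxy => Subtype.ext (hi (congrArg Subtype.val hxy)))
      (f.subgroupMap N) (f.subgroupMap_surjective N) (key N i f hif)
    exact ⟨a, b, hab, .up _ (hN.comap i) ha, .up _ (hN.map f hf) hb⟩
  | @step G _ k N hN h hs ih =>
    obtain ⟨a, b, hab, ha, hb⟩ := ih (i.subgroupComap N)
      (fun x y hxy => Subtype.ext (hi (congrArg Subtype.val hxy)))
      (f.subgroupMap N) (f.subgroupMap_surjective N) (key N i f hif)
    have hN1 : (N.comap i).Normal := hN.comap i
    have hN2 : (N.map f).Normal := hN.map f hf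
    by_cases h1 : Group.IsSolvable (K ⧸ N.comap i)
    · by_cases h2 : Group.IsSolvable (Q ⧸ N.map f)
      · refine absurd (Group.isSolvable_of_ker_le_range (QuotientGroup.map (N.comap i) N i le_rfl)
          (QuotientGroup.map N (N.map f) f (Subgroup.le_comap_map f N)) ?_) hs
        intro q hq
        obtain ⟨g, rfl⟩ := QuotientGroup.mk_surjective q
        rw [MonoidHom.mem_ker, QuotientGroup.map_mk, QuotientGroup.eq_one_iff] at hq
        obtain ⟨n, hn, hnq⟩ := hq
        have : g * n⁻¹ ∈ i.range := by
          rw [hif, MonoidHom.mem_ker, map_mul, map_inv, hnq, mul_inv_cancel]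
        obtain ⟨x, hx⟩ := this
        refine ⟨QuotientGroup.mk x, ?_⟩
        rw [QuotientGroup.map_mk, hx, QuotientGroup.eq]
        simpa using hn
      · exact ⟨a, b + 1, by omega, .up _ hN1 ha, .step _ hb h2⟩
    · exact ⟨a + 1, b, by omega, .step _ ha h1, .up _ hN2 hb⟩

theorem HasEta.lt_card {G : Type u} [Group G] {k : ℕ} (h : HasEta G k) (hG : Finite G) :
    k < Nat.card G := by
  induction h with
  | zero G => exact Nat.card_pos
  | up N hN h ih =>
    exact (ih inferInstance).trans_le (Nat.card_le_card_of_injective _ N.subtype_injective)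
  | @step G _ k N hN h hs ih =>
    refine (Nat.succ_le_of_lt (ih inferInstance)).trans_lt ?_
    refine lt_of_le_of_ne (Nat.card_le_card_of_injective _ N.subtype_injective) fun hc => hs ?_
    have : N = ⊤ := N.eq_top_of_card_eq hc
    subst this
    have : Subsingleton (G ⧸ (⊤ : Subgroup G)) := QuotientGroup.subsingleton_quotient_top
    infer_instance

/-- The number of nonabelian composition factors of a finite group, as the maximal number of
nonsolvable factors in a subnormal series. -/
noncomputable def eta (G : Type u) [Group G] : ℕ := sSup {k | HasEta G k}

section eta

variable {K : Type u} {G : Type v} {Q : Type w} [Group K] [Group G] [Group Q]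

theorem bddAbove_hasEta (G : Type u) [Group G] [Finite G] : BddAbove {k | HasEta G k} :=
  ⟨Nat.card G, fun _ hk => (hk.lt_card inferInstance).le⟩

theorem HasEta.le_eta [Finite G] {k : ℕ} (h : HasEta G k) : k ≤ eta G :=
  le_csSup (bddAbove_hasEta G) h

theorem hasEta_eta (G : Type u) [Group G] [Finite G] : HasEta G (eta G) :=
  Nat.sSup_mem ⟨0, .zero G⟩ (bddAbove_hasEta G)

theorem eta_exact [Finite G] (i : K →* G) (hi : Function.Injective i)
    (f : G →* Q) (hf : Function.Surjective f) (hif : i.range = f.ker) :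
    eta G = eta K + eta Q := by
  have := Finite.of_injective i hi
  have := Finite.of_surjective f hf
  apply le_antisymm
  · obtain ⟨a, b, hab, ha, hb⟩ := (hasEta_eta G).split i hi f hf hif
    rw [← hab]
    exact add_le_add ha.le_eta hb.le_eta
  · exact ((hasEta_eta K).add (hasEta_eta Q) i hi f hf hif).le_eta

theorem eta_ker_add_range [Finite G] (f : G →* Q) : eta G = eta f.ker + eta f.range :=
  eta_exact f.ker.subtype f.ker.subtype_injective f.rangeRestrict f.rangeRestrict_surjective
    (by rw [Subgroup.range_subtype, MonoidHom.ker_rangeRestrict])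

theorem eta_add_quotient [Finite G] (N : Subgroup G) [N.Normal] :
    eta G = eta N + eta (G ⧸ N) :=
  eta_exact N.subtype N.subtype_injective (QuotientGroup.mk' N) (QuotientGroup.mk'_surjective N)
    (by simp)

theorem eta_le_of_surjective [Finite G] (f : G →* Q) (hf : Function.Surjective f) :
    eta Q ≤ eta G :=
  have := Finite.of_surjective f hf
  ((hasEta_eta Q).of_surjective f hf).le_eta

theorem eta_le_of_injective [Finite G] (i : K →* G) (hi : Function.Injective i)
    (hn : i.range.Normal) : eta K ≤ eta G :=
  have := Finite.of_injective i hi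
  ((hasEta_eta K).of_injective i hi hn).le_eta

theorem eta_congr [Finite G] (e : G ≃* Q) : eta G = eta Q :=
  have := Finite.of_equiv G e.toEquiv
  le_antisymm (eta_le_of_surjective e.symm.toMonoidHom e.symm.surjective)
    (eta_le_of_surjective e.toMonoidHom e.surjective)

theorem eta_le_of_le [Finite G] {A B : Subgroup G} (h : A ≤ B)
    (hn : ∀ b ∈ B, ∀ a ∈ A, b * a * b⁻¹ ∈ A) : eta A ≤ eta B := by
  refine eta_le_of_injective (Subgroup.inclusion h) (Subgroup.inclusion_injective h) ?_
  rw [Subgroup.inclusion_range]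
  exact Subgroup.normal_subgroupOf_of_le_normalizer (Subgroup.le_normalizer_iff.2 hn)

theorem HasEta.eq_zero_of_isSolvable {k : ℕ} (h : HasEta G k) (hG : Group.IsSolvable G) :
    k = 0 := by
  induction h with
  | zero => rfl
  | up N hN h ih => exact ih inferInstance
  | @step G _ k N hN h hs ih => exact absurd (inferInstanceAs (Group.IsSolvable (G ⧸ N))) hs

theorem eta_eq_zero_of_isSolvable [Finite G] [Group.IsSolvable G] : eta G = 0 :=
  (hasEta_eta G).eq_zero_of_isSolvable inferInstance

theorem one_le_eta [Finite G] (h : ¬ Group.IsSolvable G) : 1 ≤ eta G := by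
  refine (HasEta.step (G := G) (k := 0) ⊥ (.zero _) fun hs => h ?_).le_eta
  exact Group.isSolvable_of_surjective (f := QuotientGroup.quotientBot.toMonoidHom)
    QuotientGroup.quotientBot.surjective

theorem HasEta.le_one_of_isSimpleGroup {k : ℕ} (h : HasEta G k) (hG : IsSimpleGroup G) :
    k ≤ 1 := by
  induction h with
  | zero => exact zero_le_one
  | up N hN h ih =>
    rcases hN.eq_bot_or_eq_top with rfl | rfl
    · rw [h.eq_zero_of_isSolvable inferInstance]; exact zero_le_one
    · exact ih ((Subgroup.topEquiv (G := _)).isSimpleGroup_congr.2 hG)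
  | @step G _ k N hN h hs ih =>
    rcases hN.eq_bot_or_eq_top with rfl | rfl
    · rw [h.eq_zero_of_isSolvable inferInstance]
    · have : Subsingleton (G ⧸ (⊤ : Subgroup G)) := QuotientGroup.subsingleton_quotient_top
      exact absurd (inferInstanceAs (Group.IsSolvable (G ⧸ (⊤ : Subgroup G)))) hs

theorem eta_le_one [Finite G] [IsSimpleGroup G] : eta G ≤ 1 :=
  (hasEta_eta G).le_one_of_isSimpleGroup inferInstance

/-- If `ker f ≤ ker g` then the image of `g` is a quotient of the image of `f`. -/
theorem eta_range_le_of_ker_le [Finite G] (f : G →* Q) (g : G →* K) (h : f.ker ≤ g.ker) :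
    eta g.range ≤ eta f.range := by
  have h1 := eta_ker_add_range f
  have h2 := eta_ker_add_range g
  have h3 := eta_le_of_le h fun b _ a ha => (inferInstance : f.ker.Normal).conj_mem a ha b
  omega

theorem eta_le_sum_of_iInf_ker {ι : Type*} [Fintype ι] {Q : ι → Type w} [∀ i, Group (Q i)]
    [Finite G] (f : ∀ i, G →* Q i) (hQ : ∀ i, Finite (Q i))
    (h : ⨅ i, (f i).ker = ⊥) :
    eta G ≤ ∑ i, eta (f i).range := by
  classical
  have key : ∀ s : Finset ι,
      eta G ≤ eta ↥(⨅ i ∈ s, (f i).ker) + ∑ i ∈ s, eta (f i).range := by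
    intro s
    induction s using Finset.induction_on with
    | empty =>
      have : (⨅ i ∈ (∅ : Finset ι), (f i).ker) = ⊤ := by simp
      rw [this, Finset.sum_empty, add_zero]
      exact (eta_congr Subgroup.topEquiv).ge
    | insert a s ha ih =>
      rw [Finset.sum_insert ha, Finset.iInf_insert]
      set P : Subgroup G := ⨅ i ∈ s, (f i).ker with hP
      have hPn : P.Normal := Subgroup.normal_iInf_normal fun i =>
        Subgroup.normal_iInf_normal fun _ => inferInstance
      have h1 := eta_ker_add_range ((f a).comp P.subtype)
      have h2 : eta ((f a).comp P.subtype).range ≤ eta (f a).range := by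
        rw [MonoidHom.range_comp, Subgroup.range_subtype]
        refine eta_le_of_le (Subgroup.map_le_range _ _) ?_
        rintro _ ⟨g, rfl⟩ _ ⟨p, hp, rfl⟩
        exact ⟨g * p * g⁻¹, hPn.conj_mem p hp g, by simp⟩
      have h3 : eta ((f a).comp P.subtype).ker = eta ↥((f a).ker ⊓ P) := by
        have : ((f a).comp P.subtype).ker = ((f a).ker ⊓ P).subgroupOf P := by
          rw [Subgroup.inf_subgroupOf_right]; rfl
        rw [this]
        exact eta_congr (Subgroup.subgroupOfEquivOfLe inf_le_right)
      omega
  have := key Finset.univ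
  have hbot : (⨅ i ∈ (Finset.univ : Finset ι), (f i).ker) = ⊥ := by simpa using h
  rw [hbot, eta_eq_zero_of_isSolvable (G := (⊥ : Subgroup G)), zero_add] at this
  exact this

end eta

/-- The bound `4 η(G) ≤ |Ω| - 1` for all faithful actions of finite groups of degree
less than `n`. -/
def EtaBound (n : ℕ) : Prop :=
  ∀ (G Ω : Type) [Group G] [Finite G] [MulAction G Ω] [FaithfulSMul G Ω] [Finite Ω] [Nonempty Ω],
    Nat.card Ω < n → 4 * eta G + 1 ≤ Nat.card Ω

section Action

open MulAction
open scoped Pointwise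

variable {n : ℕ} {G Ω : Type} [Group G] [MulAction G Ω]

theorem EtaBound.mono {m : ℕ} (h : EtaBound n) (hmn : m ≤ n) : EtaBound m :=
  fun G Ω _ _ _ _ _ _ hc => h G Ω (hc.trans_le hmn)

theorem EtaBound.toPermHom_range [Finite G] [Finite Ω] [Nonempty Ω] (h : EtaBound n)
    (hc : Nat.card Ω < n) : 4 * eta (toPermHom G Ω).range + 1 ≤ Nat.card Ω :=
  h (toPermHom G Ω).range Ω hc

theorem EtaBound.range_of_ker_le {K : Type*} [Group K] [Finite G] [Finite Ω] [Nonempty Ω]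
    (h : EtaBound n) (hc : Nat.card Ω < n) (f : G →* K)
    (hf : ∀ g : G, (∀ ω : Ω, g • ω = ω) → f g = 1) :
    4 * eta f.range + 1 ≤ Nat.card Ω := by
  have h1 := h.toPermHom_range (G := G) hc
  have h2 := eta_range_le_of_ker_le (toPermHom G Ω) f fun g hg =>
    hf g fun ω => Equiv.ext_iff.1 (MonoidHom.mem_ker.1 hg) ω
  omega

/-- The fibre of an invariant map, as an invariant subset. -/
def fiberSub {Z : Type*} (p : Ω → Z) (hp : ∀ (g : G) ω, p (g • ω) = p ω) (z : Z) :
    SubMulAction G Ω where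
  carrier := {ω | p ω = z}
  smul_mem' g ω hω := (hp g ω).trans hω

theorem eta_le_sum_fiber {Z : Type*} [Finite G] [Finite Ω] [FaithfulSMul G Ω] (p : Ω → Z)
    (hp : ∀ (g : G) ω, p (g • ω) = p ω) [Fintype (Set.range p)] :
    eta G ≤ ∑ z : Set.range p, eta (toPermHom G (fiberSub p hp z)).range := by
  refine eta_le_sum_of_iInf_ker (fun z : Set.range p => toPermHom G (fiberSub p hp z))
    (fun z => inferInstance) ?_
  rw [eq_bot_iff]
  intro g hg
  rw [Subgroup.mem_iInf] at hg
  rw [Subgroup.mem_bot]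
  refine FaithfulSMul.eq_of_smul_eq_smul (α := Ω) fun ω => ?_
  rw [one_smul]
  have := Equiv.ext_iff.1 (MonoidHom.mem_ker.1 (hg ⟨p ω, ω, rfl⟩)) ⟨ω, rfl⟩
  exact congrArg Subtype.val this

theorem sum_card_fiberSub {Z : Type*} [Finite Ω] (p : Ω → Z)
    (hp : ∀ (g : G) ω, p (g • ω) = p ω) [Fintype (Set.range p)] :
    ∑ z : Set.range p, Nat.card (fiberSub p hp z) = Nat.card Ω := by
  rw [← Nat.card_congr (Equiv.sigmaFiberEquiv (Set.rangeFactorization p)), Nat.card_sigma]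
  refine Finset.sum_congr rfl fun z _ => Nat.card_congr (Equiv.subtypeEquivRight fun ω => ?_)
  exact (Subtype.ext_iff (a1 := Set.rangeFactorization p ω) (a2 := z)).symm

/-- The range of an equivariant map, as an invariant subset. -/
def rangeSub {Z : Type*} [MulAction G Z] (p : Ω → Z) (hp : ∀ (g : G) ω, p (g • ω) = g • p ω) :
    SubMulAction G Z where
  carrier := Set.range p
  smul_mem' := by
    rintro g _ ⟨ω, rfl⟩
    exact ⟨g • ω, hp g ω⟩

/-- The kernel of the action on the range of an equivariant map. -/
def rangeKer {Z : Type*} [MulAction G Z] (p : Ω → Z) (hp : ∀ (g : G) ω, p (g • ω) = g • p ω) :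
    Subgroup G :=
  (toPermHom G (rangeSub p hp)).ker

theorem mem_rangeKer {Z : Type*} [MulAction G Z] {p : Ω → Z}
    {hp : ∀ (g : G) ω, p (g • ω) = g • p ω} {g : G} :
    g ∈ rangeKer p hp ↔ ∀ ω, p (g • ω) = p ω := by
  rw [rangeKer, MonoidHom.mem_ker, Equiv.ext_iff]
  constructor
  · intro h ω
    rw [hp]
    exact congrArg Subtype.val (h ⟨p ω, ω, rfl⟩)
  · rintro h ⟨_, ω, rfl⟩
    exact Subtype.ext ((hp g ω).symm.trans (h ω))

theorem rangeKer_smul {Z : Type*} [MulAction G Z] {p : Ω → Z}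
    (hp : ∀ (g : G) ω, p (g • ω) = g • p ω) (k : rangeKer p hp) (ω : Ω) : p (k • ω) = p ω :=
  mem_rangeKer.1 k.2 ω

theorem EtaBound.fibration {Z : Type} [Finite G] [Finite Ω] [Nonempty Ω] [FaithfulSMul G Ω]
    [MulAction G Z] (h : EtaBound n) (p : Ω → Z) (hp : ∀ (g : G) ω, p (g • ω) = g • p ω)
    [Fintype (Set.range p)] (hc : Nat.card (Set.range p) < n) :
    4 * eta G + 1 ≤ Nat.card (Set.range p) + ∑ z : Set.range p,
      4 * eta (toPermHom (rangeKer p hp) (fiberSub p (rangeKer_smul hp) z)).range := by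
  have h1 := eta_ker_add_range (toPermHom G (rangeSub p hp))
  have : Finite (rangeSub p hp) := Finite.of_fintype (Set.range p)
  have : Nonempty (rangeSub p hp) := ⟨⟨_, Classical.arbitrary Ω, rfl⟩⟩
  have h2 := h.toPermHom_range (G := G) (Ω := rangeSub p hp) hc
  have h3 := eta_le_sum_fiber (G := rangeKer p hp) p (rangeKer_smul hp)
  have h4 : Nat.card (rangeSub p hp) = Nat.card (Set.range p) := rfl
  rw [← Finset.mul_sum]
  have h5 : eta (rangeKer p hp) = eta (toPermHom G (rangeSub p hp)).ker := rfl
  omega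

/-- The map sending a point to the translate of a given block that contains it. -/
theorem exists_block_map [IsPretransitive G Ω] {B : Set Ω} (hB : IsBlock G B)
    (hne : B.Nonempty) :
    ∃ p : Ω → Set Ω, (∀ (g : G) ω, p (g • ω) = g • p ω) ∧ (∀ ω, ∃ g : G, p ω = g • B) ∧
      ∀ ω ω', p ω' = p ω ↔ ω' ∈ p ω := by
  obtain ⟨b, hb⟩ := hne
  choose s hs using fun ω => exists_smul_eq G b ω
  have mem : ∀ ω, ω ∈ s ω • B := fun ω => ⟨b, hb, hs ω⟩
  have eq : ∀ (g k : G) (ω : Ω), ω ∈ g • B → ω ∈ k • B → g • B = k • B := fun g k ω h1 h2 => by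
    by_contra hne
    exact Set.disjoint_left.1 (hB hne) h1 h2
  refine ⟨fun ω => s ω • B, fun g ω => ?_, fun ω => ⟨s ω, rfl⟩, fun ω ω' => ⟨fun h => ?_,
    fun h => ?_⟩⟩
  · change _ = g • s ω • B
    rw [smul_smul]
    refine eq _ _ (g • ω) (mem _) ?_
    rw [← smul_smul]
    exact Set.smul_mem_smul_set (mem ω)
  · change ω' ∈ s ω • B
    rw [← show s ω' • B = s ω • B from h]
    exact mem ω'
  · exact eq _ _ ω' (mem ω') h

theorem card_fiberSub_block {H : Type} [Group H] [MulAction H Ω] {B : Set Ω} {p : Ω → Set Ω}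
    (hp : ∀ (h : H) ω, p (h • ω) = p ω)
    (h1 : ∀ ω, ∃ g : G, p ω = g • B) (h2 : ∀ ω ω', p ω' = p ω ↔ ω' ∈ p ω) (z : Set.range p) :
    Nat.card (fiberSub p hp z) = B.ncard := by
  obtain ⟨_, ω, rfl⟩ := z
  obtain ⟨g, hg⟩ := h1 ω
  rw [← Set.ncard_image_of_injective B (MulAction.injective g)]
  change _ = (g • B).ncard
  rw [← hg, ← Nat.card_coe_set_eq]
  exact Nat.card_congr (Equiv.subtypeEquivRight fun ω' => h2 ω ω')

theorem card_range_mul_ncard [Finite Ω] {B : Set Ω} {p : Ω → Set Ω}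
    (hp : ∀ (g : G) ω, p (g • ω) = g • p ω)
    (h1 : ∀ ω, ∃ g : G, p ω = g • B) (h2 : ∀ ω ω', p ω' = p ω ↔ ω' ∈ p ω) :
    Nat.card (Set.range p) * B.ncard = Nat.card Ω := by
  have := Fintype.ofFinite (Set.range p)
  rw [← sum_card_fiberSub (G := rangeKer p hp) p (rangeKer_smul hp)]
  rw [Finset.sum_congr rfl fun z _ => card_fiberSub_block (G := G) (rangeKer_smul hp) h1 h2 z]
  simp

theorem EtaBound.of_not_isPreprimitive [Finite G] [Finite Ω] [Nonempty Ω] [FaithfulSMul G Ω]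
    (h : EtaBound (Nat.card Ω)) (hG : ¬ IsPreprimitive G Ω) : 4 * eta G + 1 ≤ Nat.card Ω := by
  by_cases ht : IsPretransitive G Ω
  · obtain ⟨B, hB, hBt⟩ : ∃ B : Set Ω, IsBlock G B ∧ ¬ IsTrivialBlock B := by
      by_contra! hcon
      exact hG { ht with isTrivialBlock_of_isBlock := fun hB => hcon _ hB }
    rw [IsTrivialBlock, not_or, Set.not_subsingleton_iff] at hBt
    have hB2 : 1 < B.ncard := (Set.one_lt_ncard B.toFinite).2 hBt.1
    have hBn : B.ncard < Nat.card Ω := by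
      rw [← Set.ncard_univ]
      exact Set.ncard_lt_ncard (Set.ssubset_univ_iff.2 hBt.2)
    obtain ⟨p, hp, h1, h2⟩ := exists_block_map hB hBt.1.nonempty
    have := Fintype.ofFinite (Set.range p)
    have hcard := card_range_mul_ncard hp h1 h2
    have hlt : Nat.card (Set.range p) < Nat.card Ω := by nlinarith
    have h3 := h.fibration p hp hlt
    have h4 : ∑ z : Set.range p,
        4 * eta (toPermHom (rangeKer p hp) (fiberSub p (rangeKer_smul hp) z)).range ≤
        ∑ z : Set.range p, (B.ncard - 1) := by
      refine Finset.sum_le_sum fun z _ => ?_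
      have hz := card_fiberSub_block (G := G) (rangeKer_smul hp) h1 h2 z
      have : Nonempty (fiberSub p (rangeKer_smul hp) z) := by
        obtain ⟨_, ω, rfl⟩ := z
        exact ⟨⟨ω, rfl⟩⟩
      have := h.toPermHom_range (G := rangeKer p hp) (Ω := fiberSub p (rangeKer_smul hp) z)
        (hz ▸ hBn)
      omega
    rw [Finset.sum_const, Finset.card_univ, ← Nat.card_eq_fintype_card, smul_eq_mul,
      Nat.mul_sub, hcard] at h4
    have : Nat.card (Set.range p) ≤ Nat.card Ω := hlt.le
    omega
  · let p : Ω → Set Ω := fun ω => orbit G ω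
    have hp : ∀ (g : G) ω, p (g • ω) = p ω := fun g ω => orbit_eq_iff.2 (mem_orbit ω g)
    have := Fintype.ofFinite (Set.range p)
    have h1 := eta_le_sum_fiber p hp
    have h2 : ∑ z : Set.range p, (4 * eta (toPermHom G (fiberSub p hp z)).range + 1) ≤
        Nat.card Ω := by
      rw [← sum_card_fiberSub p hp]
      refine Finset.sum_le_sum fun z _ => ?_
      obtain ⟨_, ω, rfl⟩ := z
      have : Nonempty (fiberSub p hp (p ω)) := ⟨⟨ω, rfl⟩⟩
      refine h.toPermHom_range (Ω := fiberSub p hp (p ω)) ?_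
      rw [← Set.ncard_univ (α := Ω)]
      refine Set.ncard_lt_ncard (s := {ω' | p ω' = p ω}) (Set.ssubset_univ_iff.2 fun hc => ht ?_)
      refine (isPretransitive_iff_orbit_eq_univ ω).2 (Set.eq_univ_of_forall fun ω' => ?_)
      exact orbit_eq_iff.1 (Set.eq_univ_iff_forall.1 hc ω')
    rw [Finset.sum_add_distrib, ← Finset.mul_sum, Finset.sum_const, Finset.card_univ,
      ← Nat.card_eq_fintype_card] at h2
    have h3 : 0 < Nat.card (Set.range p) := by
      have : Nonempty (Set.range p) := ⟨⟨_, Classical.arbitrary Ω, rfl⟩⟩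
      exact Nat.card_pos
    simp only [smul_eq_mul, mul_one] at h2
    omega

end Action

section PermutationGroups

open MulAction
open scoped Pointwise commutatorElement

section Aut

theorem ncard_ne_one_add_one (A : Type*) [Group A] [Finite A] (p : A → Prop) (h1 : p 1) :
    Nat.card {a : A // a ≠ 1 ∧ p a} + 1 = Nat.card {a : A // p a} := by
  have := Set.ncard_sdiff_singleton_add_one (s := {a : A | p a}) (a := 1) h1
  rw [← Nat.card_coe_set_eq, ← Nat.card_coe_set_eq] at this
  rw [← show Nat.card {a : A | p a} = Nat.card {a : A // p a} from rfl, ← this]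
  congr 1
  exact Nat.card_congr (Equiv.subtypeEquivRight fun a => by simp [and_comm])

variable {n : ℕ} {A : Type} [Group A] [Finite A]

/-- The nonidentity elements of a group, under the action of a group of automorphisms. -/
def nonOneSub (R : Subgroup (MulAut A)) : SubMulAction R A where
  carrier := {a | a ≠ 1}
  smul_mem' r a ha h := ha (by
    have : (r : MulAut A) a = 1 := h
    simpa using this)

instance (R : Subgroup (MulAut A)) : FaithfulSMul R (nonOneSub R) where
  eq_of_smul_eq_smul {r s} h := by
    refine Subtype.ext (MulEquiv.ext fun a => ?_)
    by_cases ha : a = 1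
    · rw [ha, map_one, map_one]
    · exact congrArg Subtype.val (h ⟨a, ha⟩)

instance : Finite (MulAut A) :=
  Finite.of_injective (fun f : MulAut A => (f : A → A)) DFunLike.coe_injective

theorem card_nonOneSub (R : Subgroup (MulAut A)) :
    Nat.card (nonOneSub R) + 1 = Nat.card A := by
  have := ncard_ne_one_add_one A (fun _ => True) trivial
  simp only [and_true] at this
  rw [← show Nat.card {a : A // a ≠ 1} = Nat.card (nonOneSub R) from rfl, this]
  exact Nat.card_congr (Equiv.subtypeUnivEquiv fun _ => trivial)

theorem EtaBound.mulAut (h : EtaBound n) (hc : Nat.card A ≤ n) (R : Subgroup (MulAut A)) :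
    4 * eta R ≤ Nat.card A - 2 := by
  have h1 := card_nonOneSub R
  rcases isEmpty_or_nonempty (nonOneSub R) with he | he
  · have : Subsingleton R := ⟨fun r s =>
      FaithfulSMul.eq_of_smul_eq_smul (α := nonOneSub R) fun a => he.elim a⟩
    rw [eta_eq_zero_of_isSolvable]
    omega
  · have := h R (nonOneSub R) (by omega)
    omega

theorem two_mul_card_range_inv_le (R : Subgroup (MulAut A)) :
    2 * Nat.card (Set.range fun a : nonOneSub R => ({(a : A), (a : A)⁻¹} : Set A)) + 2 ≤
      Nat.card A + Nat.card {a : A // a * a = 1} := by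
  classical
  set p : nonOneSub R → Set A := fun a => {(a : A), (a : A)⁻¹} with hp
  have hsur : ∀ z : Set.range p, ∃ a, p a = z := fun z => z.2
  choose r hr using hsur
  have hrinj : ∀ z z', (r z : A) = r z' → z = z' := fun z z' hzz => by
    have : r z = r z' := Subtype.ext hzz
    exact Subtype.ext (by rw [← hr z, ← hr z', this])
  have hrinv : ∀ z z', (r z : A) = (r z' : A)⁻¹ → z = z' := fun z z' hzz => by
    refine Subtype.ext ?_
    rw [← hr z, ← hr z', hp]
    simp only [hzz, inv_inv]
    exact Set.pair_comm _ _
  have h1 := card_nonOneSub R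
  have h2 := ncard_ne_one_add_one A (fun a => a * a = 1) (one_mul 1)
  let F : Set.range p ⊕ Set.range p → nonOneSub R ⊕ {a : A // a ≠ 1 ∧ a * a = 1} := fun x =>
    match x with
    | .inl z => .inl (r z)
    | .inr z => if hz : (r z : A) * r z = 1 then .inr ⟨r z, (r z).2, hz⟩
      else .inl ⟨(r z : A)⁻¹, fun hc => (r z).2 (inv_eq_one.1 hc)⟩
  have hF : Function.Injective F := by
    have mixed : ∀ z z', F (.inl z) ≠ F (.inr z') := by
      intro z z' hzz
      simp only [F] at hzz
      split_ifs at hzz with hz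
      have h3 : (r z : A) = (r z' : A)⁻¹ := congrArg Subtype.val (Sum.inl_injective hzz)
      obtain rfl := hrinv z z' h3
      exact hz (by rw [mul_eq_one_iff_eq_inv]; exact h3)
    rintro (z | z) (z' | z') hzz
    · exact congrArg Sum.inl (hrinj z z' (congrArg Subtype.val (Sum.inl_injective hzz)))
    · exact absurd hzz (mixed z z')
    · exact absurd hzz.symm (mixed z' z)
    · simp only [F] at hzz
      split_ifs at hzz with hz hz' hz'
      · exact congrArg Sum.inr (hrinj z z' (congrArg (fun x => x.1) (Sum.inr_injective hzz)))
      · exact congrArg Sum.inr (hrinj z z' (inv_injective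
          (congrArg Subtype.val (Sum.inl_injective hzz))))
  have h3 := Nat.card_le_card_of_injective F hF
  rw [Nat.card_sum, Nat.card_sum] at h3
  omega

theorem EtaBound.mulAut_involutions (h : EtaBound n) (hc : Nat.card A ≤ n)
    (hA : 2 ≤ Nat.card A) (R : Subgroup (MulAut A)) :
    8 * eta R + 4 ≤ Nat.card A + Nat.card {a : A // a * a = 1} := by
  have h0 := two_mul_card_range_inv_le R
  set p : nonOneSub R → Set A := fun a => {(a : A), (a : A)⁻¹} with hpdef
  have hp : ∀ (r : R) a, p (r • a) = r • p a := fun r a => by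
    have hinv : (r • (a : A))⁻¹ = r • (a : A)⁻¹ := (map_inv (r : MulAut A) (a : A)).symm
    simp only [hpdef, SubMulAction.val_smul, hinv]
    rw [← Set.image_smul, Set.image_pair]
  have h1 := card_nonOneSub R
  have : Nonempty (nonOneSub R) := (Nat.card_pos_iff.1 (by omega)).1
  have h2 : Nat.card (Set.range p) ≤ Nat.card (nonOneSub R) := Finite.card_range_le p
  have := Fintype.ofFinite (Set.range p)
  have h3 := h.fibration p hp (by omega)
  have h4 : ∑ z : Set.range p,
        4 * eta (toPermHom (rangeKer p hp) (fiberSub p (rangeKer_smul hp) z)).range = 0 := by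
    refine Finset.sum_eq_zero fun z _ => ?_
    obtain ⟨_, a, rfl⟩ := z
    set Φ := fiberSub p (rangeKer_smul hp) (p a)
    have hne : Nonempty Φ := ⟨⟨a, rfl⟩⟩
    have hcard : Nat.card Φ ≤ 2 := by
      refine (Nat.card_le_card_of_injective (β := ({(a : A), (a : A)⁻¹} : Set A))
        (fun b => ⟨b.1.1, ?_⟩) fun b c hbc => ?_).trans ?_
      · have hb : p b.1 = p a := b.2
        change b.1.1 ∈ p a
        rw [← hb]
        exact Set.mem_insert _ _
      · exact Subtype.ext (Subtype.ext (Subtype.mk.inj hbc))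
      · rw [Nat.card_coe_set_eq]
        exact (Set.ncard_insert_le _ _).trans (by rw [Set.ncard_singleton])
    have h5 : Nat.card Φ < n ∨ Nat.card A = 2 := by omega
    rcases h5 with h5 | h5
    · have := h.toPermHom_range (G := rangeKer p hp) h5
      omega
    · have h6 : Nat.card Φ ≤ Nat.card (nonOneSub R) :=
        Nat.card_le_card_of_injective _ Subtype.val_injective
      have := h.toPermHom_range (G := rangeKer p hp) (Ω := Φ) (by omega)
      omega
  omega

end Aut

section Solvable

theorem exists_abelian_normal {G : Type*} [Group G] (M : Subgroup G) [M.Normal]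
    [Group.IsSolvable M] (hM : M ≠ ⊥) :
    ∃ A : Subgroup G, A.Normal ∧ A ≠ ⊥ ∧ ∀ a ∈ A, ∀ b ∈ A, a * b = b * a := by
  classical
  have hex : ∃ k, derivedSeries M k = ⊥ := Group.IsSolvable.solvable
  have hpos : Nat.find hex ≠ 0 := by
    intro h0
    have h1 := Nat.find_spec hex
    rw [h0, derivedSeries_zero] at h1
    have : Subsingleton M := Subgroup.subsingleton_iff.1 (subsingleton_of_bot_eq_top h1.symm)
    exact hM ((Subgroup.eq_bot_iff_forall M).2 fun x hx =>
      congrArg Subtype.val (Subsingleton.elim (⟨x, hx⟩ : M) 1))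
  obtain ⟨k, hk⟩ := Nat.exists_eq_succ_of_ne_zero hpos
  have hk0 : derivedSeries M k ≠ ⊥ := Nat.find_min hex (by omega)
  have hk1 : derivedSeries M (k + 1) = ⊥ := by
    have := Nat.find_spec hex
    rwa [hk] at this
  refine ⟨(derivedSeries M k).map M.subtype, inferInstance, ?_, ?_⟩
  · rwa [Ne, Subgroup.map_eq_bot_iff_of_injective _ M.subtype_injective]
  · rintro _ ⟨a, ha, rfl⟩ _ ⟨b, hb, rfl⟩
    have : ⁅a, b⁆ ∈ derivedSeries M (k + 1) := by
      rw [derivedSeries_succ]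
      exact Subgroup.commutator_mem_commutator ha hb
    rw [hk1, Subgroup.mem_bot, commutatorElement_eq_one_iff_mul_comm] at this
    exact congrArg M.subtype this

variable {n : ℕ} {R Ω : Type} [Group R] [MulAction R Ω]

theorem eta_add_eta_inf_stabilizer [Finite R] (N : Subgroup R) [N.Normal] [IsPretransitive N Ω]
    (α : Ω) : eta R + eta ↥(N ⊓ stabilizer R α) = eta N + eta (stabilizer R α) := by
  have h1 := eta_add_quotient N
  have h2 := eta_exact (Subgroup.inclusion (inf_le_right : N ⊓ stabilizer R α ≤ _))
    (Subgroup.inclusion_injective _) ((QuotientGroup.mk' N).comp (stabilizer R α).subtype) ?_ ?_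
  · omega
  · intro q
    obtain ⟨r, rfl⟩ := QuotientGroup.mk_surjective q
    obtain ⟨ν, hν⟩ := exists_smul_eq N α (r • α)
    refine ⟨⟨(ν : R)⁻¹ * r, ?_⟩, ?_⟩
    · rw [mem_stabilizer_iff, mul_smul, ← hν]
      exact inv_smul_smul ν α
    · change (((ν : R)⁻¹ * r : R) : R ⧸ N) = (r : R ⧸ N)
      rw [QuotientGroup.mk_mul, QuotientGroup.mk_inv, (QuotientGroup.eq_one_iff _).2 ν.2, inv_one,
        one_mul]
  · rw [Subgroup.inclusion_range]
    ext ⟨x, hx⟩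
    simp [Subgroup.mem_subgroupOf, MonoidHom.mem_ker]

theorem smul_eq_of_commute_of_isPretransitive {N : Subgroup R} [IsPretransitive N Ω] {r : R}
    (hr : ∀ ν ∈ N, r * ν = ν * r) {α : Ω} (hα : r • α = α) (β : Ω) : r • β = β := by
  obtain ⟨ν, rfl⟩ := exists_smul_eq N α β
  change r • (ν : R) • α = (ν : R) • α
  rw [smul_smul, hr ν ν.2, mul_smul, hα]

theorem card_eq_of_regular {N : Subgroup R} [IsPretransitive N Ω] (α : Ω)
    (h : N ⊓ stabilizer R α = ⊥) : Nat.card N = Nat.card Ω := by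
  refine Nat.card_congr (Equiv.ofBijective (fun ν : N => ν • α) ⟨fun ν μ hνμ => ?_, fun β =>
    exists_smul_eq N α β⟩)
  have : (μ : R)⁻¹ * ν ∈ N ⊓ stabilizer R α := by
    refine ⟨N.mul_mem (N.inv_mem μ.2) ν.2, ?_⟩
    change _ • _ = _
    rw [mul_smul]
    exact (congrArg ((μ : R)⁻¹ • ·) hνμ).trans (inv_smul_smul (μ : R) α)
  rw [h, Subgroup.mem_bot, inv_mul_eq_one] at this
  exact Subtype.ext this.symm

theorem EtaBound.of_abelian_transitive [Finite R] [Finite Ω] [Nonempty Ω] [FaithfulSMul R Ω]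
    (h : EtaBound n) (hc : Nat.card Ω ≤ n) (A : Subgroup R) [A.Normal] [IsPretransitive A Ω]
    (hA : ∀ a ∈ A, ∀ b ∈ A, a * b = b * a) : 4 * eta R ≤ Nat.card Ω - 4 := by
  obtain ⟨α⟩ := ‹Nonempty Ω›
  have hreg : A ⊓ stabilizer R α = ⊥ := by
    rw [eq_bot_iff]
    rintro a ⟨ha, haα⟩
    refine FaithfulSMul.eq_of_smul_eq_smul (α := Ω) fun β => ?_
    rw [one_smul]
    exact smul_eq_of_commute_of_isPretransitive (hA a ha) haα β
  have hcard := card_eq_of_regular α hreg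
  have h1 := eta_add_eta_inf_stabilizer A α
  have hAsol : Group.IsSolvable A := Group.isSolvable_of_comm fun a b =>
    Subtype.ext (hA a a.2 b b.2)
  rw [hreg, eta_eq_zero_of_isSolvable (G := (⊥ : Subgroup R)),
    eta_eq_zero_of_isSolvable (G := A)] at h1
  set c : stabilizer R α →* MulAut A := MulAut.conjNormal.comp (stabilizer R α).subtype with hcdef
  have hcinj : Function.Injective c := by
    rw [injective_iff_map_eq_one]
    intro s hs
    refine Subtype.ext (FaithfulSMul.eq_of_smul_eq_smul (α := Ω) fun β => ?_)
    rw [OneMemClass.coe_one, one_smul]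
    refine smul_eq_of_commute_of_isPretransitive (N := A) (fun ν hν => ?_) s.2 β
    have := congrArg Subtype.val (DFunLike.congr_fun hs ⟨ν, hν⟩)
    rw [← mul_inv_eq_iff_eq_mul]
    exact this
  rw [eta_congr (MonoidHom.ofInjective hcinj)] at h1
  have h2 := h.mulAut (hcard.trans_le hc) c.range
  by_cases ht : Nat.card Ω < 2
  · omega
  have h3 := h.mulAut_involutions (hcard.trans_le hc) (by omega) c.range
  let J : Subgroup A :=
    { carrier := {a | a * a = 1}
      one_mem' := one_mul 1
      mul_mem' := fun {a b} ha hb => by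
        have hab : a * b = b * a := Subtype.ext (hA a a.2 b b.2)
        change a * b * (a * b) = 1
        calc a * b * (a * b) = a * (b * a) * b := by group
          _ = (a * a) * (b * b) := by rw [← hab]; group
          _ = 1 := by rw [show a * a = 1 from ha, show b * b = 1 from hb, one_mul]
      inv_mem' := fun {a} ha => by
        change a⁻¹ * a⁻¹ = 1
        rw [← mul_inv_rev, show a * a = 1 from ha, inv_one] }
  have hJ : Nat.card J = Nat.card {a : A // a * a = 1} := rfl
  obtain ⟨q, hq⟩ := J.card_subgroup_dvd_card
  rw [← hJ, hcard] at h3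
  rw [hcard] at h2 hq
  have hJpos : 0 < Nat.card J := Nat.card_pos
  rcases Nat.lt_or_ge q 2 with hq2 | hq2
  · have hq1 : q = 1 := by
      interval_cases q
      · omega
      · rfl
    have hJtop : J = ⊤ := J.eq_top_of_card_eq (by rw [hcard, hq, hq1, mul_one])
    have hpg : IsPGroup 2 A := fun a => ⟨1, by
      have : a ∈ J := hJtop ▸ Subgroup.mem_top a
      rw [pow_one, pow_two]
      exact this⟩
    obtain ⟨e, he⟩ := IsPGroup.iff_card.1 hpg
    rw [hcard] at he
    rcases e with _ | _ | e
    · omega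
    · omega
    · rw [pow_add] at he
      omega
  · have : 2 * Nat.card J ≤ Nat.card Ω := by nlinarith
    omega

theorem EtaBound.of_solvable_normal [Finite R] [Finite Ω] [Nonempty Ω] [FaithfulSMul R Ω]
    [IsPretransitive R Ω] (h : EtaBound n) (hc : Nat.card Ω ≤ n) (M : Subgroup R) [M.Normal]
    [Group.IsSolvable M] (hM : M ≠ ⊥) : 4 * eta R ≤ Nat.card Ω - 4 := by
  obtain ⟨A, hAn, hA, hAc⟩ := exists_abelian_normal M hM
  obtain ⟨α⟩ := ‹Nonempty Ω›
  let p : Ω → Set Ω := fun ω => orbit A ω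
  have hp : ∀ (g : R) ω, p (g • ω) = g • p ω := fun g ω =>
    (smul_orbit_eq_orbit_smul A ω g).symm
  have h1 : ∀ ω, ∃ g : R, p ω = g • orbit A α := fun ω => by
    obtain ⟨g, rfl⟩ := exists_smul_eq R α ω
    exact ⟨g, hp g α⟩
  have h2 : ∀ ω ω', p ω' = p ω ↔ ω' ∈ p ω := fun ω ω' => orbit_eq_iff
  have hcard := card_range_mul_ncard hp h1 h2
  have := Fintype.ofFinite (Set.range p)
  have ht : 2 ≤ (orbit A α).ncard := by
    by_contra hlt
    refine hA ((Subgroup.eq_bot_iff_forall A).2 fun a ha => ?_)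
    refine FaithfulSMul.eq_of_smul_eq_smul (α := Ω) fun ω => ?_
    rw [one_smul]
    obtain ⟨g, hg⟩ := h1 ω
    have hle : (p ω).ncard ≤ 1 := by
      rw [hg, Set.ncard_smul_set]
      omega
    exact (Set.ncard_le_one_iff (Set.toFinite _)).1 hle (mem_orbit ω (⟨a, ha⟩ : A))
      (mem_orbit_self ω)
  have hb : 0 < Nat.card (Set.range p) := by
    have : Nonempty (Set.range p) := ⟨⟨_, α, rfl⟩⟩
    exact Nat.card_pos
  have hn : Nonempty Ω := ⟨α⟩
  have h3 := h.fibration p hp (by nlinarith)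
  have hAK : A ≤ rangeKer p hp := fun a ha => mem_rangeKer.2 fun ω =>
    (h2 _ _).2 (mem_orbit ω (⟨a, ha⟩ : A))
  have h4 : ∑ z : Set.range p,
        4 * eta (toPermHom (rangeKer p hp) (fiberSub p (rangeKer_smul hp) z)).range ≤
        ∑ z : Set.range p, ((orbit A α).ncard - 4) := by
    refine Finset.sum_le_sum fun z _ => ?_
    have hz := card_fiberSub_block (G := R) (rangeKer_smul hp) h1 h2 z
    obtain ⟨_, ω, rfl⟩ := z
    set Φ := fiberSub p (rangeKer_smul hp) (p ω) with hΦ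
    set φ := toPermHom (rangeKer p hp) Φ
    have hne : Nonempty Φ := ⟨⟨ω, rfl⟩⟩
    let A' : Subgroup φ.range := (A.subgroupOf (rangeKer p hp)).map φ.rangeRestrict
    have hA'n : A'.Normal := Subgroup.Normal.map inferInstance _ φ.rangeRestrict_surjective
    have hA't : IsPretransitive A' Φ := by
      refine ⟨fun x y => ?_⟩
      have hxy : y.1 ∈ p x.1 := (h2 _ _).1 ((show p y.1 = p ω from y.2).trans
        (show p x.1 = p ω from x.2).symm)
      obtain ⟨a, ha⟩ := hxy
      exact ⟨⟨φ.rangeRestrict ⟨a, hAK a.2⟩, ⟨_, a.2, rfl⟩⟩, Subtype.ext ha⟩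
    rw [← hz]
    refine h.of_abelian_transitive (R := φ.range) ?_ A' ?_
    · exact (Nat.card_le_card_of_injective _ Subtype.val_injective).trans hc
    · rintro _ ⟨a, ha, rfl⟩ _ ⟨b, hb, rfl⟩
      rw [← map_mul, ← map_mul, show a * b = b * a from Subtype.ext (hAc a ha b hb)]
  rw [Finset.sum_const, Finset.card_univ, ← Nat.card_eq_fintype_card, smul_eq_mul] at h4
  generalize Nat.card (Set.range p) = b at *
  generalize (orbit A α).ncard = t at *
  rw [← hcard]
  rcases Nat.lt_or_ge t 4 with ht4 | ht4
  · rw [Nat.sub_eq_zero_of_le ht4.le, mul_zero] at h4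
    have : b * 2 ≤ b * t := Nat.mul_le_mul_left b ht
    omega
  · obtain ⟨s, rfl⟩ := Nat.exists_eq_add_of_le ht4
    rw [Nat.add_sub_cancel_left] at h4
    rw [mul_add]
    omega

end Solvable

section Simple

variable {n : ℕ} {A : Type} [Group A] [Finite A]

theorem not_isSolvable_of_injective {G H : Type*} [Group G] [Group H] (hG : ¬ Group.IsSolvable G)
    (f : G →* H) (hf : Function.Injective f) : ¬ Group.IsSolvable H := fun _ =>
  hG (Group.isSolvable_of_isSolvable_injective hf)

theorem card_ne_inv_even :
    Even (Nat.card {a : A // a * a ≠ 1}) := by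
  classical
  have := Fintype.ofFinite A
  rw [Nat.card_eq_fintype_card]
  have h := Finset.sum_involution (s := (Finset.univ : Finset {a : A // a * a ≠ 1}))
    (f := fun _ => (1 : ZMod 2))
    (fun a _ => ⟨(a : A)⁻¹, fun h => a.2 (by
      rw [← mul_inv_rev, inv_eq_one] at h
      exact h)⟩) (fun _ _ => by decide) (fun a _ _ h => a.2 (by
        have : (a : A)⁻¹ = a := congrArg Subtype.val h
        rw [mul_eq_one_iff_eq_inv, this])) (fun _ _ => Finset.mem_univ _)
    (fun a _ => Subtype.ext (inv_inv _))
  simp only [Finset.sum_const, Finset.card_univ, nsmul_eq_mul, mul_one] at h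
  rwa [ZMod.natCast_eq_zero_iff_even] at h

theorem EtaBound.mulAut_of_isSimpleGroup [IsSimpleGroup A] (h : EtaBound n)
    (hc : Nat.card A ≤ n) (hA : ¬ Group.IsSolvable A) (R : Subgroup (MulAut A)) :
    4 * eta R + 5 ≤ Nat.card A := by
  let Z : SubMulAction (ConjAct A) A :=
    { carrier := {a | a * a ≠ 1}
      smul_mem' := fun c a ha hca => ha (by
        rw [← smul_mul'] at hca
        exact MulAction.injective c (hca.trans (smul_one c).symm)) }
  have hZ : Nat.card Z + Nat.card {a : A // a * a = 1} = Nat.card A := by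
    classical
    have := Fintype.ofFinite A
    have h1 : Nat.card Z = Nat.card {a : A // ¬ a * a = 1} := rfl
    rw [h1, Nat.card_eq_fintype_card, Nat.card_eq_fintype_card, Nat.card_eq_fintype_card,
      add_comm, Fintype.card_subtype_compl]
    have := Fintype.card_subtype_le fun a : A => a * a = 1
    omega
  have hinv : 0 < Nat.card {a : A // a * a = 1} := by
    have : Nonempty {a : A // a * a = 1} := ⟨⟨1, one_mul 1⟩⟩
    exact Nat.card_pos
  have hcomm : ¬ ∀ a b : A, a * b = b * a := fun hab => hA (Group.isSolvable_of_comm hab)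
  have hne : Nonempty Z := by
    by_contra hne
    have hsq : ∀ a : A, a * a = 1 := fun a => by
      by_contra ha
      exact hne ⟨⟨a, ha⟩⟩
    refine hcomm fun a b => ?_
    have h1 := hsq (a * b)
    rw [mul_eq_one_iff_eq_inv, mul_inv_rev, ← mul_eq_one_iff_eq_inv.1 (hsq a),
      ← mul_eq_one_iff_eq_inv.1 (hsq b)] at h1
    exact h1
  have : Finite (ConjAct A) := ‹Finite A›
  have h1 := h.range_of_ker_le (G := ConjAct A) (Ω := Z) (by omega)
    (ConjAct.ofConjAct : ConjAct A ≃* A).toMonoidHom ?_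
  · have h2 : eta (ConjAct.ofConjAct : ConjAct A ≃* A).toMonoidHom.range = eta A := by
      rw [MonoidHom.range_eq_top.2 (ConjAct.ofConjAct : ConjAct A ≃* A).surjective]
      exact eta_congr Subgroup.topEquiv
    have h3 := one_le_eta hA
    obtain ⟨e, he⟩ := card_ne_inv_even (A := A)
    have h4 : Nat.card Z = Nat.card {a : A // a * a ≠ 1} := rfl
    have h5 := h.mulAut_involutions hc (by omega) R
    omega
  · intro g hg
    let K : Subgroup A := Subgroup.comap ConjAct.toConjAct.toMonoidHom (toPermHom (ConjAct A) Z).ker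
    have hK : K.Normal := inferInstance
    have hgK : ConjAct.ofConjAct g ∈ K := MonoidHom.mem_ker.2 (Equiv.ext hg)
    rcases hK.eq_bot_or_eq_top with hb | ht
    · rw [hb] at hgK
      exact hgK
    · exfalso
      obtain ⟨⟨z, hz⟩⟩ := hne
      have hz1 : z ∈ Subgroup.center A := Subgroup.mem_center_iff.2 fun x => by
        have hx : x ∈ K := ht ▸ Subgroup.mem_top x
        have := congrArg Subtype.val (Equiv.ext_iff.1 (MonoidHom.mem_ker.1 hx) ⟨z, hz⟩)
        have h6 : x * z * x⁻¹ = z := this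
        exact mul_inv_eq_iff_eq_mul.1 h6
      rcases (inferInstance : (Subgroup.center A).Normal).eq_bot_or_eq_top with hb | ht
      · rw [hb, Subgroup.mem_bot] at hz1
        exact hz (by rw [hz1, one_mul])
      · exact hcomm fun a b => Subgroup.mem_center_iff.1 (ht ▸ Subgroup.mem_top b) a

/-- Pairwise commuting nonsolvable subgroups contribute independently to `eta`. -/
theorem card_le_eta_biSup {Q ι : Type*} [Group Q] [Finite Q] (P : ι → Subgroup Q)
    (hc : ∀ i j, i ≠ j → ∀ a ∈ P i, ∀ b ∈ P j, a * b = b * a) (s : Finset ι)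
    (hs : ∀ i ∈ s, ¬ Group.IsSolvable (P i)) : s.card ≤ eta ↥(⨆ i ∈ s, P i) := by
  classical
  induction s using Finset.induction_on with
  | empty => simp
  | insert i s hi ih =>
    have ih' := ih fun j hj => hs j (Finset.mem_insert_of_mem hj)
    rw [Finset.card_insert_of_notMem hi, Finset.iSup_insert]
    set U := ⨆ j ∈ s, P j with hU
    set V := P i ⊔ U
    have hUC : U ≤ Subgroup.centralizer (P i : Set Q) := by
      refine iSup₂_le fun j hj b hb => Subgroup.mem_centralizer_iff.2 fun a ha => ?_
      exact hc i j (by rintro rfl; exact hi hj) a ha b hb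
    have hn : (U.subgroupOf V).Normal := by
      refine Subgroup.normal_subgroupOf_of_le_normalizer (sup_le ?_ Subgroup.le_normalizer)
      refine Subgroup.le_normalizer_iff.2 fun b hb a ha => ?_
      rwa [Subgroup.mem_centralizer_iff.1 (hUC ha) b hb, mul_inv_cancel_right]
    have h1 := eta_add_quotient (U.subgroupOf V)
    have h2 := eta_congr (Subgroup.subgroupOfEquivOfLe (le_sup_right : U ≤ V))
    have h3 : ¬ Group.IsSolvable (V ⧸ U.subgroupOf V) := fun hsol => by
      refine hs i (Finset.mem_insert_self _ _) ?_
      let f : P i →* V ⧸ U.subgroupOf V :=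
        (QuotientGroup.mk' (U.subgroupOf V)).comp (Subgroup.inclusion le_sup_left)
      have hk : ∀ a ∈ f.ker, ∀ b : P i, a * b = b * a := fun a ha b => by
        have h4 : (a : Q) ∈ U :=
          (QuotientGroup.eq_one_iff (N := U.subgroupOf V) _).1 (MonoidHom.mem_ker.1 ha)
        exact Subtype.ext (Subgroup.mem_centralizer_iff.1 (hUC h4) b b.2).symm
      have : Group.IsSolvable f.ker := Group.isSolvable_of_comm fun a b =>
        Subtype.ext (hk a a.2 b)
      exact Group.isSolvable_of_ker_le_range f.ker.subtype f (by simp)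
    have h4 := one_le_eta h3
    rw [h2] at h1
    omega

end Simple

section Family

variable {G : Type*} [Group G]

/-- An equivariant family of pairwise commuting nonabelian simple subgroups. -/
structure IsSimpleFamily {ι : Type*} [MulAction G ι] (S : ι → Subgroup G) : Prop where
  smul : ∀ (g : G) i, S (g • i) = MulAut.conj g • S i
  comm : ∀ i j, i ≠ j → ∀ a ∈ S i, ∀ b ∈ S j, a * b = b * a
  simple : ∀ i, IsSimpleGroup (S i)
  not_isSolvable : ∀ i, ¬ Group.IsSolvable (S i)

theorem conj_smul_eq_of_mem_normalizer {L : Subgroup G} {g : G}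
    (hg : g ∈ Subgroup.normalizer (L : Set G)) : MulAut.conj g • L = L := by
  ext x
  rw [Subgroup.mem_pointwise_smul_iff_inv_smul_mem, ← map_inv]
  exact (Subgroup.mem_normalizer_iff.1 (inv_mem hg) x).symm

theorem exists_isSimpleFamily {G : Type} [Group G] [Finite G] [Nontrivial G]
    (hab : ∀ A : Subgroup G, A.Normal → (∀ a ∈ A, ∀ b ∈ A, a * b = b * a) → A = ⊥) :
    ∃ (ι : Type) (_ : Finite ι) (_ : Nonempty ι) (_ : MulAction G ι) (S : ι → Subgroup G),
      IsPretransitive G ι ∧ IsSimpleFamily S := by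
  obtain ⟨N, hN⟩ : ∃ N : Subgroup G, Minimal (fun N => N.Normal ∧ N ≠ ⊥) N :=
    exists_minimal_of_wellFoundedLT _ ⟨⊤, inferInstance, top_ne_bot⟩
  have hNn : N.Normal := hN.prop.1
  have hNconj : ∀ g : G, MulAut.conj g • N = N := fun g => Subgroup.Normal.conj_smul_eq_self g N
  let P : Subgroup G → Prop := fun L => L ≠ ⊥ ∧ L ≤ N ∧ ∀ ν ∈ N, MulAut.conj ν • L = L
  obtain ⟨T, hT⟩ : ∃ T, Minimal P T :=
    exists_minimal_of_wellFoundedLT _ ⟨N, hN.prop.2, le_rfl, fun ν _ => hNconj ν⟩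
  have hPconj : ∀ (g : G) L, P L → P (MulAut.conj g • L) := by
    rintro g L ⟨h1, h2, h3⟩
    refine ⟨fun h => h1 ?_, ?_, fun ν hν => ?_⟩
    · rwa [smul_eq_iff_eq_inv_smul, Subgroup.smul_bot] at h
    · rw [← hNconj g]
      exact Subgroup.pointwise_smul_le_pointwise_smul_iff.2 h2
    · have h4 := h3 (g⁻¹ * ν * g) (by simpa using hNn.conj_mem ν hν g⁻¹)
      rw [smul_smul, ← map_mul, show ν * g = g * (g⁻¹ * ν * g) by group, map_mul, ← smul_smul, h4]
  have hmin : ∀ g : G, Minimal P (MulAut.conj g • T) := fun g => by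
    refine ⟨hPconj g T hT.prop, fun L hL hLT => ?_⟩
    have h1 := hPconj g⁻¹ L hL
    rw [← Subgroup.pointwise_smul_le_pointwise_smul_iff (a := MulAut.conj g⁻¹), smul_smul,
      ← map_mul, inv_mul_cancel, map_one, one_smul] at hLT
    have h2 := hT.le_of_le h1 hLT
    rw [← Subgroup.pointwise_smul_le_pointwise_smul_iff (a := MulAut.conj g), smul_smul,
      ← map_mul, mul_inv_cancel, map_one, one_smul] at h2
    exact h2
  have hcomm : ∀ L M : Subgroup G, Minimal P L → Minimal P M → L ≠ M →
      ∀ a ∈ L, ∀ b ∈ M, a * b = b * a := by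
    intro L M hL hM hLM a ha b hb
    have hbot : L ⊓ M = ⊥ := by
      by_contra hne
      have hP : P (L ⊓ M) := ⟨hne, inf_le_left.trans hL.prop.2.1, fun ν hν => by
        rw [Subgroup.smul_inf, hL.prop.2.2 ν hν, hM.prop.2.2 ν hν]⟩
      have h1 := hL.le_of_le hP inf_le_left
      have h2 := hM.le_of_le hP inf_le_right
      exact hLM (le_antisymm (h1.trans inf_le_right) (h2.trans inf_le_left))
    have hnorm : ∀ K : Subgroup G, Minimal P K → ∀ x ∈ N, ∀ y ∈ K, x * y * x⁻¹ ∈ K := by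
      intro K hK x hx y hy
      rw [← hK.prop.2.2 x hx]
      exact Subgroup.smul_mem_pointwise_smul y _ K hy
    have h1 : a * b * a⁻¹ * b⁻¹ ∈ L ⊓ M := by
      constructor
      · rw [mul_assoc, mul_assoc, ← mul_assoc b]
        exact L.mul_mem ha (hnorm L hL b (hM.prop.2.1 hb) _ (L.inv_mem ha))
      · exact M.mul_mem (hnorm M hM a (hL.prop.2.1 ha) b hb) (M.inv_mem hb)
    rw [hbot, Subgroup.mem_bot, mul_inv_eq_one, mul_inv_eq_iff_eq_mul] at h1
    exact h1
  have hsup : ⨆ g : G, MulAut.conj g • T = N := by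
    refine (iSup_le fun g => (hmin g).prop.2.1).antisymm (hN.le_of_le ⟨⟨fun x hx g => ?_⟩, ?_⟩
      (iSup_le fun g => (hmin g).prop.2.1))
    · have h1 : MulAut.conj g • (⨆ g : G, MulAut.conj g • T) ≤ ⨆ g : G, MulAut.conj g • T := by
        rw [Subgroup.pointwise_smul_subset_iff]
        refine iSup_le fun k => ?_
        rw [← Subgroup.pointwise_smul_subset_iff, smul_smul, ← map_mul]
        exact le_iSup (fun g : G => MulAut.conj g • T) (g * k)
      exact h1 (Subgroup.smul_mem_pointwise_smul x _ _ hx)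
    · intro h1
      rw [iSup_eq_bot] at h1
      exact (hmin 1).prop.1 (h1 1)
  let _ : MulAction G (Subgroup G) := MulAction.compHom _ (MulAut.conj : G →* MulAut G)
  have hSmin : ∀ i : orbit G T, Minimal P i := by
    rintro ⟨_, g, rfl⟩
    exact hmin g
  have hSconj : ∀ i : orbit G T, ∃ g : G, (i : Subgroup G) = MulAut.conj g • T := by
    rintro ⟨_, g, rfl⟩
    exact ⟨g, rfl⟩
  have hsimple : ∀ i : orbit G T, IsSimpleGroup (i : Subgroup G) := by
    intro i
    have hi := hSmin i
    have : Nontrivial (i : Subgroup G) := (Subgroup.nontrivial_iff_ne_bot _).2 hi.prop.1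
    refine ⟨fun L hL => ?_⟩
    have hle : L.map (i : Subgroup G).subtype ≤ i := Subgroup.map_subtype_le L
    have hnorm : N ≤ Subgroup.normalizer (L.map (i : Subgroup G).subtype : Set G) := by
      rw [← hsup]
      refine iSup_le fun g => Subgroup.le_normalizer_iff.2 fun b hb a ha => ?_
      by_cases hg : (i : Subgroup G) = MulAut.conj g • T
      · obtain ⟨a, ha, rfl⟩ := ha
        rw [← hg] at hb
        exact ⟨⟨b, hb⟩ * a * ⟨b, hb⟩⁻¹, hL.conj_mem a ha _, rfl⟩
      · rwa [← hcomm _ _ hi (hmin g) hg a (hle ha) b hb, mul_inv_cancel_right]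
    by_cases hbot : L.map (i : Subgroup G).subtype = ⊥
    · exact .inl ((Subgroup.map_eq_bot_iff_of_injective _ (Subgroup.subtype_injective _)).1 hbot)
    · right
      have h1 := hi.le_of_le (y := L.map (i : Subgroup G).subtype)
        ⟨hbot, hle.trans hi.prop.2.1, fun ν hν =>
        conj_smul_eq_of_mem_normalizer (hnorm hν)⟩ hle
      rw [eq_top_iff]
      rintro ⟨x, hx⟩ -
      obtain ⟨y, hy, rfl⟩ := h1 hx
      exact hy
  refine ⟨orbit G T, inferInstance, ⟨⟨T, mem_orbit_self T⟩⟩, inferInstance, Subtype.val,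
    inferInstance,
    fun g i => rfl, fun i j hij => hcomm _ _ (hSmin i) (hSmin j) fun h => hij (Subtype.ext h),
    hsimple, fun i hsol => hN.prop.2 (hab N hNn ?_)⟩
  have := hsimple i
  have hTc : ∀ a b : (i : Subgroup G), a * b = b * a :=
    IsSimpleGroup.comm_iff_isSolvable.2 hsol
  obtain ⟨g, hg⟩ := hSconj i
  have hcomm' : ∀ k l : G, ∀ a ∈ MulAut.conj k • T, ∀ b ∈ MulAut.conj l • T, a * b = b * a := by
    intro k l a ha b hb
    by_cases hkl : MulAut.conj k • T = MulAut.conj l • T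
    · rw [← hkl] at hb
      rw [Subgroup.mem_pointwise_smul_iff_inv_smul_mem] at ha hb
      have h1 : ∀ x ∈ T, MulAut.conj g • x ∈ (i : Subgroup G) := fun x hx => by
        rw [hg]
        exact Subgroup.smul_mem_pointwise_smul x _ _ hx
      have h2 : MulAut.conj g • (MulAut.conj k)⁻¹ • a * MulAut.conj g • (MulAut.conj k)⁻¹ • b =
          MulAut.conj g • (MulAut.conj k)⁻¹ • b * MulAut.conj g • (MulAut.conj k)⁻¹ • a :=
        congrArg Subtype.val (hTc ⟨_, h1 _ ha⟩ ⟨_, h1 _ hb⟩)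
      rw [← smul_mul', ← smul_mul', ← smul_mul', ← smul_mul'] at h2
      exact MulAction.injective _ (MulAction.injective _ h2)
    · exact hcomm _ _ (hmin k) (hmin l) hkl a ha b hb
  have h1 : N ≤ Subgroup.centralizer (N : Set G) := by
    conv_lhs => rw [← hsup]
    refine iSup_le fun k a ha => Subgroup.mem_centralizer_iff.2 fun b hb => ?_
    have h2 : N ≤ Subgroup.centralizer {a} := by
      rw [← hsup]
      exact iSup_le fun l b hb => Subgroup.mem_centralizer_iff.2 fun x hx => by
        rw [Set.mem_singleton_iff.1 hx]
        exact hcomm' k l a ha b hb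
    exact (Subgroup.mem_centralizer_iff.1 (h2 hb) a rfl).symm
  exact fun a ha b hb => (Subgroup.mem_centralizer_iff.1 (h1 ha) b hb).symm

end Family

theorem smul_eq_of_commute {G Ω : Type*} [Group G] [MulAction G Ω] (T : Subgroup G) {x : G}
    (hx : ∀ a ∈ T, a * x = x * a) {ω : Ω}
    (hω : x • ω = ω) {β : Ω} (hβ : β ∈ orbit T ω) : x • β = β := by
  obtain ⟨a, rfl⟩ := hβ
  change x • (a : G) • ω = (a : G) • ω
  rw [smul_smul, ← hx a a.2, mul_smul, hω]

namespace IsSimpleFamily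

section Group

variable {G ι : Type*} [Group G] [MulAction G ι] {S : ι → Subgroup G}

theorem exists_ne (hS : IsSimpleFamily S) (i : ι) : ∃ a ∈ S i, ∃ b ∈ S i, a * b ≠ b * a := by
  by_contra! h
  exact hS.not_isSolvable i (Group.isSolvable_of_comm fun a b => Subtype.ext (h a a.2 b b.2))

theorem injective (hS : IsSimpleFamily S) : Function.Injective S := fun i j hij => by
  by_contra hne
  obtain ⟨a, ha, b, hb, hab⟩ := hS.exists_ne i
  exact hab (hS.comm i j hne a ha b (hij ▸ hb))

theorem conj_mem (hS : IsSimpleFamily S) (g : G) {i : ι} {a : G} (ha : a ∈ S i) :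
    g * a * g⁻¹ ∈ S (g • i) := by
  rw [hS.smul]
  exact Subgroup.smul_mem_pointwise_smul a (MulAut.conj g) _ ha

theorem smul_eq_of_mem (hS : IsSimpleFamily S) {i : ι} {g : G} (hg : g ∈ S i) (j : ι) :
    g • j = j := by
  refine hS.injective ((hS.smul g j).trans ?_)
  rcases eq_or_ne i j with rfl | hij
  · exact Subgroup.conj_smul_eq_self_of_mem hg
  · refine conj_smul_eq_of_mem_normalizer (Subgroup.mem_normalizer_iff.2 fun b => ?_)
    constructor
    · intro hb
      rwa [hS.comm i j hij g hg b hb, mul_inv_cancel_right]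
    · intro hb
      have := hS.comm i j hij g hg _ hb
      rw [inv_mul_cancel_right] at this
      rwa [mul_left_cancel this] at hb

theorem iSup_le_ker (hS : IsSimpleFamily S) : ⨆ i, S i ≤ (toPermHom G ι).ker :=
  iSup_le fun _ _ hg => MonoidHom.mem_ker.2 (Equiv.ext (hS.smul_eq_of_mem hg))

theorem smul_eq_of_mem_iSup (hS : IsSimpleFamily S) {g : G} (hg : g ∈ ⨆ i, S i) (j : ι) :
    g • j = j :=
  Equiv.ext_iff.1 (MonoidHom.mem_ker.1 (hS.iSup_le_ker hg)) j

theorem mem_normalizer (hS : IsSimpleFamily S) {g : G} {i : ι} (hg : g • i = i) :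
    g ∈ Subgroup.normalizer (S i : Set G) := by
  refine Subgroup.mem_normalizer_iff.2 fun b => ⟨fun hb => hg ▸ hS.conj_mem g hb, fun hb => ?_⟩
  have := hS.conj_mem g⁻¹ hb
  rwa [inv_smul_eq_iff.2 hg.symm, inv_inv, ← mul_assoc, ← mul_assoc, inv_mul_cancel, one_mul,
    inv_mul_cancel_right] at this

theorem conj_mem_of_smul_eq (hS : IsSimpleFamily S) {g : G} {i : ι} (hg : g • i = i) {a : G}
    (ha : a ∈ S i) : g * a * g⁻¹ ∈ S i :=
  (Subgroup.mem_normalizer_iff.1 (hS.mem_normalizer hg) a).1 ha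

theorem normal_iSup (hS : IsSimpleFamily S) : (⨆ i, S i).Normal := by
  refine ⟨fun x hx g => ?_⟩
  have h : MulAut.conj g • (⨆ i, S i) ≤ ⨆ i, S i := by
    rw [Subgroup.pointwise_smul_subset_iff]
    refine iSup_le fun i => ?_
    rw [← Subgroup.pointwise_smul_subset_iff, ← hS.smul]
    exact le_iSup S _
  exact h (Subgroup.smul_mem_pointwise_smul x _ _ hx)

theorem exists_mul_mem_centralizer (hS : IsSimpleFamily S) (i : ι) {g : G} (hg : g ∈ ⨆ i, S i) :
    ∃ a ∈ S i, ∃ z ∈ Subgroup.centralizer (S i : Set G), g = a * z := by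
  refine Subgroup.iSup_induction S (C := fun g => ∃ a ∈ S i,
    ∃ z ∈ Subgroup.centralizer (S i : Set G), g = a * z) hg (fun j x hx => ?_) ?_ ?_
  · rcases eq_or_ne j i with rfl | hij
    · exact ⟨x, hx, 1, one_mem _, (mul_one x).symm⟩
    · exact ⟨1, one_mem _, x, Subgroup.mem_centralizer_iff.2 fun b hb =>
        (hS.comm j i hij x hx b hb).symm, (one_mul x).symm⟩
  · exact ⟨1, one_mem _, 1, one_mem _, (one_mul 1).symm⟩
  · rintro _ _ ⟨a, ha, z, hz, rfl⟩ ⟨b, hb, w, hw, rfl⟩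
    refine ⟨a * b, mul_mem ha hb, z * w, mul_mem hz hw, ?_⟩
    have := Subgroup.mem_centralizer_iff.1 hz b hb
    rw [mul_assoc, ← mul_assoc z, ← this]
    group

theorem inf_eq_bot_or_le (hS : IsSimpleFamily S) (i : ι) (K : Subgroup G)
    (hK : ∀ b ∈ S i, ∀ a ∈ S i, a ∈ K → b * a * b⁻¹ ∈ K) : S i ⊓ K = ⊥ ∨ S i ≤ K := by
  have := hS.simple i
  have hn : (K.subgroupOf (S i)).Normal := ⟨fun a ha b => hK b b.2 a a.2 ha⟩
  rcases hn.eq_bot_or_eq_top with h | h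
  · left
    rw [inf_comm]
    exact disjoint_iff.1 (Subgroup.subgroupOf_eq_bot.1 h)
  · exact .inr (Subgroup.subgroupOf_eq_top.1 h)

end Group

section Action

variable {G ι Ω : Type} [Group G] [MulAction G ι] {S : ι → Subgroup G} [MulAction G Ω]

theorem orbit_smul (hS : IsSimpleFamily S) (g : G) (i : ι) (ω : Ω) :
    orbit (S (g • i)) (g • ω) = g • orbit (S i) ω := by
  have key : ∀ (g : G) (i : ι) (ω : Ω), g • orbit (S i) ω ⊆ orbit (S (g • i)) (g • ω) := by
    rintro g i ω _ ⟨_, ⟨a, rfl⟩, rfl⟩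
    refine ⟨⟨_, hS.conj_mem g a.2⟩, ?_⟩
    change (g * (a : G) * g⁻¹) • g • ω = g • (a : G) • ω
    rw [smul_smul, smul_smul, inv_mul_cancel_right]
  refine (key g i ω).antisymm' ?_
  have := key g⁻¹ (g • i) (g • ω)
  rw [inv_smul_smul, inv_smul_smul] at this
  exact Set.subset_smul_set_iff.2 this

theorem orbit_smul_of_smul_eq (hS : IsSimpleFamily S) {g : G} {i : ι} (hg : g • i = i) (ω : Ω) :
    orbit (S i) (g • ω) = g • orbit (S i) ω := by
  have := hS.orbit_smul g i ω
  rwa [hg] at this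

theorem ncard_orbit_eq [IsPretransitive G ι] [IsPretransitive ↥(⨆ i, S i) Ω]
    (hS : IsSimpleFamily S) (i j : ι) (ω ω' : Ω) :
    (orbit (S i) ω).ncard = (orbit (S j) ω').ncard := by
  obtain ⟨g, rfl⟩ := exists_smul_eq G i j
  obtain ⟨ν, rfl⟩ := exists_smul_eq ↥(⨆ i, S i) (g • ω) ω'
  change _ = (orbit (S (g • i)) ((ν : G) • g • ω)).ncard
  rw [hS.orbit_smul_of_smul_eq (hS.smul_eq_of_mem_iSup ν.2 _), hS.orbit_smul,
    Set.ncard_smul_set, Set.ncard_smul_set]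

theorem not_forall_smul_eq [FaithfulSMul G Ω] [IsPretransitive ↥(⨆ i, S i) Ω]
    (hS : IsSimpleFamily S) (i : ι) (ω : Ω) : ¬ ∀ a ∈ S i, a • ω = ω := by
  intro h
  have h1 : ∀ a ∈ S i, a = 1 := fun a ha => by
    refine FaithfulSMul.eq_of_smul_eq_smul (α := Ω) fun β => ?_
    obtain ⟨ν, rfl⟩ := exists_smul_eq ↥(⨆ i, S i) ω β
    have h2 := hS.conj_mem_of_smul_eq (hS.smul_eq_of_mem_iSup (inv_mem ν.2) i) ha
    have h3 := h _ h2
    change a • (ν : G) • ω = (1 : G) • (ν : G) • ω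
    rw [one_smul]
    rwa [inv_inv, mul_assoc, mul_smul, inv_smul_eq_iff, mul_smul] at h3
  obtain ⟨a, ha, b, hb, hab⟩ := hS.exists_ne i
  exact hab (by rw [h1 a ha, h1 b hb])

theorem eq_one_of_forall_smul_eq [FaithfulSMul G Ω] [IsPretransitive ↥(⨆ i, S i) Ω]
    (hS : IsSimpleFamily S) {i : ι} {ω : Ω} {a : G} (ha : a ∈ S i)
    (h : ∀ β ∈ orbit (S i) ω, a • β = β) : a = 1 := by
  have hK : ∀ b ∈ S i, ∀ c ∈ S i, c ∈ fixingSubgroup G (orbit (S i) ω) →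
      b * c * b⁻¹ ∈ fixingSubgroup G (orbit (S i) ω) := by
    intro b hb c _ hc
    refine (mem_fixingSubgroup_iff G).2 fun β hβ => ?_
    have h1 : b⁻¹ • β ∈ orbit (S i) ω := mem_orbit_of_mem_orbit (⟨b, hb⟩⁻¹ : S i) hβ
    rw [mul_smul, mul_smul, (mem_fixingSubgroup_iff G).1 hc _ h1, smul_inv_smul]
  rcases hS.inf_eq_bot_or_le i (fixingSubgroup G (orbit (S i) ω)) hK with hb | ht
  · rw [← Subgroup.mem_bot, ← hb]
    exact ⟨ha, (mem_fixingSubgroup_iff G).2 h⟩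
  · exact absurd (fun a ha => (mem_fixingSubgroup_iff G).1 (ht ha) ω (mem_orbit_self ω))
      (hS.not_forall_smul_eq i ω)

theorem two_le_ncard_orbit [Finite Ω] [FaithfulSMul G Ω] [IsPretransitive ↥(⨆ i, S i) Ω]
    (hS : IsSimpleFamily S) (i : ι) (ω : Ω) : 2 ≤ (orbit (S i) ω).ncard := by
  by_contra h
  refine hS.not_forall_smul_eq i ω fun a ha => ?_
  exact (Set.ncard_le_one_iff (Set.toFinite _)).1 (by omega) (mem_orbit ω (⟨a, ha⟩ : S i))
    (mem_orbit_self ω)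

/-- At most one member of the family other than `S i` has its orbit inside that of `S i`. -/
theorem ncard_orbit_subset_le_two [Finite ι] [Finite Ω] [FaithfulSMul G Ω] [IsPretransitive G ι]
    [IsPretransitive ↥(⨆ i, S i) Ω] (hS : IsSimpleFamily S) (i : ι) (α : Ω) :
    {j | orbit (S j) α ⊆ orbit (S i) α}.ncard ≤ 2 := by
  by_contra! hlt
  obtain ⟨j, hj, hji⟩ : ∃ j ∈ {j | orbit (S j) α ⊆ orbit (S i) α}, j ∉ ({i} : Set ι) :=
    Set.exists_mem_notMem_of_ncard_lt_ncard (by rw [Set.ncard_singleton]; omega)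
  obtain ⟨l, hl, hlij⟩ : ∃ l ∈ {j | orbit (S j) α ⊆ orbit (S i) α}, l ∉ ({i, j} : Set ι) := by
    refine Set.exists_mem_notMem_of_ncard_lt_ncard (lt_of_le_of_lt ?_ hlt)
    exact (Set.ncard_insert_le _ _).trans (by rw [Set.ncard_singleton])
  have heq : ∀ {j}, orbit (S j) α ⊆ orbit (S i) α → orbit (S j) α = orbit (S i) α := fun h =>
    Set.eq_of_subset_of_ncard_le h (hS.ncard_orbit_eq _ _ _ _).le (Set.toFinite _)
  have hj' := heq hj
  have hl' := heq hl
  simp only [Set.mem_insert_iff, Set.mem_singleton_iff, not_or] at hji hlij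
  have hagree : ∀ a ∈ S l, ∃ b ∈ S j, ∀ β ∈ orbit (S i) α, a • β = b • β := by
    intro a ha
    have h1 : a • α ∈ orbit (S j) α := by
      rw [hj', ← hl']
      exact mem_orbit α (⟨a, ha⟩ : S l)
    obtain ⟨b, hb⟩ := h1
    refine ⟨b, b.2, fun β hβ => ?_⟩
    have h2 : ((b : G)⁻¹ * a) • β = β := by
      refine smul_eq_of_commute (S i) (fun c hc => ?_) ?_ hβ
      · have h3 := hS.comm i j (Ne.symm hji) c hc _ (inv_mem b.2)
        have h4 := hS.comm i l (Ne.symm hlij.1) c hc a ha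
        rw [← mul_assoc, h3, mul_assoc, h4, mul_assoc]
      · rw [mul_smul, inv_smul_eq_iff]
        exact hb.symm
    rwa [mul_smul, inv_smul_eq_iff] at h2
  obtain ⟨a, ha, c, hc, hac⟩ := hS.exists_ne l
  refine hac ?_
  rw [← mul_inv_eq_one]
  refine hS.eq_one_of_forall_smul_eq (i := l) (ω := α)
    (mul_mem (mul_mem ha hc) (inv_mem (mul_mem hc ha))) fun β hβ => ?_
  have hstab : ∀ x ∈ S l, ∀ β ∈ orbit (S i) α, x • β ∈ orbit (S i) α := by
    intro x hx β hβ
    rw [← hl'] at hβ ⊢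
    exact mem_orbit_of_mem_orbit (⟨x, hx⟩ : S l) hβ
  have hcomm : ∀ β ∈ orbit (S i) α, (a * c) • β = (c * a) • β := by
    intro β hβ
    obtain ⟨b, hb, hab⟩ := hagree a ha
    rw [mul_smul, hab _ (hstab c hc β hβ), mul_smul, hab β hβ, smul_smul, smul_smul,
      hS.comm j l (Ne.symm hlij.2) b hb c hc]
  have hβ' : (c * a)⁻¹ • β ∈ orbit (S i) α := by
    rw [hl'] at hβ
    exact hstab _ (inv_mem (mul_mem hc ha)) β hβ
  rw [mul_smul, hcomm _ hβ', smul_inv_smul]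

end Action

end IsSimpleFamily

namespace IsSimpleFamily

variable {n : ℕ} {G ι Ω : Type} [Group G] [MulAction G ι] {S : ι → Subgroup G} [MulAction G Ω]

theorem exists_not_orbit_subset [IsPretransitive ↥(⨆ i, S i) Ω] (hS : IsSimpleFamily S)
    {i : ι} {α : Ω} (hi : orbit (S i) α ≠ Set.univ) :
    ∃ j, ¬ orbit (S j) α ⊆ orbit (S i) α := by
  by_contra! h
  refine hi (Set.eq_univ_of_forall fun β => ?_)
  have hle : ∀ j, ∀ g ∈ S j, ∀ β ∈ orbit (S i) α, g • β ∈ orbit (S i) α := by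
    rintro j g hg _ ⟨a, rfl⟩
    rcases eq_or_ne j i with rfl | hij
    · exact mem_orbit_of_mem_orbit (⟨g, hg⟩ : S j) (mem_orbit α a)
    · change g • (a : G) • α ∈ _
      rw [smul_smul, hS.comm j i hij g hg a a.2, mul_smul]
      exact mem_orbit_of_mem_orbit a (h j (mem_orbit α (⟨g, hg⟩ : S j)))
  obtain ⟨ν, rfl⟩ := exists_smul_eq ↥(⨆ i, S i) α β
  refine Subgroup.iSup_induction S
    (C := fun g => ∀ β ∈ orbit (S i) α, g • β ∈ orbit (S i) α) ν.2 (fun j g hg => hle j g hg)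
    (fun β hβ => ?_) (fun x y hx hy β hβ => ?_) α (mem_orbit_self α)
  · rwa [one_smul]
  · rw [mul_smul]
    exact hx _ (hy _ hβ)

theorem card_mul_ncard_orbit_le [Finite ι] [Finite Ω] [Finite G] [FaithfulSMul G Ω]
    [IsPretransitive G ι] [IsPretransitive ↥(⨆ i, S i) Ω] (hS : IsSimpleFamily S)
    (h : EtaBound n) (hc : Nat.card Ω ≤ n) {i : ι} {α : Ω} (hi : orbit (S i) α ≠ Set.univ) :
    Nat.card ι * (orbit (S i) α).ncard ≤ Nat.card Ω := by
  classical
  have := Fintype.ofFinite ι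
  let K := stabilizer G i
  let p : Ω → Set Ω := fun ω => orbit (S i) ω
  have hp : ∀ (g : K) ω, p (g • ω) = g • p ω := fun g ω => hS.orbit_smul_of_smul_eq g.2 ω
  have h1 : ∀ ω, ∃ g : K, p ω = g • orbit (S i) α := fun ω => by
    obtain ⟨ν, rfl⟩ := exists_smul_eq ↥(⨆ i, S i) α ω
    exact ⟨⟨ν, hS.smul_eq_of_mem_iSup ν.2 i⟩, hp ⟨ν, hS.smul_eq_of_mem_iSup ν.2 i⟩ α⟩
  have h2 : ∀ ω ω', p ω' = p ω ↔ ω' ∈ p ω := fun ω ω' => orbit_eq_iff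
  have hcard := card_range_mul_ncard hp h1 h2
  have hd := hS.two_le_ncard_orbit i α
  let Y := rangeSub p hp
  have hY : Nat.card Y = Nat.card (Set.range p) := rfl
  have : Finite Y := inferInstanceAs (Finite (Set.range p))
  have : Nonempty Y := ⟨⟨_, α, rfl⟩⟩
  have hYpos : 0 < Nat.card Y := Nat.card_pos
  have hSK : ∀ j, S j ≤ K := fun j g hg => hS.smul_eq_of_mem hg i
  let ψ : ∀ j, S j →* Equiv.Perm Y := fun j => (toPermHom K Y).comp (Subgroup.inclusion (hSK j))
  let W : Finset ι := Finset.univ.filter fun j => ¬ orbit (S j) α ⊆ orbit (S i) α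
  have hψ : ∀ j ∈ W, ¬ Group.IsSolvable (ψ j).range := by
    intro j hj
    have := hS.simple j
    refine not_isSolvable_of_injective (hS.not_isSolvable j) (ψ j).rangeRestrict ?_
    rw [← MonoidHom.ker_eq_bot_iff, MonoidHom.ker_rangeRestrict]
    refine (inferInstance : (ψ j).ker.Normal).eq_bot_or_eq_top.resolve_right fun ht => ?_
    refine (Finset.mem_filter.1 hj).2 ?_
    rintro _ ⟨a, rfl⟩
    have ha : a ∈ (ψ j).ker := ht ▸ Subgroup.mem_top a
    have h3 := congrArg Subtype.val (Equiv.ext_iff.1 (MonoidHom.mem_ker.1 ha) ⟨_, α, rfl⟩)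
    have h4 : p (a • α) = p α := (hp (Subgroup.inclusion (hSK j) a) α).trans h3
    exact (h2 _ _).1 h4
  have hψc : ∀ j l, j ≠ l → ∀ x ∈ (ψ j).range, ∀ y ∈ (ψ l).range, x * y = y * x := by
    rintro j l hjl _ ⟨x, rfl⟩ _ ⟨y, rfl⟩
    have h3 : Subgroup.inclusion (hSK j) x * Subgroup.inclusion (hSK l) y =
        Subgroup.inclusion (hSK l) y * Subgroup.inclusion (hSK j) x :=
      Subtype.ext (hS.comm j l hjl x x.2 y y.2)
    change toPermHom K Y _ * toPermHom K Y _ = toPermHom K Y _ * toPermHom K Y _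
    rw [← map_mul, h3, map_mul]
  have h3 := card_le_eta_biSup (fun j => (ψ j).range) hψc W hψ
  have h4 := h ↥(⨆ j ∈ W, (ψ j).range) Y (by nlinarith)
  have h5 : W.card ≠ 0 := by
    obtain ⟨j, hj⟩ := hS.exists_not_orbit_subset hi
    exact Finset.card_ne_zero_of_mem (Finset.mem_filter.2 ⟨Finset.mem_univ j, hj⟩)
  have h6 : Nat.card ι ≤ 2 + W.card := by
    have h7 := hS.ncard_orbit_subset_le_two i α
    rw [Nat.card_eq_fintype_card, ← Finset.card_univ, ← Finset.card_filter_add_card_filter_not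
      (fun j => orbit (S j) α ⊆ orbit (S i) α)]
    rw [Set.ncard_eq_toFinset_card', Set.toFinset_ofPred] at h7
    exact Nat.add_le_add_right h7 _
  rw [← hcard]
  exact Nat.mul_le_mul_right _ (by omega)

/-- The action by conjugation on a member of the family. -/
def conjHom (hS : IsSimpleFamily S) (H : Subgroup G) (i : ι) (hH : ∀ g ∈ H, g • i = i) :
    H →* MulAut (S i) :=
  (S i).normalizerMonoidHom.comp (Subgroup.inclusion fun g hg => hS.mem_normalizer (hH g hg))

theorem mem_ker_conjHom {hS : IsSimpleFamily S} {H : Subgroup G} {i : ι}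
    {hH : ∀ g ∈ H, g • i = i} {g : H} :
    g ∈ (hS.conjHom H i hH).ker ↔ ∀ a ∈ S i, a * g = g * a := by
  rw [MonoidHom.mem_ker, MulEquiv.ext_iff]
  constructor
  · intro h a ha
    have h1 : (g : G) * a * (g : G)⁻¹ = a := congrArg Subtype.val (h ⟨a, ha⟩)
    exact (mul_inv_eq_iff_eq_mul.1 h1).symm
  · rintro h ⟨a, ha⟩
    refine Subtype.ext ?_
    change (g : G) * a * (g : G)⁻¹ = a
    rw [← h a ha, mul_inv_cancel_right]

theorem eta_le_sum_conjHom [Fintype ι] [Finite G] (hS : IsSimpleFamily S) (H : Subgroup G)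
    (hH : ∀ i, ∀ g ∈ H, g • i = i) (hcent : ∀ g ∈ H, (∀ i, ∀ a ∈ S i, a * g = g * a) → g = 1) :
    eta H ≤ ∑ i, eta (hS.conjHom H i (hH i)).range := by
  refine eta_le_sum_of_iInf_ker (fun i => hS.conjHom H i (hH i)) (fun i => inferInstance) ?_
  refine (Subgroup.eq_bot_iff_forall _).2 fun g hg => Subtype.ext (hcent g g.2 fun i => ?_)
  exact mem_ker_conjHom.1 (Subgroup.mem_iInf.1 hg i)

theorem eta_conjHom_iSup_le_one [Finite G] (hS : IsSimpleFamily S) (i : ι)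
    (hH : ∀ g ∈ ⨆ i, S i, g • i = i) : eta (hS.conjHom (⨆ i, S i) i hH).range ≤ 1 := by
  have := hS.simple i
  let f := hS.conjHom (⨆ i, S i) i hH
  let e : S i →* f.range := f.rangeRestrict.comp (Subgroup.inclusion (le_iSup S i))
  refine (eta_le_of_surjective e ?_).trans eta_le_one
  rintro ⟨_, ⟨g, hg⟩, rfl⟩
  obtain ⟨a, ha, z, hz, rfl⟩ := hS.exists_mul_mem_centralizer i hg
  refine ⟨⟨a, ha⟩, Subtype.ext ?_⟩
  have haN := le_iSup S i ha
  have hzN : z ∈ ⨆ i, S i := by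
    have := mul_mem (inv_mem haN) hg
    rwa [inv_mul_cancel_left] at this
  have hz1 : f ⟨z, hzN⟩ = 1 := mem_ker_conjHom.2 (Subgroup.mem_centralizer_iff.1 hz)
  change f ⟨a, haN⟩ = f (⟨a, haN⟩ * ⟨z, hzN⟩)
  rw [map_mul, hz1, mul_one]

/-- The case of a regular normal subgroup generated by the family. -/
theorem four_mul_eta_le_of_regular [Finite ι] [Nonempty ι] [Finite Ω] [Finite G]
    [FaithfulSMul G Ω] [IsPretransitive ↥(⨆ i, S i) Ω] (hS : IsSimpleFamily S)
    (h : EtaBound n) (hc : Nat.card Ω ≤ n) (α : Ω)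
    (hreg : (⨆ i, S i) ⊓ stabilizer G α = ⊥)
    (hcent : ∀ g ∈ ⨆ i, S i, (∀ i, ∀ a ∈ S i, a * g = g * a) → g = 1)
    {d : ℕ} (hd : ∀ i, Nat.card (S i) = d) (hkd : Nat.card ι * d ≤ Nat.card Ω) :
    4 * eta G + 1 ≤ Nat.card ι * d := by
  have := Fintype.ofFinite ι
  have hn := hS.normal_iSup
  have h1 := eta_add_eta_inf_stabilizer (⨆ i, S i) α
  rw [hreg, eta_eq_zero_of_isSolvable (G := (⊥ : Subgroup G))] at h1
  have hk : 0 < Nat.card ι := Nat.card_pos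
  have hdn : d ≤ n := by nlinarith
  have hd5 : ∀ i, ∀ R : Subgroup (MulAut (S i)), 4 * eta R + 5 ≤ d := fun i R => by
    have := hS.simple i
    have := h.mulAut_of_isSimpleGroup ((hd i).trans_le hdn) (hS.not_isSolvable i) R
    rwa [hd] at this
  have hd5' : 5 ≤ d := by
    have := hd5 (Classical.arbitrary ι) ⊥
    omega
  have h2 : eta ↥(⨆ i, S i) ≤ Nat.card ι := by
    refine (hS.eta_le_sum_conjHom (⨆ i, S i) (fun i g hg => hS.smul_eq_of_mem_iSup hg i)
      hcent).trans ?_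
    refine (Finset.sum_le_sum fun i _ => hS.eta_conjHom_iSup_le_one i _).trans ?_
    simp
  have h3 := eta_ker_add_range (toPermHom (stabilizer G α) ι)
  have h4 := h.toPermHom_range (G := stabilizer G α) (Ω := ι) (by nlinarith)
  let H : Subgroup G := stabilizer G α ⊓ (toPermHom G ι).ker
  have h5 : eta (toPermHom (stabilizer G α) ι).ker = eta H := by
    refine eta_congr (MulEquiv.ofBijective (f := ((Subgroup.subtype _).comp
      (Subgroup.subtype _)).codRestrict H fun g => ⟨g.1.2, ?_⟩) ⟨fun a b hab => ?_, fun b => ?_⟩)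
    · exact MonoidHom.mem_ker.2 (MonoidHom.mem_ker.1 g.2)
    · have hab' : (a.1.1 : G) = b.1.1 := congrArg (fun x : H => (x : G)) hab
      exact Subtype.ext (Subtype.ext hab')
    · exact ⟨⟨⟨b, b.2.1⟩, MonoidHom.mem_ker.2 (MonoidHom.mem_ker.1 b.2.2)⟩, rfl⟩
  have hH : ∀ i, ∀ g ∈ H, g • i = i := fun i g hg =>
    Equiv.ext_iff.1 (MonoidHom.mem_ker.1 hg.2) i
  have h6 := hS.eta_le_sum_conjHom H hH fun g hg hgc => by
    refine FaithfulSMul.eq_of_smul_eq_smul (α := Ω) fun β => ?_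
    rw [one_smul]
    refine smul_eq_of_commute_of_isPretransitive (N := ⨆ i, S i) (fun ν hν => ?_) hg.1 β
    have hle : ⨆ i, S i ≤ Subgroup.centralizer {g} := iSup_le fun i a ha =>
      Subgroup.mem_centralizer_iff.2 fun x hx => by
        rw [Set.mem_singleton_iff.1 hx, hgc i a ha]
    exact Subgroup.mem_centralizer_iff.1 (hle hν) g rfl
  have h7 : ∑ i, (4 * eta (hS.conjHom H i (hH i)).range + 5) ≤ ∑ i : ι, d :=
    Finset.sum_le_sum fun i _ => hd5 i _
  rw [Finset.sum_add_distrib, ← Finset.mul_sum, Finset.sum_const, Finset.sum_const,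
    Finset.card_univ, ← Nat.card_eq_fintype_card, smul_eq_mul, smul_eq_mul] at h7
  omega

theorem four_mul_eta_conjHom_le [Finite Ω] [Finite G] [FaithfulSMul G Ω]
    [IsPretransitive ↥(⨆ i, S i) Ω] (hS : IsSimpleFamily S)
    (h : EtaBound n) (B : Subgroup G) (hB : ∀ i, ∀ g ∈ B, g • i = i)
    (hNB : ⨆ i, S i ≤ B) (i : ι) (α : Ω) (hd : (orbit (S i) α).ncard < n) :
    4 * eta (hS.conjHom B i (hB i)).range + 1 ≤ (orbit (S i) α).ncard := by
  let f := hS.conjHom B i (hB i)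
  let J : Subgroup B := stabilizer B (orbit (S i) α)
  let Δ : SubMulAction J Ω :=
    { carrier := orbit (S i) α
      smul_mem' := fun g β hβ => by
        have h1 : (g : B) • orbit (S i) α = orbit (S i) α := g.2
        rw [← h1]
        exact Set.smul_mem_smul_set hβ }
  have hΔ : Nat.card Δ = (orbit (S i) α).ncard := rfl
  have : Nonempty Δ := ⟨⟨α, mem_orbit_self α⟩⟩
  have h1 := h.range_of_ker_le (G := J) (Ω := Δ) (hΔ ▸ hd) (f.comp J.subtype) fun g hg => ?_
  · have h2 : (f.comp J.subtype).range = f.range := by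
      refine le_antisymm ?_ ?_
      · rintro _ ⟨g, rfl⟩
        exact ⟨g, rfl⟩
      · rintro _ ⟨g, rfl⟩
        obtain ⟨ν, hν⟩ := exists_smul_eq ↥(⨆ i, S i) α (g • α)
        obtain ⟨a, ha, z, hz, haz⟩ := hS.exists_mul_mem_centralizer i ν.2
        have haB : a ∈ B := hNB (le_iSup S i ha)
        have hzB : z ∈ B := by
          have := mul_mem (inv_mem haB) (hNB ν.2)
          rwa [haz, inv_mul_cancel_left] at this
        have hz1 : f ⟨z, hzB⟩ = 1 := mem_ker_conjHom.2 (Subgroup.mem_centralizer_iff.1 hz)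
        obtain ⟨γ, hγ⟩ : ∃ γ : B, γ = (⟨a, haB⟩ * ⟨z, hzB⟩)⁻¹ * g := ⟨_, rfl⟩
        have hγα : γ • α = α := by
          rw [hγ]
          change ((a * z)⁻¹ * (g : G)) • α = α
          rw [← haz, mul_smul, inv_smul_eq_iff]
          exact hν.symm
        have hγJ : γ ∈ J := by
          have h3 := hS.orbit_smul_of_smul_eq (hB i γ γ.2) α
          have h4 : (γ : G) • α = α := hγα
          rw [h4] at h3
          exact mem_stabilizer_iff.2 h3.symm
        have haJ : (⟨a, haB⟩ : B) ∈ J := by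
          have h3 := hS.orbit_smul_of_smul_eq (hB i a haB) α
          have h4 : orbit (S i) (a • α) = orbit (S i) α :=
            orbit_eq_iff.2 (mem_orbit α (⟨a, ha⟩ : S i))
          rw [h4] at h3
          exact mem_stabilizer_iff.2 h3.symm
        have hfg : f (⟨a, haB⟩ * γ) = f g := by
          rw [hγ, map_mul, map_mul, map_inv, map_mul, hz1, mul_one, mul_inv_cancel_left]
        have haγ := J.mul_mem haJ hγJ
        exact ⟨⟨_, haγ⟩, hfg⟩
    rwa [h2] at h1
  · refine (mem_ker_conjHom (hS := hS) (hH := hB i) (g := (g : B))).2 fun a ha => ?_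
    have hgi := hB i g g.1.2
    have hcom : (g : G) * a * (g : G)⁻¹ * a⁻¹ ∈ S i :=
      mul_mem (hS.conj_mem_of_smul_eq hgi ha) (inv_mem ha)
    have hfix : ∀ β ∈ orbit (S i) α, ((g : B) : G) • β = β := fun β hβ =>
      congrArg Subtype.val (hg ⟨β, hβ⟩)
    have h2 := hS.eq_one_of_forall_smul_eq (ω := α) hcom fun β hβ => by
      have h3 : a⁻¹ • β ∈ orbit (S i) α := mem_orbit_of_mem_orbit (⟨a, ha⟩⁻¹ : S i) hβ
      have h4 : ((g : B) : G)⁻¹ • a⁻¹ • β = a⁻¹ • β := by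
        rw [inv_smul_eq_iff, hfix _ h3]
      rw [mul_smul, mul_smul, mul_smul, h4, smul_inv_smul, hfix _ hβ]
    rw [mul_inv_eq_one, mul_inv_eq_iff_eq_mul] at h2
    exact h2.symm

end IsSimpleFamily

section Primitive

variable {n : ℕ} {G Ω : Type} [Group G] [MulAction G Ω]

theorem sum_tsub_le {ι : Type*} (s : Finset ι) (m : ι → ℕ) (c : ℕ) :
    ∑ z ∈ s, (m z - c) ≤ ∑ z ∈ s, m z - c := by
  classical
  induction s using Finset.induction_on with
  | empty => simp
  | insert a s ha ih =>
    rw [Finset.sum_insert ha, Finset.sum_insert ha]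
    omega

theorem EtaBound.of_solvable_normal_of_forall_exists_ne [Finite G] [Finite Ω]
    [FaithfulSMul G Ω] (h : EtaBound n) (hc : Nat.card Ω ≤ n) (M : Subgroup G) [M.Normal]
    [Group.IsSolvable M] (hM : ∀ ω : Ω, ∃ a ∈ M, a • ω ≠ ω) : 4 * eta G ≤ Nat.card Ω - 4 := by
  let p : Ω → Set Ω := fun ω => orbit G ω
  have hp : ∀ (g : G) ω, p (g • ω) = p ω := fun g ω => orbit_eq_iff.2 (mem_orbit ω g)
  have := Fintype.ofFinite (Set.range p)
  have h1 := eta_le_sum_fiber p hp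
  have h2 := sum_card_fiberSub p hp
  have h3 : ∑ z : Set.range p, 4 * eta (toPermHom G (fiberSub p hp z)).range ≤
      ∑ z : Set.range p, (Nat.card (fiberSub p hp z) - 4) := by
    refine Finset.sum_le_sum fun z _ => ?_
    obtain ⟨_, ω, rfl⟩ := z
    set Φ := fiberSub p hp (p ω)
    set φ := toPermHom G Φ
    have hne : Nonempty Φ := ⟨⟨ω, rfl⟩⟩
    have ht : IsPretransitive φ.range Φ := by
      refine ⟨fun x y => ?_⟩
      obtain ⟨g, hg⟩ := orbit_eq_iff.1 ((show p y.1 = p ω from y.2).trans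
        (show p x.1 = p ω from x.2).symm)
      exact ⟨φ.rangeRestrict g, Subtype.ext hg⟩
    have hn : (M.map φ.rangeRestrict).Normal :=
      Subgroup.Normal.map inferInstance _ φ.rangeRestrict_surjective
    have hs : Group.IsSolvable (M.map φ.rangeRestrict) :=
      Group.isSolvable_of_surjective (φ.rangeRestrict.subgroupMap_surjective M)
    refine h.of_solvable_normal
      ((Nat.card_le_card_of_injective _ Subtype.val_injective).trans hc)
      (M.map φ.rangeRestrict) fun hb => ?_
    obtain ⟨a, ha, hne⟩ := hM ω
    have h4 : φ.rangeRestrict a = 1 :=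
      (Subgroup.mem_bot).1 (hb ▸ Subgroup.mem_map_of_mem φ.rangeRestrict ha)
    have h5 := congrArg Subtype.val (Equiv.ext_iff.1 (congrArg Subtype.val h4) ⟨ω, rfl⟩)
    exact hne h5
  have h4 := h3.trans (sum_tsub_le _ _ 4)
  rw [h2, ← Finset.mul_sum] at h4
  omega

instance [FaithfulSMul G Ω] (α : Ω) : FaithfulSMul (stabilizer G α)
    (SubMulAction.ofStabilizer G α) where
  eq_of_smul_eq_smul {r s} h := by
    refine Subtype.ext (FaithfulSMul.eq_of_smul_eq_smul (α := Ω) fun β => ?_)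
    by_cases hβ : β = α
    · rw [hβ]
      exact r.2.trans s.2.symm
    · exact congrArg Subtype.val (h ⟨β, (SubMulAction.mem_ofStabilizer_iff G α).2 hβ⟩)

/-- In a primitive group, the point stabilizer of a nonregular normal subgroup fixes no other
point. -/
theorem exists_smul_ne_of_isPreprimitive [Finite G] [FaithfulSMul G Ω] [IsPreprimitive G Ω]
    [Nontrivial Ω] (T : Subgroup G) [T.Normal] [IsPretransitive T Ω] {α β : Ω} (hβ : β ≠ α)
    (hM : T ⊓ stabilizer G α ≠ ⊥) : ∃ a ∈ T ⊓ stabilizer G α, a • β ≠ β := by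
  by_contra! hfix
  obtain ⟨t, rfl⟩ := exists_smul_eq T α β
  have ht : (t : G) • α ≠ α := hβ
  set M := T ⊓ stabilizer G α with hMdef
  have hle : M ≤ MulAut.conj (t : G) • M := by
    intro x hx
    rw [Subgroup.mem_pointwise_smul_iff_inv_smul_mem, ← map_inv]
    change (t : G)⁻¹ * x * (t : G)⁻¹⁻¹ ∈ M
    refine Subgroup.mem_inf.2
      ⟨mul_mem (mul_mem (inv_mem t.2) hx.1) (inv_mem (inv_mem t.2)), ?_⟩
    rw [inv_inv, mem_stabilizer_iff, mul_smul, mul_smul, inv_smul_eq_iff]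
    exact hfix x hx
  have heq : M = MulAut.conj (t : G) • M := Subgroup.eq_of_le_of_card_ge hle
    (Nat.card_congr (Subgroup.equivSMul (MulAut.conj (t : G)) M).toEquiv).ge
  have htn : (t : G) ∈ Subgroup.normalizer (M : Set G) := by
    refine Subgroup.mem_normalizer_iff.2 fun x => ?_
    conv_rhs => rw [heq]
    exact (Subgroup.smul_mem_pointwise_smul_iff (a := MulAut.conj (t : G))).symm
  have hHn : stabilizer G α ≤ Subgroup.normalizer (M : Set G) := by
    refine Subgroup.le_normalizer_iff.2 ?_
    intro g hg x hx
    refine Subgroup.mem_inf.2 ⟨Subgroup.Normal.conj_mem inferInstance x hx.1 g, ?_⟩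
    exact mul_mem (mul_mem hg hx.2) (inv_mem hg)
  have htop : Subgroup.normalizer (M : Set G) = ⊤ :=
    (IsPreprimitive.isCoatom_stabilizer_of_isPreprimitive (G := G) α).2 _
      (lt_of_le_of_ne hHn fun he => ht (by
        rw [← he] at htn
        exact htn))
  refine hM ((Subgroup.eq_bot_iff_forall _).2 fun x hx => ?_)
  refine FaithfulSMul.eq_of_smul_eq_smul (α := Ω) fun γ => ?_
  obtain ⟨g, rfl⟩ := exists_smul_eq G α γ
  have hg : g⁻¹ ∈ Subgroup.normalizer (M : Set G) := htop ▸ Subgroup.mem_top _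
  have h1 : (g⁻¹ * x * g⁻¹⁻¹) • α = α := ((Subgroup.mem_normalizer_iff.1 hg x).1 hx).2
  rw [inv_inv, mul_smul, mul_smul, inv_smul_eq_iff] at h1
  rw [h1, one_smul]

theorem EtaBound.of_normal_eta_le_one [Finite G] [Finite Ω] [FaithfulSMul G Ω]
    [IsPreprimitive G Ω] (h : EtaBound (Nat.card Ω)) (h5 : 5 ≤ Nat.card Ω) (T : Subgroup G)
    [T.Normal] [IsPretransitive T Ω] (hT : eta T ≤ 1) (α : Ω)
    (hM : T ⊓ stabilizer G α ≠ ⊥) : 4 * eta G + 1 ≤ Nat.card Ω := by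
  have : Nontrivial Ω := Finite.one_lt_card_iff_nontrivial.1 (by omega)
  have h1 := eta_add_eta_inf_stabilizer T α
  have h2 := SubMulAction.nat_card_ofStabilizer_eq G α
  by_cases hs : Group.IsSolvable ↥(T ⊓ stabilizer G α)
  · let M := (T ⊓ stabilizer G α).subgroupOf (stabilizer G α)
    have hMn : M.Normal := by
      have : M = T.subgroupOf (stabilizer G α) := Subgroup.inf_subgroupOf_right _ _
      rw [this]
      infer_instance
    have hMs : Group.IsSolvable M := Group.isSolvable_of_isSolvable_injective
      (f := (Subgroup.subgroupOfEquivOfLe (inf_le_right :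
        T ⊓ stabilizer G α ≤ stabilizer G α)).toMonoidHom) (MulEquiv.injective _)
    have h3 := h.of_solvable_normal_of_forall_exists_ne (G := stabilizer G α)
      (Ω := SubMulAction.ofStabilizer G α) (by omega) M fun ω => by
        obtain ⟨a, ha, hne⟩ := exists_smul_ne_of_isPreprimitive T
          ((SubMulAction.mem_ofStabilizer_iff G α).1 ω.2) hM
        exact ⟨⟨a, ha.2⟩, ha, fun he => hne (congrArg Subtype.val he)⟩
    omega
  · have h3 := one_le_eta hs
    have : Nonempty (SubMulAction.ofStabilizer G α) := (Nat.card_pos_iff.1 (by omega)).1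
    have h4 := h (stabilizer G α) (SubMulAction.ofStabilizer G α) (by omega)
    omega

end Primitive

section Primitive

variable {G Ω : Type} [Group G] [MulAction G Ω]

theorem isPretransitive_of_normal_of_ne_bot [FaithfulSMul G Ω] [IsPreprimitive G Ω]
    {N : Subgroup G} [N.Normal] (hN : N ≠ ⊥) : IsPretransitive N Ω := by
  refine IsQuasiPreprimitive.isPretransitive_of_normal fun hf => hN ?_
  refine (Subgroup.eq_bot_iff_forall _).2 fun x hx => ?_
  refine FaithfulSMul.eq_of_smul_eq_smul (α := Ω) fun ω => ?_
  rw [one_smul]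
  have hω : ω ∈ fixedPoints N Ω := hf ▸ Set.mem_univ ω
  exact hω ⟨x, hx⟩

theorem card_eq_ncard_orbit {T : Subgroup G} {α : Ω} (h : T ⊓ stabilizer G α = ⊥) :
    Nat.card T = (orbit T α).ncard := by
  rw [← Nat.card_coe_set_eq]
  refine (Nat.card_range_of_injective (f := fun a : T => a • α) fun a b hab => ?_).symm
  have : (b : G)⁻¹ * a ∈ T ⊓ stabilizer G α := by
    refine Subgroup.mem_inf.2 ⟨T.mul_mem (T.inv_mem b.2) a.2, ?_⟩
    rw [mem_stabilizer_iff, mul_smul, inv_smul_eq_iff]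
    exact hab
  rw [h, Subgroup.mem_bot, inv_mul_eq_one] at this
  exact Subtype.ext this.symm

theorem mul_comm_of_mem_iSup {ι : Type*} {S : ι → Subgroup G} {g x : G}
    (hg : ∀ i, ∀ a ∈ S i, a * g = g * a)
    (hx : x ∈ ⨆ i, S i) : g * x = x * g := by
  have hle : ⨆ i, S i ≤ Subgroup.centralizer {g} := iSup_le fun i a ha =>
    Subgroup.mem_centralizer_iff.2 fun y hy => by rw [Set.mem_singleton_iff.1 hy, hg i a ha]
  exact Subgroup.mem_centralizer_iff.1 (hle hx) g rfl

end Primitive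

namespace IsSimpleFamily

variable {n : ℕ} {G ι Ω : Type} [Group G] [MulAction G ι] {S : ι → Subgroup G} [MulAction G Ω]

theorem eq_one_of_mem_of_commute (hS : IsSimpleFamily S) {i : ι} {a : G} (ha : a ∈ S i)
    (h : ∀ b ∈ S i, b * a = a * b) : a = 1 := by
  rcases hS.inf_eq_bot_or_le i (Subgroup.centralizer (S i : Set G)) (fun b hb c hc hcz => by
    rw [Subgroup.mem_centralizer_iff.1 hcz b hb, mul_inv_cancel_right]
    exact hcz) with h1 | h1
  · exact (Subgroup.mem_bot).1 (h1 ▸ Subgroup.mem_inf.2 ⟨ha, Subgroup.mem_centralizer_iff.2 h⟩)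
  · obtain ⟨b, hb, c, hc, hbc⟩ := hS.exists_ne i
    exact absurd (Subgroup.mem_centralizer_iff.1 (h1 hc) b hb) hbc

theorem eq_of_le (hS : IsSimpleFamily S) {i j : ι} (h : S j ≤ S i) : j = i := by
  by_contra hne
  obtain ⟨a, ha, b, hb, hab⟩ := hS.exists_ne j
  exact hab (hS.comm j i hne a ha b (h hb))

theorem four_mul_eta_le_of_orbit_ne_univ [Finite ι] [Nonempty ι] [Finite Ω] [Finite G]
    [FaithfulSMul G Ω] [IsPretransitive G ι] [IsPretransitive ↥(⨆ i, S i) Ω]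
    (hS : IsSimpleFamily S) (h : EtaBound (Nat.card Ω)) {i : ι} {α : Ω}
    (hi : orbit (S i) α ≠ Set.univ)
    (hcent : ∀ g, (∀ i, ∀ a ∈ S i, a * g = g * a) → g = 1) : 4 * eta G + 1 ≤ Nat.card Ω := by
  have := Fintype.ofFinite ι
  have hk : 0 < Nat.card ι := Nat.card_pos
  have h1 := hS.card_mul_ncard_orbit_le h le_rfl hi
  have h2 := hS.two_le_ncard_orbit i α
  have h3 : (orbit (S i) α).ncard < Nat.card Ω := Set.ncard_lt_card hi
  have h4 := eta_ker_add_range (toPermHom G ι)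
  have h5 := h.toPermHom_range (G := G) (Ω := ι) (by nlinarith)
  have hB : ∀ j, ∀ g ∈ (toPermHom G ι).ker, g • j = j := fun j g hg =>
    Equiv.ext_iff.1 (MonoidHom.mem_ker.1 hg) j
  have h6 := hS.eta_le_sum_conjHom (toPermHom G ι).ker hB fun g _ => hcent g
  have h7 : ∑ j, (4 * eta (hS.conjHom (toPermHom G ι).ker j (hB j)).range + 1) ≤
      ∑ j : ι, (orbit (S i) α).ncard := Finset.sum_le_sum fun j _ => by
    rw [hS.ncard_orbit_eq i j α α]
    exact hS.four_mul_eta_conjHom_le h _ hB hS.iSup_le_ker j α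
      (by rwa [← hS.ncard_orbit_eq i j α α])
  rw [Finset.sum_add_distrib, ← Finset.mul_sum, Finset.sum_const, Finset.sum_const,
    Finset.card_univ, ← Nat.card_eq_fintype_card, smul_eq_mul, smul_eq_mul] at h7
  omega

theorem four_mul_eta_le_of_transitive_of_ne [Finite ι] [Finite Ω] [Finite G]
    [FaithfulSMul G Ω] [IsPretransitive G ι] [IsPretransitive ↥(⨆ i, S i) Ω]
    (hS : IsSimpleFamily S) (h : EtaBound (Nat.card Ω)) (h5 : 5 ≤ Nat.card Ω) {i j : ι}
    {α : Ω} (hij : i ≠ j) (hi : orbit (S i) α = Set.univ) : 4 * eta G + 1 ≤ Nat.card Ω := by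
  have htr : ∀ l, IsPretransitive (S l) Ω := fun l => by
    rw [isPretransitive_iff_orbit_eq_univ α]
    refine Set.eq_of_subset_of_ncard_le (Set.subset_univ _) ?_
    rw [← hS.ncard_orbit_eq i l α α, hi]
  have hι : Nat.card ι ≤ 2 := by
    have := hS.ncard_orbit_subset_le_two i α
    simpa [hi, Set.ncard_univ] using this
  have : Nonempty ι := ⟨i⟩
  have h1 := h.toPermHom_range (G := G) (Ω := ι) (by omega)
  have h2 := eta_ker_add_range (toPermHom G ι)
  have hreg : S i ⊓ stabilizer G α = ⊥ := by
    refine (Subgroup.eq_bot_iff_forall _).2 fun x hx => ?_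
    refine FaithfulSMul.eq_of_smul_eq_smul (α := Ω) fun β => ?_
    rw [one_smul]
    have := htr j
    exact smul_eq_of_commute_of_isPretransitive (N := S j)
      (fun ν hν => hS.comm i j hij x hx.1 ν hν) hx.2 β
  have hcard : Nat.card (S i) = Nat.card Ω := by
    rw [card_eq_ncard_orbit hreg, hi, Set.ncard_univ]
  set B := (toPermHom G ι).ker with hBdef
  have hSB : S i ≤ B := (le_iSup S i).trans hS.iSup_le_ker
  let e := Subgroup.subgroupOfEquivOfLe hSB
  let S' : Unit → Subgroup B := fun _ => (S i).subgroupOf B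
  have hB : ∀ g ∈ B, g • i = i := fun g hg => Equiv.ext_iff.1 (MonoidHom.mem_ker.1 hg) i
  have hn : ((S i).subgroupOf B).Normal :=
    ⟨fun x hx g => hS.conj_mem_of_smul_eq (hB g g.2) hx⟩
  have hsim := hS.simple i
  have hS' : IsSimpleFamily S' :=
    { smul := fun g _ => (Subgroup.Normal.conj_smul_eq_self g _).symm
      comm := fun i j hij => absurd (Subsingleton.elim i j) hij
      simple := fun _ => e.isSimpleGroup
      not_isSolvable := fun _ =>
        not_isSolvable_of_injective (hS.not_isSolvable i) e.symm.toMonoidHom e.symm.injective }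
  have hsup : ⨆ u, S' u = (S i).subgroupOf B := iSup_const
  have htr' : IsPretransitive ↥(⨆ u, S' u) Ω := by
    rw [hsup]
    refine ⟨fun x y => ?_⟩
    obtain ⟨a, ha⟩ := (htr i).exists_smul_eq x y
    exact ⟨⟨⟨a, hSB a.2⟩, a.2⟩, ha⟩
  have h3 := hS'.four_mul_eta_le_of_regular h le_rfl α ?_ ?_ (d := Nat.card Ω) ?_ ?_
  · rw [Nat.card_unique] at h3
    omega
  · rw [hsup]
    refine (Subgroup.eq_bot_iff_forall _).2 fun x hx => Subtype.ext ?_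
    exact (Subgroup.mem_bot).1 (hreg ▸ Subgroup.mem_inf.2 ⟨hx.1, hx.2⟩)
  · rw [hsup]
    intro g hg hgc
    refine Subtype.ext (hS.eq_one_of_mem_of_commute hg fun b hb => ?_)
    exact congrArg Subtype.val (hgc () ⟨b, hSB hb⟩ hb)
  · intro u
    rw [← hcard]
    exact Nat.card_congr e.toEquiv
  · rw [Nat.card_unique, one_mul]

theorem four_mul_eta_le_of_inf_stabilizer_eq_bot [Finite ι] [Finite Ω] [Finite G]
    [FaithfulSMul G Ω] [IsPretransitive G ι] [IsPretransitive ↥(⨆ i, S i) Ω]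
    (hS : IsSimpleFamily S) (h : EtaBound (Nat.card Ω)) (i : ι) (α : Ω)
    (hreg : (⨆ i, S i) ⊓ stabilizer G α = ⊥)
    (hcent : ∀ g ∈ ⨆ i, S i, (∀ i, ∀ a ∈ S i, a * g = g * a) → g = 1) :
    4 * eta G + 1 ≤ Nat.card Ω := by
  have : Nonempty ι := ⟨i⟩
  have hd : ∀ j, Nat.card (S j) = (orbit (S i) α).ncard := fun j => by
    rw [hS.ncard_orbit_eq i j α α]
    exact card_eq_ncard_orbit (eq_bot_iff.2 ((inf_le_inf_right _ (le_iSup S j)).trans hreg.le))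
  have hkd : Nat.card ι * (orbit (S i) α).ncard ≤ Nat.card Ω := by
    by_cases hi : orbit (S i) α = Set.univ
    · have h1 : S i = ⨆ i, S i := by
        refine Subgroup.eq_of_le_of_card_ge (le_iSup S i) ?_
        rw [hd, hi, Set.ncard_univ, card_eq_of_regular α hreg]
      have h2 : Subsingleton ι := ⟨fun j l =>
        (hS.eq_of_le ((le_iSup S j).trans h1.ge)).trans
          (hS.eq_of_le ((le_iSup S l).trans h1.ge)).symm⟩
      rw [Nat.card_unique, one_mul, hi, Set.ncard_univ]
    · exact hS.card_mul_ncard_orbit_le h le_rfl hi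
  exact (hS.four_mul_eta_le_of_regular h le_rfl α hreg hcent hd hkd).trans hkd

end IsSimpleFamily

theorem EtaBound.of_isPreprimitive {G Ω : Type} [Group G] [MulAction G Ω] [Finite G] [Finite Ω]
    [FaithfulSMul G Ω] [IsPreprimitive G Ω] (h : EtaBound (Nat.card Ω)) (h5 : 5 ≤ Nat.card Ω) :
    4 * eta G + 1 ≤ Nat.card Ω := by
  obtain ⟨α⟩ : Nonempty Ω := (Nat.card_pos_iff.1 (by omega)).1
  rcases subsingleton_or_nontrivial G with hG | hG
  · rw [eta_eq_zero_of_isSolvable]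
    omega
  by_cases hab : ∃ A : Subgroup G, A.Normal ∧ (∀ a ∈ A, ∀ b ∈ A, a * b = b * a) ∧ A ≠ ⊥
  · obtain ⟨A, hAn, hAc, hA⟩ := hab
    have := isPretransitive_of_normal_of_ne_bot (Ω := Ω) hA
    have : Nonempty Ω := ⟨α⟩
    have := h.of_abelian_transitive le_rfl A hAc
    omega
  push Not at hab
  obtain ⟨ι, _, ⟨i⟩, _, S, hι, hS⟩ := exists_isSimpleFamily hab
  have : Nonempty ι := ⟨i⟩
  have hn := hS.normal_iSup
  have hne : ⨆ i, S i ≠ ⊥ := fun hb => by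
    obtain ⟨a, ha, b, hb', hab⟩ := hS.exists_ne i
    have h1 : a = 1 := Subgroup.mem_bot.1 (hb ▸ le_iSup S i ha)
    rw [h1, one_mul, mul_one] at hab
    exact hab rfl
  have htr := isPretransitive_of_normal_of_ne_bot (Ω := Ω) hne
  by_cases hreg : (⨆ i, S i) ⊓ stabilizer G α = ⊥
  · refine hS.four_mul_eta_le_of_inf_stabilizer_eq_bot h i α hreg fun g hg hgc => ?_
    have h1 := hab ((⨆ i, S i) ⊓ Subgroup.centralizer (⨆ i, S i : Subgroup G)) inferInstance
      fun a ha b hb => (Subgroup.mem_centralizer_iff.1 ha.2 b hb.1).symm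
    refine Subgroup.mem_bot.1 (h1 ▸ Subgroup.mem_inf.2 ⟨hg, ?_⟩)
    exact Subgroup.mem_centralizer_iff.2 fun x hx =>
      (mul_comm_of_mem_iSup hgc hx).symm
  have hC : Subgroup.centralizer ((⨆ i, S i : Subgroup G) : Set G) = ⊥ := by
    by_contra hC
    have := isPretransitive_of_normal_of_ne_bot (Ω := Ω) hC
    refine hreg ((Subgroup.eq_bot_iff_forall _).2 fun x hx => ?_)
    refine FaithfulSMul.eq_of_smul_eq_smul (α := Ω) fun β => ?_
    rw [one_smul]
    exact smul_eq_of_commute_of_isPretransitive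
      (fun ν hν => Subgroup.mem_centralizer_iff.1 hν x hx.1) hx.2 β
  by_cases hi : orbit (S i) α = Set.univ
  · by_cases hs : ∃ j, i ≠ j
    · obtain ⟨j, hij⟩ := hs
      exact hS.four_mul_eta_le_of_transitive_of_ne h h5 hij hi
    · push Not at hs
      have h1 : ⨆ i, S i = S i := le_antisymm (iSup_le fun j => by rw [hs j]) (le_iSup S i)
      have := hS.simple i
      refine h.of_normal_eta_le_one h5 (⨆ i, S i) ?_ α hreg
      rw [h1]
      exact eta_le_one
  · refine hS.four_mul_eta_le_of_orbit_ne_univ h hi fun g hg => ?_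
    refine Subgroup.mem_bot.1 (hC ▸ Subgroup.mem_centralizer_iff.2 fun x hx => ?_)
    exact (mul_comm_of_mem_iSup hg hx).symm

end PermutationGroups

section Small

theorem isSolvable_alternatingGroup_of_card_eq_four {α : Type*} [DecidableEq α] [Fintype α]
    (hα : Nat.card α = 4) : Group.IsSolvable (alternatingGroup α) := by
  have hK : Group.IsSolvable (alternatingGroup.kleinFour α) := by
    have := alternatingGroup.kleinFour_isKleinFour hα
    exact Group.isSolvable_of_comm fun a b =>
      mul_comm_of_exponent_two IsKleinFour.exponent_two a b
  refine Group.isSolvable_of_ker_le_range (alternatingGroup.kleinFour α).subtype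
    (Abelianization.of (G := alternatingGroup α)) ?_
  rw [Abelianization.ker_of, Subgroup.range_subtype,
    alternatingGroup.kleinFour_eq_commutator hα]

theorem isSolvable_perm_of_card_le_four {α : Type*} [Finite α] (hα : Nat.card α ≤ 4) :
    Group.IsSolvable (Equiv.Perm α) := by
  classical
  have h4 : Group.IsSolvable (Equiv.Perm (Fin 4)) := by
    have := isSolvable_alternatingGroup_of_card_eq_four (α := Fin 4) (Nat.card_fin 4)
    refine Group.isSolvable_of_ker_le_range (alternatingGroup (Fin 4)).subtype
      (Equiv.Perm.sign (α := Fin 4)) ?_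
    rw [Subgroup.range_subtype]
    exact le_rfl
  have := Fintype.ofFinite α
  obtain ⟨e⟩ : Nonempty (α ↪ Fin 4) := Function.Embedding.nonempty_of_card_le (by
    rwa [Fintype.card_fin, ← Nat.card_eq_fintype_card])
  exact Group.isSolvable_of_isSolvable_injective (Equiv.Perm.viaEmbeddingHom_injective e)

end Small

open MulAction in
theorem etaBound (n : ℕ) : EtaBound n := by
  induction n with
  | zero => exact fun _ _ _ _ _ _ _ _ hc => absurd hc (Nat.not_lt_zero _)
  | succ n ih =>
    intro G Ω _ _ _ _ _ _ hc
    have h := ih.mono (Nat.lt_succ_iff.1 hc)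
    by_cases h4 : Nat.card Ω ≤ 4
    · have := isSolvable_perm_of_card_le_four h4
      have : Group.IsSolvable G := Group.isSolvable_of_isSolvable_injective
        (f := toPermHom G Ω) toPerm_injective
      rw [eta_eq_zero_of_isSolvable]
      have : 0 < Nat.card Ω := Nat.card_pos
      omega
    · by_cases hp : IsPreprimitive G Ω
      · exact h.of_isPreprimitive (by omega)
      · exact h.of_not_isPreprimitive hp

namespace CompositionSeriesOf

variable {G : Type*} [Group G] {m : ℕ} (s : CompositionSeriesOf G m)

theorem not_isSolvable_quotient {i : Fin m} (hi : s.NonabelianFactor i)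
    [((s.ser i.castSucc).subgroupOf (s.ser i.succ)).Normal] :
    ¬ Group.IsSolvable (s.ser i.succ ⧸ (s.ser i.castSucc).subgroupOf (s.ser i.succ)) := by
  have := s.simple i
  rw [← IsSimpleGroup.comm_iff_isSolvable]
  intro h
  obtain ⟨a, ha, b, hb, hab⟩ := hi
  have h1 := h (⟨a, ha⟩ : s.ser i.succ) (⟨b, hb⟩ : s.ser i.succ)
  refine hab ?_
  obtain ⟨c, hc⟩ : ∃ c : s.ser i.succ, c = ⟨a, ha⟩ * ⟨b, hb⟩ * ⟨a, ha⟩⁻¹ * ⟨b, hb⟩⁻¹ := ⟨_, rfl⟩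
  have h2 : (c :
      s.ser i.succ ⧸ (s.ser i.castSucc).subgroupOf (s.ser i.succ)) = 1 := by
    rw [hc, QuotientGroup.mk_mul, QuotientGroup.mk_mul, QuotientGroup.mk_mul, h1,
      QuotientGroup.mk_inv, QuotientGroup.mk_inv, mul_inv_cancel_right, mul_inv_cancel]
  rw [QuotientGroup.eq_one_iff, Subgroup.mem_subgroupOf, hc] at h2
  exact h2

open scoped Classical in
theorem hasEta_ser (i : Fin (m + 1)) : HasEta (s.ser i)
    (Finset.univ.filter fun j : Fin m => j.castSucc < i ∧ s.NonabelianFactor j).card := by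
  induction i using Fin.induction with
  | zero =>
    rw [Finset.filter_false_of_mem fun j _ h => absurd h.1 (Fin.not_lt_zero _)]
    exact .zero _
  | succ i ih =>
    have hn := s.normal i
    let e := Subgroup.subgroupOfEquivOfLe (s.mono i.castSucc_lt_succ.le)
    have ih' : HasEta ((s.ser i.castSucc).subgroupOf (s.ser i.succ)) _ :=
      ih.of_surjective e.toMonoidHom e.surjective
    by_cases hi : s.NonabelianFactor i
    · have h1 : (Finset.univ.filter fun j : Fin m => j.castSucc < i.succ ∧ s.NonabelianFactor j) =
          insert i (Finset.univ.filter fun j : Fin m =>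
            j.castSucc < i.castSucc ∧ s.NonabelianFactor j) := by
        ext j
        simp only [Finset.mem_filter, Finset.mem_univ, true_and, Finset.mem_insert,
          Fin.castSucc_lt_succ_iff, Fin.castSucc_lt_castSucc_iff, le_iff_eq_or_lt]
        constructor
        · rintro ⟨rfl | h, hj⟩
          · exact .inl rfl
          · exact .inr ⟨h, hj⟩
        · rintro (rfl | ⟨h, hj⟩)
          · exact ⟨.inl rfl, hi⟩
          · exact ⟨.inr h, hj⟩
      rw [h1, Finset.card_insert_of_notMem (by simp)]
      exact .step _ ih' (s.not_isSolvable_quotient hi)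
    · have h1 : (Finset.univ.filter fun j : Fin m => j.castSucc < i.succ ∧ s.NonabelianFactor j) =
          Finset.univ.filter fun j : Fin m =>
            j.castSucc < i.castSucc ∧ s.NonabelianFactor j := by
        refine Finset.filter_congr fun j _ => ?_
        simp only [Fin.castSucc_lt_succ_iff, Fin.castSucc_lt_castSucc_iff, le_iff_eq_or_lt]
        constructor
        · rintro ⟨rfl | h, hj⟩
          · exact absurd hj hi
          · exact ⟨h, hj⟩
        · rintro ⟨h, hj⟩
          exact ⟨.inr h, hj⟩
      rw [h1]
      exact .up _ hn ih'

theorem hasEta : HasEta G (Nat.card {i : Fin m // s.NonabelianFactor i}) := by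
  classical
  have h := s.hasEta_ser (Fin.last m)
  have h1 : (Finset.univ.filter fun j : Fin m =>
      j.castSucc < Fin.last m ∧ s.NonabelianFactor j).card =
      Nat.card {i : Fin m // s.NonabelianFactor i} := by
    rw [Nat.card_eq_fintype_card, Fintype.card_subtype]
    exact congrArg _ (Finset.filter_congr fun j _ => by simp [Fin.castSucc_lt_last])
  rw [h1, s.top_eq] at h
  exact h.of_surjective (Subgroup.topEquiv (G := G)).symm.toMonoidHom (MulEquiv.surjective _)

end CompositionSeriesOf

/-- If `G` is (isomorphic to) a subgroup of the symmetric group `Sym_n`, then the number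
`η(G)` of nonabelian composition factors of `G` is at most `(n - 1)/4`, i.e.
`4 · η(G) ≤ n - 1`. -/
theorem eta_le_of_subgroup_symmetricGroup (n : ℕ) (G : Type*) [Group G]
    (f : G →* Equiv.Perm (Fin n)) (hf : Function.Injective f)
    (m : ℕ) (s : CompositionSeriesOf G m) :
    4 * Nat.card {i : Fin m // s.NonabelianFactor i} ≤ n - 1 := by
  rw [← Nat.card_fin n]
  have h1 := (s.hasEta.of_surjective (MonoidHom.ofInjective hf).symm.toMonoidHom
    (MonoidHom.ofInjective hf).symm.surjective).le_eta
  rcases isEmpty_or_nonempty (Fin n) with hn | hn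
  · rw [eta_eq_zero_of_isSolvable] at h1
    omega
  · have h2 := etaBound (Nat.card (Fin n) + 1) f.range (Fin n) (Nat.lt_succ_self _)
    omega
end

section
/- For every k ≥ 1, setting n = 5^k, the symmetric group Sym_n contains a subgroup G isomorphic to the (k-1)-fold iterated permutational wreath product (...((Alt_5 ≀ Alt_5) ≀ Alt_5)...) ≀ Alt_5 of the alternating group Alt_5, and this subgroup satisfies η(G) = (5^k - 1)/4 = (n-1)/4. In particular, the bound η(G) ≤ (n-1)/4 for subgroups of Sym_n is attained. -/
/-- The action of a permutation of the index type on functions, as a multiplicative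
automorphism of the direct power `ι → M`. -/
def permMulAut {ι : Type*} (M : Type*) [Group M] : Equiv.Perm ι →* MulAut (ι → M) where
  toFun σ :=
    { toFun := fun f => f ∘ σ.symm
      invFun := fun f => f ∘ σ
      left_inv := fun f => by ext i; simp
      right_inv := fun f => by ext i; simp
      map_mul' := fun f g => rfl }
  map_one' := by ext f i; rfl
  map_mul' σ τ := by ext f i; rfl

/-- The permutational action of `Alt_5 ≤ Sym_5` on the direct power `Fin 5 → M`. -/
def altMulAut (M : Type*) [Group M] : alternatingGroup (Fin 5) →* MulAut (Fin 5 → M) :=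
  (permMulAut M).comp (alternatingGroup (Fin 5)).subtype

/-- One step of the permutational wreath product construction: from a group `T`,
form `T ≀ Alt_5 = (Fin 5 → T) ⋊ Alt_5`, where `Alt_5` permutes the five copies of `T`. -/
def wreathStep (p : Σ T : Type, Group T) : Σ T : Type, Group T :=
  letI := p.2
  ⟨SemidirectProduct (Fin 5 → p.1) (alternatingGroup (Fin 5)) (altMulAut p.1),
    inferInstance⟩

/-- The iterated permutational wreath product: `iterWreath 0 = Alt_5` and
`iterWreath (j + 1) = (iterWreath j) ≀ Alt_5`, so `iterWreath j` is the `j`-fold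
iterated wreath product `(...((Alt_5 ≀ Alt_5) ≀ Alt_5)...) ≀ Alt_5`. -/
def iterWreath : ℕ → Σ T : Type, Group T
  | 0 => ⟨alternatingGroup (Fin 5), inferInstance⟩
  | j + 1 => wreathStep (iterWreath j)

/-- The group structure on the iterated wreath product. -/
instance iterWreathGroup (j : ℕ) : Group (iterWreath j).1 := (iterWreath j).2

/-- `H` is normal in `K` and `K / H` is simple or trivial. -/
structure IsSimpleStep {G : Type*} [Group G] (H K : Subgroup G) : Prop where
  le : H ≤ K
  conj_mem : ∀ k ∈ K, ∀ h ∈ H, k * h * k⁻¹ ∈ H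
  eq_or_eq : ∀ L : Subgroup G, H ≤ L → L ≤ K → (∀ k ∈ K, ∀ l ∈ L, k * l * k⁻¹ ∈ L) →
    L = H ∨ L = K

/-- Some commutator of elements of `K` lies outside `H`. -/
def IsNoncommStep {G : Type*} [Group G] (H K : Subgroup G) : Prop :=
  ∃ a ∈ K, ∃ b ∈ K, a * b * a⁻¹ * b⁻¹ ∉ H

/-- There is a subnormal chain from `⊥` to `K` with simple or trivial factors, exactly `n` of
which are nonabelian. -/
inductive HasSubnormalChain {G : Type*} [Group G] : Subgroup G → ℕ → Prop
  | bot : HasSubnormalChain ⊥ 0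
  | noncomm {H K : Subgroup G} {n : ℕ} : HasSubnormalChain H n → IsSimpleStep H K →
      IsNoncommStep H K → HasSubnormalChain K (n + 1)
  | comm {H K : Subgroup G} {n : ℕ} : HasSubnormalChain H n → IsSimpleStep H K →
      ¬ IsNoncommStep H K → HasSubnormalChain K n

/-- Every subnormal chain of `G` with simple or trivial factors has exactly `n` nonabelian
factors. -/
def HasEta_s3 (G : Type*) [Group G] (n : ℕ) : Prop :=
  ∀ m : ℕ, HasSubnormalChain (⊤ : Subgroup G) m → m = n

section Steps

variable {G N Q : Type*} [Group G] [Group N] [Group Q] {H K : Subgroup G}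

theorem IsNoncommStep.not_le (h : IsNoncommStep H K) : ¬ K ≤ H := by
  obtain ⟨a, ha, b, hb, hab⟩ := h
  exact fun hle => hab (hle (mul_mem (mul_mem (mul_mem ha hb) (inv_mem ha)) (inv_mem hb)))

theorem IsSimpleStep.map (h : IsSimpleStep H K) (f : G →* Q) :
    IsSimpleStep (H.map f) (K.map f) where
  le := Subgroup.map_mono h.le
  conj_mem := by
    rintro _ ⟨k, hk, rfl⟩ _ ⟨x, hx, rfl⟩
    exact ⟨k * x * k⁻¹, h.conj_mem k hk x hx, by simp⟩
  eq_or_eq L hHL hLK hL := by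
    have hmap : (K ⊓ L.comap f).map f = L := by
      refine le_antisymm ?_ fun y hy => ?_
      · rintro _ ⟨x, hx, rfl⟩
        exact hx.2
      · obtain ⟨x, hx, rfl⟩ := hLK hy
        exact ⟨x, ⟨hx, hy⟩, rfl⟩
    have hnorm : ∀ k ∈ K, ∀ l ∈ K ⊓ L.comap f, k * l * k⁻¹ ∈ K ⊓ L.comap f := by
      rintro k hk l ⟨hlK, hlL⟩
      refine ⟨K.mul_mem (K.mul_mem hk hlK) (K.inv_mem hk), ?_⟩
      simpa using hL (f k) ⟨k, hk, rfl⟩ (f l) hlL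
    rcases h.eq_or_eq (K ⊓ L.comap f) (le_inf h.le (Subgroup.map_le_iff_le_comap.1 hHL))
      inf_le_left hnorm with h' | h'
    · exact .inl (by rw [← hmap, h'])
    · exact .inr (by rw [← hmap, h'])

/-- A simple step of `G` survives in exactly one of the image and the kernel of a homomorphism. -/
theorem IsSimpleStep.map_eq_or_inf_ker_le (h : IsSimpleStep H K) (f : G →* Q) :
    K.map f = H.map f ∨ K ⊓ f.ker ≤ H := by
  have hnorm : ∀ k ∈ K, ∀ l ∈ K ⊓ (H.map f).comap f, k * l * k⁻¹ ∈ K ⊓ (H.map f).comap f := by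
    rintro k hk l ⟨hlK, x, hx, hxl⟩
    exact ⟨K.mul_mem (K.mul_mem hk hlK) (K.inv_mem hk),
      k * x * k⁻¹, h.conj_mem k hk x hx, by simp [hxl]⟩
  rcases h.eq_or_eq (K ⊓ (H.map f).comap f)
    (le_inf h.le (Subgroup.le_comap_map f H)) inf_le_left hnorm with h' | h'
  · right
    rintro x ⟨hxK, hx⟩
    rw [← h']
    exact ⟨hxK, 1, one_mem _, by simpa using (MonoidHom.mem_ker.1 hx).symm⟩
  · left
    refine le_antisymm ?_ (Subgroup.map_mono h.le)
    rw [Subgroup.map_le_iff_le_comap]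
    exact inf_eq_left.1 h'

theorem mem_of_map_mem_map {f : G →* Q} (hHK : H ≤ K) (hker : K ⊓ f.ker ≤ H) {x : G}
    (hx : x ∈ K) (hfx : f x ∈ H.map f) : x ∈ H := by
  obtain ⟨y, hy, hyx⟩ := hfx
  have hyx' : f (y⁻¹ * x) = 1 := by simp [hyx]
  have : y⁻¹ * x ∈ H := hker ⟨K.mul_mem (K.inv_mem (hHK hy)) hx, hyx'⟩
  simpa using mul_mem hy this

theorem isNoncommStep_map_iff {f : G →* Q} (hHK : H ≤ K) (hker : K ⊓ f.ker ≤ H) :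
    IsNoncommStep (H.map f) (K.map f) ↔ IsNoncommStep H K := by
  constructor
  · rintro ⟨_, ⟨a, ha, rfl⟩, _, ⟨b, hb, rfl⟩, hab⟩
    exact ⟨a, ha, b, hb, fun hc => hab ⟨_, hc, by simp⟩⟩
  · rintro ⟨a, ha, b, hb, hab⟩
    refine ⟨f a, ⟨a, ha, rfl⟩, f b, ⟨b, hb, rfl⟩, fun hc => hab ?_⟩
    refine mem_of_map_mem_map hHK hker
      (mul_mem (mul_mem (mul_mem ha hb) (inv_mem ha)) (inv_mem hb)) ?_
    simpa using hc

theorem exists_mul_of_map_eq {f : G →* Q} {i : N →* G} (hi : i.range = f.ker) (hHK : H ≤ K)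
    (hmap : K.map f = H.map f) {x : G} (hx : x ∈ K) :
    ∃ y ∈ H, ∃ n ∈ K.comap i, x = y * i n := by
  obtain ⟨y, hy, hyx⟩ : f x ∈ H.map f := hmap ▸ ⟨x, hx, rfl⟩
  obtain ⟨n, hn⟩ : y⁻¹ * x ∈ i.range := by rw [hi, MonoidHom.mem_ker]; simp [hyx]
  exact ⟨y, hy, n, show i n ∈ K from hn ▸ mul_mem (inv_mem (hHK hy)) hx, by simp [hn]⟩

theorem IsSimpleStep.comap {f : G →* Q} {i : N →* G} (hi : i.range = f.ker)
    (h : IsSimpleStep H K) : IsSimpleStep (H.comap i) (K.comap i) where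
  le := Subgroup.comap_mono h.le
  conj_mem k hk x hx := by
    simpa using h.conj_mem (i k) hk (i x) hx
  eq_or_eq L hHL hLK hL := by
    rcases h.map_eq_or_inf_ker_le f with hmap | hker
    swap
    · left
      refine le_antisymm (hLK.trans fun x hx => hker ⟨hx, ?_⟩) hHL
      rw [← hi]
      exact ⟨x, rfl⟩
    have hLK' : L.map i ≤ K := Subgroup.map_le_iff_le_comap.2 hLK
    have hnorm : L.map i ≤ Subgroup.normalizer (H : Set G) := by
      rw [Subgroup.le_normalizer_iff]
      exact fun l hl x hx => h.conj_mem l (hLK' hl) x hx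
    have hmem (x : G) : x ∈ L.map i ⊔ H ↔ ∃ l ∈ L, ∃ y ∈ H, i l * y = x := by
      rw [← SetLike.mem_coe, Subgroup.coe_mul_of_left_le_normalizer_right _ _ hnorm]
      simp [Set.mem_mul]
    have hconj : ∀ k ∈ K, ∀ x ∈ L.map i ⊔ H, k * x * k⁻¹ ∈ L.map i ⊔ H := by
      have hbase : ∀ k ∈ K, ∀ l ∈ L, k * i l * k⁻¹ ∈ L.map i ⊔ H := by
        intro k hk l hl
        obtain ⟨y, hy, n, hn, rfl⟩ := exists_mul_of_map_eq hi h.le hmap hk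
        have hl' : n * l * n⁻¹ ∈ L := hL n hn l hl
        have e : y * i n * i l * (y * i n)⁻¹ = y * i (n * l * n⁻¹) * y⁻¹ := by
          simp [mul_assoc]
        rw [e]
        have hy' : y ∈ L.map i ⊔ H := Subgroup.mem_sup_right hy
        exact mul_mem (mul_mem hy' (Subgroup.mem_sup_left ⟨_, hl', rfl⟩)) (inv_mem hy')
      intro k hk x hx
      obtain ⟨l, hl, y, hy, rfl⟩ := (hmem x).1 hx
      have e : k * (i l * y) * k⁻¹ = (k * i l * k⁻¹) * (k * y * k⁻¹) := by group
      rw [e]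
      exact mul_mem (hbase k hk l hl) (Subgroup.mem_sup_right (h.conj_mem k hk y hy))
    rcases h.eq_or_eq (L.map i ⊔ H) le_sup_right (sup_le hLK' h.le) hconj with h' | h'
    · left
      refine le_antisymm (fun l hl => ?_) hHL
      change i l ∈ H
      rw [← h']
      exact Subgroup.mem_sup_left ⟨l, hl, rfl⟩
    · right
      refine le_antisymm hLK fun n hn => ?_
      obtain ⟨l, hl, y, hy, hly⟩ := (hmem (i n)).1 (h' ▸ hn)
      have : l⁻¹ * n ∈ H.comap i := by
        change i (l⁻¹ * n) ∈ H
        simpa [← hly] using hy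
      simpa using mul_mem hl (hHL this)

theorem isNoncommStep_comap_iff {f : G →* Q} {i : N →* G} (hi : i.range = f.ker)
    (h : IsSimpleStep H K) (hmap : K.map f = H.map f) :
    IsNoncommStep (H.comap i) (K.comap i) ↔ IsNoncommStep H K := by
  constructor
  · rintro ⟨a, ha, b, hb, hab⟩
    exact ⟨i a, ha, i b, hb, fun hc => hab (by simpa using hc)⟩
  · rintro ⟨a, ha, b, hb, hab⟩
    obtain ⟨y, hy, m, hm, rfl⟩ := exists_mul_of_map_eq hi h.le hmap ha
    obtain ⟨z, hz, n, hn, rfl⟩ := exists_mul_of_map_eq hi h.le hmap hb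
    refine ⟨m, hm, n, hn, fun hc => hab ?_⟩
    have hc' : i m * i n * (i m)⁻¹ * (i n)⁻¹ ∈ H := by simpa using hc
    have hm' : i m ∈ K := hm
    have hn' : i n ∈ K := hn
    have e : y * i m * (z * i n) * (y * i m)⁻¹ * (z * i n)⁻¹ =
        y * (i m * z * (i m)⁻¹) * (i m * i n * (i m)⁻¹ * (i n)⁻¹) *
          (i n * y⁻¹ * (i n)⁻¹) * z⁻¹ := by group
    rw [e]
    exact mul_mem (mul_mem (mul_mem (mul_mem hy (h.conj_mem _ hm' _ hz)) hc')
      (h.conj_mem _ hn' _ (inv_mem hy))) (inv_mem hz)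

theorem HasSubnormalChain.exists_comap_map {f : G →* Q} {i : N →* G}
    (hinj : Function.Injective i) (hi : i.range = f.ker) {n : ℕ} (h : HasSubnormalChain K n) :
    ∃ a b, HasSubnormalChain (K.comap i) a ∧ HasSubnormalChain (K.map f) b ∧ n = a + b := by
  have hker {H K : Subgroup G} (hle : K ⊓ f.ker ≤ H) : K.comap i ≤ H.comap i :=
    fun x hx => hle ⟨hx, hi ▸ ⟨x, rfl⟩⟩
  induction h with
  | bot =>
    refine ⟨0, 0, ?_, ?_, rfl⟩
    · rw [MonoidHom.comap_bot, (MonoidHom.ker_eq_bot_iff i).2 hinj]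
      exact .bot
    · rw [Subgroup.map_bot]
      exact .bot
  | noncomm _ hs hnc ih =>
    obtain ⟨a, b, ha, hb, rfl⟩ := ih
    rcases hs.map_eq_or_inf_ker_le f with hmap | hle
    · exact ⟨a + 1, b, .noncomm ha (hs.comap hi) ((isNoncommStep_comap_iff hi hs hmap).2 hnc),
        hmap ▸ hb, by omega⟩
    · exact ⟨a, b + 1, .comm ha (hs.comap hi) fun h => h.not_le (hker hle),
        .noncomm hb (hs.map f) ((isNoncommStep_map_iff hs.le hle).2 hnc), by omega⟩
  | comm _ hs hnc ih =>
    obtain ⟨a, b, ha, hb, rfl⟩ := ih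
    rcases hs.map_eq_or_inf_ker_le f with hmap | hle
    · exact ⟨a, b, .comm ha (hs.comap hi) (mt (isNoncommStep_comap_iff hi hs hmap).1 hnc),
        hmap ▸ hb, rfl⟩
    · exact ⟨a, b, .comm ha (hs.comap hi) fun h => h.not_le (hker hle),
        .comm hb (hs.map f) (mt (isNoncommStep_map_iff hs.le hle).1 hnc), rfl⟩

theorem HasSubnormalChain.eq_zero_of_eq_bot {n : ℕ} (h : HasSubnormalChain K n) (hK : K = ⊥) :
    n = 0 := by
  induction h with
  | bot => rfl
  | noncomm _ _ hnc => exact absurd (hK ▸ bot_le) hnc.not_le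
  | comm _ hs _ ih => exact ih (le_bot_iff.1 (hK ▸ hs.le))

theorem HasEta_s3.of_extension {f : G →* Q} {i : N →* G} (hf : Function.Surjective f)
    (hinj : Function.Injective i) (hi : i.range = f.ker) {a b : ℕ} (hN : HasEta_s3 N a)
    (hQ : HasEta_s3 Q b) : HasEta_s3 G (a + b) := by
  intro m hm
  obtain ⟨a', b', ha, hb, rfl⟩ := hm.exists_comap_map hinj hi
  rw [Subgroup.comap_top] at ha
  rw [Subgroup.map_top_of_surjective f hf] at hb
  rw [hN a' ha, hQ b' hb]

theorem HasEta_s3.of_subsingleton [Subsingleton G] : HasEta_s3 G 0 :=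
  fun _ h => h.eq_zero_of_eq_bot (Subsingleton.elim _ _)

theorem HasEta_s3.of_mulEquiv {n : ℕ} (h : HasEta_s3 Q n) (e : G ≃* Q) : HasEta_s3 G n := by
  have := HasEta_s3.of_extension (f := e.toMonoidHom) (i := (⊥ : Subgroup G).subtype) e.surjective
    (Subgroup.subtype_injective _)
    (by rw [Subgroup.range_subtype, (MonoidHom.ker_eq_bot_iff e.toMonoidHom).2 e.injective])
    HasEta_s3.of_subsingleton h
  rwa [zero_add] at this

theorem HasEta_s3.of_isSimpleGroup [IsSimpleGroup G] (hG : ∃ a b : G, a * b * a⁻¹ * b⁻¹ ≠ 1) :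
    HasEta_s3 G 1 := by
  have aux {H : Subgroup G} (hs : IsSimpleStep H ⊤) : H = ⊥ ∨ H = ⊤ :=
    Subgroup.Normal.eq_bot_or_eq_top ⟨fun h hh k => hs.conj_mem k trivial h hh⟩
  intro m hm
  generalize hK : (⊤ : Subgroup G) = K at hm
  induction hm with
  | bot => exact absurd hK top_ne_bot
  | noncomm hc hs hnc ih =>
    subst hK
    rcases aux hs with rfl | rfl
    · rw [hc.eq_zero_of_eq_bot rfl]
    · exact absurd le_rfl hnc.not_le
  | comm hc hs hnc ih =>
    subst hK
    rcases aux hs with rfl | rfl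
    · obtain ⟨a, b, hab⟩ := hG
      exact absurd ⟨a, trivial, b, trivial, by simpa using hab⟩ hnc
    · exact ih rfl

theorem HasEta_s3.pi {a : ℕ} (hG : HasEta_s3 G a) (n : ℕ) : HasEta_s3 (Fin n → G) (n * a) := by
  induction n with
  | zero => simpa using HasEta_s3.of_subsingleton
  | succ n ih =>
    let f : (Fin (n + 1) → G) →* (Fin n → G) :=
      { toFun := fun g j => g j.succ
        map_one' := rfl
        map_mul' := fun _ _ => rfl }
    have hf : Function.Surjective f := fun g => ⟨Fin.cons 1 g, funext fun j => by simp [f]⟩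
    have hi : (MonoidHom.mulSingle (fun _ : Fin (n + 1) => G) 0).range = f.ker := by
      ext g
      constructor
      · rintro ⟨x, rfl⟩
        rw [MonoidHom.mem_ker]
        ext j
        simp [f]
      · intro hg
        refine ⟨g 0, funext fun j => ?_⟩
        refine Fin.cases (by simp) (fun j => ?_) j
        have : g j.succ = 1 := congrFun (MonoidHom.mem_ker.1 hg) j
        simp [this]
    have := HasEta_s3.of_extension hf
      (i := MonoidHom.mulSingle (fun _ : Fin (n + 1) => G) 0)
      (Pi.mulSingle_injective (M := fun _ : Fin (n + 1) => G) 0) hi hG ih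
    rwa [Nat.succ_mul, add_comm (n * a)]

theorem HasEta_s3.semidirectProduct {φ : Q →* MulAut N} {a b : ℕ} (hN : HasEta_s3 N a)
    (hQ : HasEta_s3 Q b) : HasEta_s3 (N ⋊[φ] Q) (a + b) :=
  HasEta_s3.of_extension SemidirectProduct.rightHom_surjective SemidirectProduct.inl_injective
    SemidirectProduct.range_inl_eq_ker_rightHom hN hQ

end Steps

section CompositionSeries

variable {G : Type*} [Group G] {H K : Subgroup G}

theorem isSimpleStep_of_isSimpleGroup (hle : H ≤ K) [hn : (H.subgroupOf K).Normal]
    [hs : IsSimpleGroup (K ⧸ H.subgroupOf K)] : IsSimpleStep H K where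
  le := hle
  conj_mem k hk h hh := by
    simpa [Subgroup.mem_subgroupOf] using hn.conj_mem ⟨h, hle hh⟩ hh ⟨k, hk⟩
  eq_or_eq L hHL hLK hL := by
    have hLn : (L.subgroupOf K).Normal := ⟨fun l hl k => hL k k.2 l hl⟩
    rcases (hLn.map (QuotientGroup.mk' (H.subgroupOf K))
      (QuotientGroup.mk'_surjective _)).eq_bot_or_eq_top with h | h
    · left
      refine le_antisymm (fun x hx => ?_) hHL
      have : QuotientGroup.mk' (H.subgroupOf K) ⟨x, hLK hx⟩ ∈
          (L.subgroupOf K).map (QuotientGroup.mk' (H.subgroupOf K)) := ⟨⟨x, hLK hx⟩, hx, rfl⟩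
      rw [h, Subgroup.mem_bot, QuotientGroup.mk'_apply, QuotientGroup.eq_one_iff] at this
      exact this
    · right
      refine le_antisymm hLK fun x hx => ?_
      have : QuotientGroup.mk' (H.subgroupOf K) ⟨x, hx⟩ ∈
          (L.subgroupOf K).map (QuotientGroup.mk' (H.subgroupOf K)) := h ▸ trivial
      obtain ⟨l, hl, hlx⟩ := this
      rw [QuotientGroup.mk'_apply, QuotientGroup.mk'_apply, QuotientGroup.eq] at hlx
      have : (l : G)⁻¹ * x ∈ H := hlx
      have hl' : (l : G) ∈ L := hl
      simpa using mul_mem hl' (hHL this)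

theorem IsSimpleStep.normal (h : IsSimpleStep H K) : (H.subgroupOf K).Normal :=
  ⟨fun x hx k => h.conj_mem k k.2 x hx⟩

theorem IsSimpleStep.isSimpleGroup (h : IsSimpleStep H K) (hne : H ≠ K)
    [(H.subgroupOf K).Normal] : IsSimpleGroup (K ⧸ H.subgroupOf K) where
  exists_pair_ne := by
    obtain ⟨x, hxK, hxH⟩ := SetLike.exists_of_lt (lt_of_le_of_ne h.le hne)
    refine ⟨QuotientGroup.mk ⟨x, hxK⟩, 1, fun hx => hxH ?_⟩
    rw [QuotientGroup.eq_one_iff] at hx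
    exact hx
  eq_bot_or_eq_top_of_normal M hM := by
    let q := QuotientGroup.mk' (H.subgroupOf K)
    have hq : Function.Surjective q := QuotientGroup.mk'_surjective _
    have hmem (x : K) : (x : G) ∈ (M.comap q).map K.subtype ↔ q x ∈ M := by
      simp
    have hHM : H ≤ (M.comap q).map K.subtype := by
      intro x hx
      refine (hmem ⟨x, h.le hx⟩).2 ?_
      have : q ⟨x, h.le hx⟩ = 1 := (QuotientGroup.eq_one_iff _).2 hx
      rw [this]
      exact one_mem M
    have hMK : (M.comap q).map K.subtype ≤ K := by
      rintro _ ⟨x, -, rfl⟩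
      exact x.2
    have hconj : ∀ k ∈ K, ∀ l ∈ (M.comap q).map K.subtype,
        k * l * k⁻¹ ∈ (M.comap q).map K.subtype := by
      rintro k hk _ ⟨x, hx, rfl⟩
      refine (hmem (⟨k, hk⟩ * x * ⟨k, hk⟩⁻¹)).2 ?_
      rw [map_mul, map_mul, map_inv]
      exact hM.conj_mem _ hx _
    rcases h.eq_or_eq ((M.comap q).map K.subtype) hHM hMK hconj with h' | h'
    · left
      rw [eq_bot_iff]
      intro y hy
      obtain ⟨x, rfl⟩ := hq y
      have hx : (x : G) ∈ H := h' ▸ (hmem x).2 hy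
      rw [Subgroup.mem_bot]
      exact (QuotientGroup.eq_one_iff x).2 hx
    · right
      rw [eq_top_iff]
      intro y _
      obtain ⟨x, rfl⟩ := hq y
      exact (hmem x).1 (h'.symm ▸ x.2 : (x : G) ∈ _)

theorem CompositionSeriesOf.hasSubnormalChain {m : ℕ} (s : CompositionSeriesOf G m) :
    HasSubnormalChain (⊤ : Subgroup G) (Nat.card {i : Fin m // s.NonabelianFactor i}) := by
  classical
  have key (j : ℕ) (hj : j < m + 1) : HasSubnormalChain (s.ser ⟨j, hj⟩)
      (Finset.univ.filter fun i : Fin m => i.val < j ∧ s.NonabelianFactor i).card := by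
    induction j with
    | zero =>
      have : s.ser ⟨0, hj⟩ = ⊥ := s.bot_eq
      rw [this]
      simpa using HasSubnormalChain.bot (G := G)
    | succ j ih =>
      let i : Fin m := ⟨j, by omega⟩
      have hs : IsSimpleStep (s.ser i.castSucc) (s.ser i.succ) := by
        have := s.normal i
        have := s.simple i
        exact isSimpleStep_of_isSimpleGroup (s.mono i.castSucc_lt_succ.le)
      have ih' : HasSubnormalChain (s.ser i.castSucc) _ := ih (by omega)
      by_cases hi : s.NonabelianFactor i
      · have e : (Finset.univ.filter fun l : Fin m => l.val < j + 1 ∧ s.NonabelianFactor l) =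
            insert i (Finset.univ.filter fun l : Fin m => l.val < j ∧ s.NonabelianFactor l) := by
          ext l
          simp only [Finset.mem_filter, Finset.mem_univ, true_and, Finset.mem_insert,
            Nat.lt_succ_iff_lt_or_eq]
          have : l = i ↔ l.val = j := Fin.ext_iff
          constructor
          · rintro ⟨h | h, hl⟩
            · exact .inr ⟨h, hl⟩
            · exact .inl (this.2 h)
          · rintro (rfl | h)
            · exact ⟨.inr rfl, hi⟩
            · exact ⟨.inl h.1, h.2⟩
        rw [e, Finset.card_insert_of_notMem (by simp [i])]
        exact .noncomm ih' hs hi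
      · have e : (Finset.univ.filter fun l : Fin m => l.val < j + 1 ∧ s.NonabelianFactor l) =
            Finset.univ.filter fun l : Fin m => l.val < j ∧ s.NonabelianFactor l := by
          ext l
          simp only [Finset.mem_filter, Finset.mem_univ, true_and, Nat.lt_succ_iff_lt_or_eq]
          have : l = i ↔ l.val = j := Fin.ext_iff
          constructor
          · rintro ⟨h | h, hl⟩
            · exact ⟨h, hl⟩
            · exact absurd (this.2 h ▸ hl) hi
          · exact fun h => ⟨.inl h.1, h.2⟩
        rw [e]
        exact .comm ih' hs hi
  have := key m (Nat.lt_succ_self m)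
  have htop : s.ser ⟨m, Nat.lt_succ_self m⟩ = ⊤ := s.top_eq
  rw [htop] at this
  rw [Nat.card_eq_fintype_card, Fintype.card_subtype]
  simpa using this

theorem exists_isSimpleStep [Finite G] (hK : K ≠ ⊥) : ∃ H < K, IsSimpleStep H K := by
  let S : Set (Subgroup G) := {H | H < K ∧ ∀ k ∈ K, ∀ h ∈ H, k * h * k⁻¹ ∈ H}
  have hS : S.Nonempty := ⟨⊥, bot_lt_iff_ne_bot.2 hK, by simp [Subgroup.mem_bot]⟩
  obtain ⟨H, hH⟩ := (Set.toFinite S).exists_maximal hS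
  refine ⟨H, hH.prop.1, hH.prop.1.le, hH.prop.2, fun L hHL hLK hL => ?_⟩
  rcases hLK.eq_or_lt with h | h
  · exact .inr h
  · exact .inl (le_antisymm (hH.le_of_ge ⟨h, hL⟩ hHL) hHL)

theorem exists_series [Finite G] (K : Subgroup G) :
    ∃ (m : ℕ) (ser : Fin (m + 1) → Subgroup G), ser 0 = ⊥ ∧ ser (Fin.last m) = K ∧
      ∀ i : Fin m, ser i.castSucc < ser i.succ ∧ IsSimpleStep (ser i.castSucc) (ser i.succ) := by
  induction K using WellFoundedLT.induction with
  | ind K ih =>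
    by_cases hK : K = ⊥
    · exact ⟨0, fun _ => ⊥, rfl, hK.symm, fun i => i.elim0⟩
    · obtain ⟨H, hlt, hs⟩ := exists_isSimpleStep hK
      obtain ⟨m, ser, h0, hl, hser⟩ := ih H hlt
      refine ⟨m + 1, Fin.snoc ser K, ?_, by simp, fun i => ?_⟩
      · rw [← Fin.castSucc_zero, Fin.snoc_castSucc, h0]
      · refine Fin.lastCases ?_ (fun i => ?_) i
        · rw [Fin.succ_last, Fin.snoc_last, Fin.snoc_castSucc, hl]
          exact ⟨hlt, hs⟩
        · rw [← Fin.castSucc_succ, Fin.snoc_castSucc, Fin.snoc_castSucc]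
          exact hser i

variable (G) in
theorem exists_compositionSeriesOf [Finite G] : ∃ m, Nonempty (CompositionSeriesOf G m) := by
  obtain ⟨m, ser, h0, hl, hser⟩ := exists_series (⊤ : Subgroup G)
  exact ⟨m, ⟨{
    ser := ser
    bot_eq := h0
    top_eq := hl
    mono := Fin.monotone_iff_le_succ.2 fun i => (hser i).1.le
    normal := fun i => (hser i).2.normal
    simple := fun i =>
      haveI := (hser i).2.normal
      (hser i).2.isSimpleGroup (hser i).1.ne }⟩⟩

end CompositionSeries

section IterWreath

/-- The imprimitive action of the wreath product on `Fin 5 × X`. -/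
def wreathToPerm {T X : Type*} [Group T] (ρ : T →* Equiv.Perm X) :
    ((Fin 5 → T) ⋊[altMulAut T] alternatingGroup (Fin 5)) →* Equiv.Perm (Fin 5 × X) :=
  MonoidHom.toHomPerm
    { toFun := fun g p => (g.right.1 p.1, ρ (g.left (g.right.1 p.1)) p.2)
      map_one' := funext fun p : Fin 5 × X => by simp; rfl
      map_mul' := fun g h => by
        refine funext fun p : Fin 5 × X => ?_
        change ((g.right * h.right).1 p.1,
          ρ ((g.left * altMulAut T g.right h.left) ((g.right * h.right).1 p.1)) p.2) =
            (g.right.1 (h.right.1 p.1), ρ (g.left (g.right.1 (h.right.1 p.1)))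
          (ρ (h.left (h.right.1 p.1)) p.2))
        simp [altMulAut, permMulAut] }

theorem wreathToPerm_apply {T X : Type*} [Group T] (ρ : T →* Equiv.Perm X)
    (g : (Fin 5 → T) ⋊[altMulAut T] alternatingGroup (Fin 5)) (p : Fin 5 × X) :
    wreathToPerm ρ g p = (g.right.1 p.1, ρ (g.left (g.right.1 p.1)) p.2) := rfl

theorem wreathToPerm_injective {T X : Type*} [Group T] [Nonempty X] {ρ : T →* Equiv.Perm X}
    (hρ : Function.Injective ρ) : Function.Injective (wreathToPerm ρ) := by
  intro g h hgh
  have hp (i : Fin 5) (x : X) := Prod.ext_iff.1 (Equiv.congr_fun hgh (i, x))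
  simp only [wreathToPerm_apply] at hp
  have hr : g.right = h.right :=
    Subtype.ext (Equiv.ext fun i => (hp i (Classical.arbitrary X)).1)
  refine SemidirectProduct.ext (funext fun j => hρ (Equiv.ext fun x => ?_)) hr
  have := (hp (h.right.1.symm j) x).2
  simpa [hr] using this

theorem exists_injective_iterWreath_perm (j : ℕ) :
    ∃ ρ : (iterWreath j).1 →* Equiv.Perm (Fin (5 ^ (j + 1))), Function.Injective ρ := by
  induction j with
  | zero => exact ⟨(alternatingGroup (Fin 5)).subtype, Subgroup.subtype_injective _⟩
  | succ j ih =>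
    obtain ⟨ρ, hρ⟩ := ih
    have : Nonempty (Fin (5 ^ (j + 1))) := ⟨⟨0, by positivity⟩⟩
    let e : Fin 5 × Fin (5 ^ (j + 1)) ≃ Fin (5 ^ (j + 1 + 1)) :=
      finProdFinEquiv.trans (finCongr (pow_succ' 5 (j + 1)).symm)
    exact ⟨e.permCongrHom.toMonoidHom.comp (wreathToPerm ρ),
      e.permCongrHom.injective.comp (wreathToPerm_injective hρ)⟩

theorem hasEta_alternatingGroup_five : HasEta_s3 (alternatingGroup (Fin 5)) 1 := by
  refine HasEta_s3.of_isSimpleGroup ?_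
  by_contra! h
  have hc : IsMulCommutative (alternatingGroup (Fin 5)) :=
    ⟨⟨fun a b => by simpa [mul_inv_eq_iff_eq_mul] using h a b⟩⟩
  have := alternatingGroup.isMulCommutative_iff_card_le_three.1 hc
  simp at this

theorem hasEta_iterWreath (j : ℕ) : HasEta_s3 (iterWreath j).1 ((5 ^ (j + 1) - 1) / 4) := by
  induction j with
  | zero => exact hasEta_alternatingGroup_five
  | succ j ih =>
    have h := HasEta_s3.semidirectProduct (φ := altMulAut (iterWreath j).1) (ih.pi 5)
      hasEta_alternatingGroup_five
    have hmod : 5 ^ (j + 1) % 4 = 1 := by simp [Nat.pow_mod]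
    have e : (5 ^ (j + 1 + 1) - 1) / 4 = 5 * ((5 ^ (j + 1) - 1) / 4) + 1 := by
      rw [pow_succ 5 (j + 1)]
      omega
    rw [e]
    exact h

end IterWreath

/-- For every `k ≥ 1` and `n = 5^k`, the symmetric group `Sym_n` contains a subgroup `G`
isomorphic to the `(k-1)`-fold iterated permutational wreath product
`(...((Alt_5 ≀ Alt_5) ≀ Alt_5)...) ≀ Alt_5`, and this subgroup satisfies
`η(G) = (5^k - 1)/4 = (n - 1)/4`; in particular, the bound `η(G) ≤ (n-1)/4` for
subgroups of `Sym_n` is attained. -/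
theorem exists_subgroup_isom_iterWreath_eta_eq (k : ℕ) (hk : 1 ≤ k) :
    ∃ G : Subgroup (Equiv.Perm (Fin (5 ^ k))),
      Nonempty (G ≃* (iterWreath (k - 1)).1) ∧
      (∃ m : ℕ, Nonempty (CompositionSeriesOf G m)) ∧
      ∀ m : ℕ, ∀ s : CompositionSeriesOf G m,
        Nat.card {i : Fin m // s.NonabelianFactor i} = (5 ^ k - 1) / 4 := by
  obtain ⟨j, rfl⟩ : ∃ j, k = j + 1 := ⟨k - 1, by omega⟩
  rw [Nat.add_sub_cancel]
  obtain ⟨ρ, hρ⟩ := exists_injective_iterWreath_perm j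
  let e := MonoidHom.ofInjective hρ
  exact ⟨ρ.range, ⟨e.symm⟩, exists_compositionSeriesOf _, fun m s =>
    (hasEta_iterWreath j).of_mulEquiv e.symm _ s.hasSubnormalChain⟩
end

section
/- If G is a locally finite, locally soluble, simple group, then G is cyclic (hence trivial or cyclic of prime order). -/
/-- A group is locally finite if every finitely generated subgroup is finite. -/
def LocallyFiniteGroup (G : Type*) [Group G] : Prop :=
  ∀ s : Finset G, Finite (Subgroup.closure (s : Set G))

/-- A group is locally soluble if every finitely generated subgroup is soluble. -/
def LocallySolubleGroup (G : Type*) [Group G] : Prop :=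
  ∀ s : Finset G, IsSolvable (Subgroup.closure (s : Set G))

open scoped commutatorElement

/-- Membership in the normal closure of an element `c` is witnessed by finitely many conjugators. -/
theorem exists_finset_of_mem_normalClosure_singleton {G : Type*} [Group G] {c x : G}
    (hx : x ∈ Subgroup.normalClosure {c}) :
    ∃ T : Finset G, ∀ K : Subgroup G, c ∈ K →
      (∀ g ∈ T, ∀ k ∈ K, g * k * g⁻¹ ∈ K) → x ∈ K := by
  classical
  unfold Subgroup.normalClosure at hx
  induction hx using Subgroup.closure_induction with
  | mem y hy =>
    obtain ⟨z, hz, hzy⟩ := Group.mem_conjugatesOfSet_iff.1 hy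
    rw [Set.mem_singleton_iff] at hz
    subst hz
    obtain ⟨g, rfl⟩ := isConj_iff.1 hzy
    exact ⟨{g}, fun K hc hK => hK g (Finset.mem_singleton_self g) _ hc⟩
  | one => exact ⟨∅, fun K _ _ => K.one_mem⟩
  | mul y z _ _ hy hz =>
    obtain ⟨S, hS⟩ := hy
    obtain ⟨T, hT⟩ := hz
    exact ⟨S ∪ T, fun K hc hK => K.mul_mem
      (hS K hc fun g hg => hK g (Finset.mem_union_left _ hg))
      (hT K hc fun g hg => hK g (Finset.mem_union_right _ hg))⟩
  | inv y _ hy =>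
    obtain ⟨S, hS⟩ := hy
    exact ⟨S, fun K hc hK => K.inv_mem (hS K hc hK)⟩

/-- In a locally soluble group, two elements lying in the normal closure of their commutator
commute. -/
theorem LocallySolubleGroup.commutatorElement_eq_one {G : Type*} [Group G]
    (hsol : LocallySolubleGroup G) {a b : G}
    (ha : a ∈ Subgroup.normalClosure {⁅a, b⁆}) (hb : b ∈ Subgroup.normalClosure {⁅a, b⁆}) :
    ⁅a, b⁆ = 1 := by
  classical
  obtain ⟨S, hS⟩ := exists_finset_of_mem_normalClosure_singleton ha
  obtain ⟨T, hT⟩ := exists_finset_of_mem_normalClosure_singleton hb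
  have hsub := Subgroup.subset_closure (k := ((insert a (insert b (S ∪ T)) : Finset G) : Set G))
  have hsolv := hsol (insert a (insert b (S ∪ T)))
  generalize Subgroup.closure ((insert a (insert b (S ∪ T)) : Finset G) : Set G) = H
    at hsub hsolv
  have haH : a ∈ H := hsub (by simp)
  have hbH : b ∈ H := hsub (by simp)
  have hconj : ∀ n, ∀ g ∈ H, ∀ k ∈ (derivedSeries H n).map H.subtype,
      g * k * g⁻¹ ∈ (derivedSeries H n).map H.subtype := by
    rintro n g hg _ ⟨k, hk, rfl⟩
    exact ⟨⟨g, hg⟩ * k * ⟨g, hg⟩⁻¹, (derivedSeries_normal H n).conj_mem k hk ⟨g, hg⟩, rfl⟩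
  have key : ∀ n, a ∈ (derivedSeries H n).map H.subtype ∧
      b ∈ (derivedSeries H n).map H.subtype := by
    intro n
    induction n with
    | zero => exact ⟨⟨⟨a, haH⟩, trivial, rfl⟩, ⟨⟨b, hbH⟩, trivial, rfl⟩⟩
    | succ n ih =>
      have hc : ⁅a, b⁆ ∈ (derivedSeries H (n + 1)).map H.subtype := by
        rw [derivedSeries_succ, Subgroup.map_commutator]
        exact Subgroup.commutator_mem_commutator ih.1 ih.2
      exact ⟨hS _ hc fun g hg => hconj _ g (hsub (by simp [hg])),
        hT _ hc fun g hg => hconj _ g (hsub (by simp [hg]))⟩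
  obtain ⟨n, hn⟩ := hsolv.solvable
  have h1 := (key n).1
  rw [hn, Subgroup.map_bot, Subgroup.mem_bot] at h1
  rw [h1, commutatorElement_one_left]

/-- If `G` is a locally finite, locally soluble, simple group, then `G` is cyclic. -/
theorem isCyclic_of_locallyFinite_locallySoluble_simple (G : Type*) [Group G]
    (hfin : LocallyFiniteGroup G) (hsol : LocallySolubleGroup G)
    (hsimple : IsSimpleGroup G) : IsCyclic G := by
  have hcomm : ∀ a b : G, a * b = b * a := by
    intro a b
    rw [← commutatorElement_eq_one_iff_mul_comm]
    by_contra hc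
    have htop : Subgroup.normalClosure {⁅a, b⁆} = ⊤ := by
      refine Subgroup.normalClosure_normal.eq_bot_or_eq_top.resolve_left fun hbot => hc ?_
      rw [← Subgroup.mem_bot, ← hbot]
      exact Subgroup.subset_normalClosure rfl
    exact hc (hsol.commutatorElement_eq_one (htop ▸ Subgroup.mem_top a)
      (htop ▸ Subgroup.mem_top b))
  let _ : CommGroup G := { mul_comm := hcomm }
  exact IsSimpleGroup.isCyclic
end

section
/- Let 𝔏 be a class of finite groups closed under taking subgroups, homomorphic images and extensions, let G be a finite group, and let N be the maximal normal 𝔏-subgroup of G (i.e. a normal subgroup of G belonging to 𝔏 that contains every normal subgroup of G belonging to 𝔏). Then μ(G) ≥ μ(G/N). -/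
/-- `μ G`, the minimal degree of a faithful permutation representation of `G`:
the least `n` such that `G` embeds into the symmetric group `Sym_n`. -/
noncomputable def minFaithfulDegree (G : Type*) [Group G] : ℕ :=
  sInf {n : ℕ | ∃ f : G →* Equiv.Perm (Fin n), Function.Injective f}

universe u

namespace GroupClass

/-- A class of finite groups closed under subgroups, homomorphic images and extensions. -/
structure IsClosed (𝔏 : (H : Type u) → [Group H] → Prop) : Prop where
  sub : ∀ (H : Type u) [Group H] [Finite H], 𝔏 H → ∀ K : Subgroup H, 𝔏 K
  img : ∀ (H H' : Type u) [Group H] [Group H'] [Finite H] [Finite H']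
    (f : H →* H'), Function.Surjective f → 𝔏 H → 𝔏 H'
  ext : ∀ (H : Type u) [Group H] [Finite H] (K : Subgroup H) [K.Normal],
    𝔏 K → 𝔏 (H ⧸ K) → 𝔏 H

variable {𝔏 : (H : Type u) → [Group H] → Prop}

/-- `K ⊓ M` is normal in `M` with quotient in the class `𝔏`. -/
def Section (𝔏 : (H : Type u) → [Group H] → Prop) {G : Type u} [Group G]
    (K M : Subgroup G) : Prop :=
  ∃ (Q : Type u) (_ : Group Q) (_ : Finite Q) (φ : M →* Q), 𝔏 Q ∧ φ.ker = K.subgroupOf M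

/-- `L` is the largest normal subgroup of `G` whose image modulo `K` is in `𝔏`. -/
structure IsRadical (𝔏 : (H : Type u) → [Group H] → Prop) {G : Type u} [Group G]
    (K L : Subgroup G) : Prop where
  normal : L.Normal
  sec : Section 𝔏 K L
  max : ∀ M : Subgroup G, M.Normal → Section 𝔏 K M → M ≤ L

namespace IsClosed

theorem range_of_ker_le (h𝔏 : IsClosed 𝔏) {M Q₁ Q₂ : Type u} [Group M] [Group Q₁] [Group Q₂]
    [Finite Q₁] [Finite Q₂] (φ₁ : M →* Q₁) (φ₂ : M →* Q₂) (hker : φ₁.ker ≤ φ₂.ker)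
    (h : 𝔏 Q₁) : 𝔏 φ₂.range := by
  refine h𝔏.img φ₁.range φ₂.range
    (φ₁.rangeRestrict.liftOfSurjective φ₁.rangeRestrict_surjective
      ⟨φ₂.rangeRestrict, by simpa using hker⟩) ?_ (h𝔏.sub _ h _)
  intro y
  obtain ⟨x, rfl⟩ := φ₂.rangeRestrict_surjective y
  exact ⟨φ₁.rangeRestrict x, by
    simp [MonoidHom.liftOfSurjective, MonoidHom.liftOfRightInverse_comp_apply]⟩

theorem of_ker_of_codomain (h𝔏 : IsClosed 𝔏) {A B : Type u} [Group A] [Group B] [Finite A]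
    [Finite B] (f : A →* B) (hker : 𝔏 f.ker) (hB : 𝔏 B) : 𝔏 A := by
  refine h𝔏.ext A f.ker hker ?_
  exact h𝔏.img f.range _ (QuotientGroup.quotientKerEquivRange f).symm.toMonoidHom
    (QuotientGroup.quotientKerEquivRange f).symm.surjective (h𝔏.sub _ hB _)

theorem prod (h𝔏 : IsClosed 𝔏) {A B : Type u} [Group A] [Group B] [Finite A] [Finite B]
    (hA : 𝔏 A) (hB : 𝔏 B) : 𝔏 (A × B) := by
  refine h𝔏.of_ker_of_codomain (MonoidHom.fst A B) ?_ hA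
  refine h𝔏.img B _ ((MonoidHom.inr A B).codRestrict _ fun b => MonoidHom.mem_ker.2 rfl) ?_ hB
  rintro ⟨⟨a, b⟩, h⟩
  have ha : a = 1 := h
  subst ha
  exact ⟨b, rfl⟩

end IsClosed

namespace Section

variable {G G' : Type u} [Group G] [Group G']

theorem mono {K M M' : Subgroup G} (h : Section 𝔏 K M) (hM : M' ≤ M) : Section 𝔏 K M' := by
  obtain ⟨Q, _, _, φ, hQ, hφ⟩ := h
  refine ⟨Q, _, ‹_›, φ.comp (Subgroup.inclusion hM), hQ, ?_⟩
  rw [← MonoidHom.comap_ker, hφ]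
  rfl

theorem comap {K M : Subgroup G} (h : Section 𝔏 K M) (f : G' →* G) :
    Section 𝔏 (K.comap f) (M.comap f) := by
  obtain ⟨Q, _, _, φ, hQ, hφ⟩ := h
  refine ⟨Q, _, ‹_›, φ.comp (f.subgroupComap M), hQ, ?_⟩
  rw [← MonoidHom.comap_ker, hφ]
  rfl

theorem map {K : Subgroup G'} {M : Subgroup G} (f : G →* G') (h : Section 𝔏 (K.comap f) M) :
    Section 𝔏 K (M.map f) := by
  obtain ⟨Q, _, _, φ, hQ, hφ⟩ := h
  have hsurj := f.subgroupMap_surjective M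
  have hle : (f.subgroupMap M).ker ≤ φ.ker := by
    intro x hx
    rw [hφ, Subgroup.mem_subgroupOf, Subgroup.mem_comap]
    have : f x = 1 := congrArg Subtype.val hx
    rw [this]
    exact K.one_mem
  refine ⟨Q, _, ‹_›, (f.subgroupMap M).liftOfSurjective hsurj ⟨φ, hle⟩, hQ, ?_⟩
  ext y
  obtain ⟨x, rfl⟩ := hsurj y
  have : x ∈ φ.ker ↔ x ∈ (K.comap f).subgroupOf M := by rw [hφ]
  rw [MonoidHom.mem_ker] at this ⊢
  simpa [MonoidHom.liftOfSurjective, MonoidHom.liftOfRightInverse_comp_apply,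
    Subgroup.mem_subgroupOf] using this

theorem map_mk [Finite G] (h𝔏 : IsClosed 𝔏) {K M : Subgroup G} [K.Normal] (h : Section 𝔏 K M) :
    𝔏 (M.map (QuotientGroup.mk' K)) := by
  obtain ⟨Q, _, _, φ, hQ, hφ⟩ := h
  have := h𝔏.range_of_ker_le φ ((QuotientGroup.mk' K).comp M.subtype) (by
    rw [hφ, ← MonoidHom.comap_ker, QuotientGroup.ker_mk']; rfl) hQ
  rwa [MonoidHom.range_comp, Subgroup.range_subtype] at this

theorem of_map_mk [Finite G] {K M : Subgroup G} [K.Normal]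
    (h : 𝔏 (M.map (QuotientGroup.mk' K))) : Section 𝔏 K M := by
  refine ⟨_, _, inferInstance, (QuotientGroup.mk' K).subgroupMap M, h, ?_⟩
  ext x
  simp [MonoidHom.mem_ker, Subgroup.mem_subgroupOf, Subtype.ext_iff]

theorem mono_left [Finite G] (h𝔏 : IsClosed 𝔏) {K K' M : Subgroup G} [K'.Normal]
    (h : Section 𝔏 K M) (hK : K ≤ K') : Section 𝔏 K' M := by
  refine of_map_mk ?_
  obtain ⟨Q, _, _, φ, hQ, hφ⟩ := h
  have := h𝔏.range_of_ker_le φ ((QuotientGroup.mk' K').comp M.subtype) (by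
    rw [hφ, ← MonoidHom.comap_ker, QuotientGroup.ker_mk']; exact Subgroup.comap_mono hK) hQ
  rwa [MonoidHom.range_comp, Subgroup.range_subtype] at this

theorem top_left {Q : Type u} [Group Q] [Finite Q] (h𝔏 : IsClosed 𝔏) (hQ : 𝔏 Q)
    {K M : Subgroup G} (h : M ≤ K) : Section 𝔏 K M :=
  ⟨(⊥ : Subgroup Q), _, inferInstance, 1, h𝔏.sub Q hQ ⊥, by
    rw [Subgroup.subgroupOf_eq_top.2 h]; exact MonoidHom.ker_one⟩

theorem inf (h𝔏 : IsClosed 𝔏) {K₁ K₂ M : Subgroup G} (h₁ : Section 𝔏 K₁ M)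
    (h₂ : Section 𝔏 K₂ M) : Section 𝔏 (K₁ ⊓ K₂) M := by
  obtain ⟨Q₁, _, _, φ₁, hQ₁, hφ₁⟩ := h₁
  obtain ⟨Q₂, _, _, φ₂, hQ₂, hφ₂⟩ := h₂
  refine ⟨Q₁ × Q₂, _, inferInstance, φ₁.prod φ₂, h𝔏.prod hQ₁ hQ₂, ?_⟩
  rw [MonoidHom.ker_prod, hφ₁, hφ₂]
  rfl

theorem iInf (h𝔏 : IsClosed 𝔏) {Q : Type u} [Group Q] [Finite Q] (hQ : 𝔏 Q)
    {ι : Type*} [Finite ι] {K : ι → Subgroup G} {M : Subgroup G}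
    (h : ∀ i, Section 𝔏 (K i) M) : Section 𝔏 (⨅ i, K i) M := by
  classical
  have := Fintype.ofFinite ι
  suffices ∀ s : Finset ι, Section 𝔏 (⨅ i ∈ s, K i) M by simpa using this Finset.univ
  intro s
  induction s using Finset.induction_on with
  | empty => exact top_left h𝔏 hQ (by simp)
  | insert a s _ ih => rw [Finset.iInf_insert]; exact (h a).inf h𝔏 ih

theorem sup_left {L M : Subgroup G} [hL : L.Normal] (h : Section 𝔏 L M) :
    Section 𝔏 L (M ⊔ L) := by
  have h₁ : Section 𝔏 (⊥ : Subgroup (G ⧸ L)) (M.map (QuotientGroup.mk' L)) :=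
    map _ (by rwa [MonoidHom.comap_bot, QuotientGroup.ker_mk'])
  have h₂ := h₁.comap (QuotientGroup.mk' L)
  rwa [MonoidHom.comap_bot, Subgroup.comap_map_eq, QuotientGroup.ker_mk'] at h₂

theorem trans [Finite G] (h𝔏 : IsClosed 𝔏) {K N M : Subgroup G} [K.Normal] [N.Normal]
    (hKN : K ≤ N) (h₁ : Section 𝔏 K N) (h₂ : Section 𝔏 N M) : Section 𝔏 K M := by
  refine of_map_mk ?_
  let p : G ⧸ K →* G ⧸ N := QuotientGroup.map K N (MonoidHom.id G) hKN
  let f : M.map (QuotientGroup.mk' K) →* G ⧸ N := p.comp (Subgroup.subtype _)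
  have hf : f.range = M.map (QuotientGroup.mk' N) := by
    rw [MonoidHom.range_comp, Subgroup.range_subtype, Subgroup.map_map]
    rfl
  have hker : 𝔏 f.rangeRestrict.ker := by
    have hN := h₁.map_mk h𝔏
    let q : f.rangeRestrict.ker →* G ⧸ K := (Subgroup.subtype _).comp (Subgroup.subtype _)
    have hq : Function.Injective q :=
      Subtype.val_injective.comp Subtype.val_injective
    have hmem : ∀ x, q x ∈ N.map (QuotientGroup.mk' K) := by
      rintro ⟨⟨y, hy⟩, hx⟩
      obtain ⟨m, hm, rfl⟩ := hy
      have hx' : (m : G ⧸ N) = 1 := congrArg Subtype.val hx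
      exact ⟨m, (QuotientGroup.eq_one_iff m).1 hx', rfl⟩
    let r := q.codRestrict _ hmem
    have hr : Function.Injective r := fun a b hab => by
      have hval : (r a : G ⧸ K) = r b := by rw [hab]
      exact hq hval
    exact h𝔏.img r.range _ (MonoidHom.ofInjective hr).symm.toMonoidHom
      (MonoidHom.ofInjective hr).symm.surjective (h𝔏.sub _ hN _)
  refine h𝔏.of_ker_of_codomain f.rangeRestrict hker ?_
  rw [hf]
  exact h₂.map_mk h𝔏

end Section

theorem exists_isRadical {G : Type u} [Group G] [Finite G] (h𝔏 : IsClosed 𝔏) {Q : Type u}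
    [Group Q] [Finite Q] (hQ : 𝔏 Q) (K : Subgroup G) [hK : K.Normal] :
    ∃ L, IsRadical 𝔏 K L := by
  obtain ⟨L, hKL, hL⟩ := (Set.toFinite {M : Subgroup G | M.Normal ∧ Section 𝔏 K M}).exists_le_maximal
    (show K ∈ _ from ⟨hK, Section.top_left h𝔏 hQ le_rfl⟩)
  have := hL.prop.1
  refine ⟨L, hL.prop.1, hL.prop.2, fun M hM hKM => ?_⟩
  have h := hL.prop.2.trans h𝔏 hKL (hKM.mono_left h𝔏 hKL).sup_left
  exact le_sup_left.trans (hL.le_of_ge ⟨inferInstance, h⟩ le_sup_right)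

theorem IsRadical.le {G : Type u} [Group G] (h𝔏 : IsClosed 𝔏) {Q : Type u}
    [Group Q] [Finite Q] (hQ : 𝔏 Q) {K L : Subgroup G} [hK : K.Normal] (h : IsRadical 𝔏 K L) :
    K ≤ L :=
  h.max K hK (Section.top_left h𝔏 hQ le_rfl)

end GroupClass

/-- `G` has a permutation representation of degree `n` with kernel `K`. -/
def HasPermRep (G : Type*) [Group G] (n : ℕ) (K : Subgroup G) : Prop :=
  ∃ f : G →* Equiv.Perm (Fin n), f.ker = K

namespace HasPermRep

theorem of_hom {G : Type*} [Group G] {X : Type*} [Finite X] (f : G →* Equiv.Perm X) :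
    HasPermRep G (Nat.card X) f.ker := by
  refine ⟨(Finite.equivFin X).permCongrHom.toMonoidHom.comp f, ?_⟩
  ext g
  simp [MonoidHom.mem_ker]

theorem normal {G : Type*} [Group G] {n : ℕ} {K : Subgroup G} (h : HasPermRep G n K) :
    K.Normal := by
  obtain ⟨f, rfl⟩ := h
  infer_instance

theorem comap {G H : Type*} [Group G] [Group H] {n : ℕ} {K : Subgroup G} (h : HasPermRep G n K)
    (φ : H →* G) : HasPermRep H n (K.comap φ) := by
  obtain ⟨f, rfl⟩ := h
  exact ⟨f.comp φ, (MonoidHom.comap_ker _ _).symm⟩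

theorem of_comap {G H : Type*} [Group G] [Group H] {n : ℕ} {K : Subgroup G} {φ : H →* G}
    (hφ : Function.Surjective φ) (h : HasPermRep H n (K.comap φ)) : HasPermRep G n K := by
  obtain ⟨f, hf⟩ := h
  have hle : φ.ker ≤ f.ker := by rw [hf, ← MonoidHom.comap_bot]; exact Subgroup.comap_mono bot_le
  refine ⟨φ.liftOfSurjective hφ ⟨f, hle⟩, ?_⟩
  ext y
  obtain ⟨x, rfl⟩ := hφ y
  have : x ∈ f.ker ↔ x ∈ K.comap φ := by rw [hf]
  rw [MonoidHom.mem_ker] at this ⊢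
  simpa [MonoidHom.liftOfSurjective, MonoidHom.liftOfRightInverse_comp_apply] using this

theorem normalCore {G : Type*} [Group G] [Finite G] (H : Subgroup G) :
    HasPermRep G H.index H.normalCore := by
  rw [Subgroup.normalCore_eq_ker]
  exact of_hom _

theorem sum {G : Type*} [Group G] {ι : Type*} [Fintype ι] {n : ι → ℕ} {K : ι → Subgroup G}
    (h : ∀ i, HasPermRep G (n i) (K i)) : HasPermRep G (∑ i, n i) (⨅ i, K i) := by
  choose f hf using h
  have := of_hom ((Equiv.Perm.sigmaCongrRightHom fun i => Fin (n i)).comp (MonoidHom.pi f))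
  convert this using 1
  · simp [Nat.card_eq_fintype_card]
  · ext g
    rw [← MonoidHom.comap_ker, (MonoidHom.ker_eq_bot_iff _).2
      Equiv.Perm.sigmaCongrRightHom_injective]
    simp [Subgroup.mem_iInf, ← hf, MonoidHom.mem_ker, funext_iff]

/-- Induction of permutation representations from a subgroup. -/
theorem induced {G : Type*} [Group G] [Finite G] {S : Subgroup G} {n : ℕ} {K : Subgroup S}
    (hn : n ≠ 0) (h : HasPermRep S n K) :
    HasPermRep G (S.index * n) (K.map S.subtype).normalCore := by
  obtain ⟨f, rfl⟩ := h
  have hmem (g : G) (c : G ⧸ S) : (g • c).out⁻¹ * (g * c.out) ∈ S := by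
    rw [← QuotientGroup.eq, QuotientGroup.out_eq', ← smul_eq_mul, ← MulAction.Quotient.smul_mk,
      QuotientGroup.out_eq']
  let t (g : G) (c : G ⧸ S) : S := ⟨_, hmem g c⟩
  let act : MulAction G ((G ⧸ S) × Fin n) :=
    { smul := fun g p => (g • p.1, f (t g p.1) p.2)
      one_smul := by
        rintro ⟨c, b⟩
        have : t 1 c = 1 := by ext; simp [t]
        change ((1 : G) • c, f (t 1 c) b) = _
        simp [this]
      mul_smul := by
        rintro g g' ⟨c, b⟩
        have : t (g * g') c = t g (g' • c) * t g' c := by ext; simp [t, mul_assoc, mul_smul]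
        change ((g * g') • c, f (t (g * g') c) b) = (g • g' • c, f (t g (g' • c)) (f (t g' c) b))
        simp [this, mul_smul] }
  have hs (g : G) (c : G ⧸ S) (b : Fin n) : g • (c, b) = (g • c, f (t g c) b) := rfl
  convert of_hom (MulAction.toPermHom G ((G ⧸ S) × Fin n)) using 1
  · simp [Nat.card_prod, Subgroup.index]
  have : NeZero n := ⟨hn⟩
  ext g
  rw [MonoidHom.mem_ker]
  constructor
  · intro hg
    ext1 ⟨c, b⟩
    have h1 := hg c.out⁻¹
    rw [inv_inv] at h1
    obtain ⟨s, hsk, hse⟩ := h1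
    have hc : g • c = c := by
      have : ((g * c.out : G) : G ⧸ S) = (c.out : G) := by
        rw [eq_comm, QuotientGroup.eq, ← mul_assoc, ← hse]
        exact s.2
      rwa [← smul_eq_mul, ← MulAction.Quotient.smul_mk, QuotientGroup.out_eq'] at this
    have ht : t g c = s := by
      ext
      simp only [t, hc]
      rw [← mul_assoc, ← hse]; rfl
    change g • (c, b) = (c, b)
    rw [hs, hc, ht, MonoidHom.mem_ker.1 hsk]
    rfl
  · intro hg a
    have hfix (c : G ⧸ S) (b : Fin n) : (g • c, f (t g c) b) = (c, b) := by
      rw [← hs]; exact congrArg (fun e => e (c, b)) hg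
    let c : G ⧸ S := (a⁻¹ : G)
    have hc : g • c = c := congrArg Prod.fst (hfix c 0)
    have ht : f (t g c) = 1 := by
      ext1 b; exact congrArg Prod.snd (hfix c b)
    have hsS : c.out⁻¹ * a⁻¹ ∈ S := by
      rw [← QuotientGroup.eq, QuotientGroup.out_eq']
    let s : S := ⟨_, hsS⟩
    refine ⟨s⁻¹ * t g c * s, ?_, ?_⟩
    · simp [MonoidHom.mem_ker, ht]
    · simp [s, t, hc, mul_assoc]

end HasPermRep

namespace GroupClass

variable {𝔏 : (H : Type u) → [Group H] → Prop} {G : Type u} [Group G] [Finite G]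

/-- If `H` and the radical `L` generate `G`, then `L ⊓ H` is the radical of `H`. -/
theorem IsRadical.subgroupOf (h𝔏 : IsClosed 𝔏) {Q : Type u} [Group Q] [Finite Q] (hQ : 𝔏 Q)
    {H K L : Subgroup G} [hK : K.Normal] (h : IsRadical 𝔏 K L) (hHL : H ⊔ L = ⊤) :
    IsRadical 𝔏 (K.subgroupOf H) (L.subgroupOf H) := by
  have hL := h.normal
  refine ⟨inferInstance, h.sec.comap H.subtype, fun M hM hKM => ?_⟩
  have hKL := h.le h𝔏 hQ
  have hsec : Section 𝔏 K (M.map H.subtype ⊔ L) :=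
    h.sec.trans h𝔏 hKL ((Section.map H.subtype hKM).mono_left h𝔏 hKL).sup_left
  have hnormal : (M.map H.subtype ⊔ L).Normal := by
    have hsurj : Function.Surjective ((QuotientGroup.mk' L).comp H.subtype) := by
      rw [← MonoidHom.range_eq_top, MonoidHom.range_comp, Subgroup.range_subtype]
      refine Subgroup.comap_injective (QuotientGroup.mk'_surjective L) ?_
      rw [Subgroup.comap_map_eq, QuotientGroup.ker_mk', hHL, Subgroup.comap_top]
    have := (hM.map _ hsurj).comap (QuotientGroup.mk' L)
    rwa [← Subgroup.map_map, Subgroup.comap_map_eq, QuotientGroup.ker_mk'] at this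
  exact Subgroup.map_le_iff_le_comap.1 (le_sup_left.trans (h.max _ hnormal hsec))

theorem IsRadical.hasPermRep_of_sup_eq_top (h𝔏 : IsClosed 𝔏) {Q : Type u} [Group Q] [Finite Q]
    (hQ : 𝔏 Q) {H L : Subgroup G} (h : IsRadical 𝔏 H.normalCore L) (hHL : H ⊔ L = ⊤)
    (ih : ∀ n (K L : Subgroup H), HasPermRep H n K → IsRadical 𝔏 K L → HasPermRep H n L) :
    HasPermRep G H.index L := by
  have hL := h.normal
  have hH := ih _ _ _ ((HasPermRep.normalCore H).comap H.subtype) (h.subgroupOf h𝔏 hQ hHL)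
  have hsurj : Function.Surjective ((QuotientGroup.mk' L).comp H.subtype) := by
    rw [← MonoidHom.range_eq_top, MonoidHom.range_comp, Subgroup.range_subtype]
    refine Subgroup.comap_injective (QuotientGroup.mk'_surjective L) ?_
    rw [Subgroup.comap_map_eq, QuotientGroup.ker_mk', hHL, Subgroup.comap_top]
  have hbot : HasPermRep (G ⧸ L) H.index ⊥ := by
    refine HasPermRep.of_comap hsurj ?_
    rwa [← Subgroup.comap_comap, MonoidHom.comap_bot, QuotientGroup.ker_mk']
  simpa using hbot.comap (QuotientGroup.mk' L)

/-- The radical of `G` is the core of the radical of a subgroup containing it. -/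
theorem IsRadical.normalCore_map_eq (h𝔏 : IsClosed 𝔏) {Q : Type u} [Group Q] [Finite Q]
    (hQ : 𝔏 Q) {H S L : Subgroup G} (h : IsRadical 𝔏 H.normalCore L) (hHS : H ≤ S) (hLS : L ≤ S)
    {R : Subgroup S} (hR : IsRadical 𝔏 (H.subgroupOf S).normalCore R) :
    (R.map S.subtype).normalCore = L := by
  have hL := h.normal
  apply le_antisymm
  · set C := (R.map S.subtype).normalCore with hC
    refine h.max C inferInstance ?_
    set J := (H.subgroupOf S).normalCore.map S.subtype with hJ
    have hJH : J ≤ H := (Subgroup.map_mono (Subgroup.normalCore_le _)).trans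
      (Subgroup.map_subgroupOf_eq_of_le hHS).le
    have h₁ : Section 𝔏 J C := by
      refine Section.mono (Section.map S.subtype ?_) (Subgroup.normalCore_le _)
      rw [Subgroup.comap_map_eq_self_of_injective S.subtype_injective]
      exact hR.sec
    have h₂ (g : G) : Section 𝔏 (J.comap (MulAut.conj g).toMonoidHom) C := by
      refine (h₁.comap (MulAut.conj g).toMonoidHom).mono fun x hx => ?_
      exact (Subgroup.normalCore_normal _).conj_mem x hx g
    refine (Section.iInf h𝔏 hQ h₂).mono_left h𝔏 fun x hx g => hJH ?_
    exact Subgroup.mem_iInf.1 hx g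
  · rw [Subgroup.normal_le_normalCore, ← Subgroup.map_subgroupOf_eq_of_le hLS]
    refine Subgroup.map_mono (hR.max _ inferInstance ?_)
    refine (h.sec.comap S.subtype).mono_left h𝔏 ?_
    exact Subgroup.normal_le_normalCore.2 (Subgroup.comap_mono (Subgroup.normalCore_le H))

theorem IsRadical.hasPermRep_index (h𝔏 : IsClosed 𝔏) {Q : Type u} [Group Q] [Finite Q]
    (hQ : 𝔏 Q) {H L : Subgroup G} (h : IsRadical 𝔏 H.normalCore L)
    (ih : ∀ S : Subgroup G, S ≠ ⊤ → ∀ n (K L : Subgroup S), HasPermRep S n K →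
      IsRadical 𝔏 K L → HasPermRep S n L) :
    HasPermRep G H.index L := by
  by_cases hS : H ⊔ L = ⊤
  · by_cases hH : H = ⊤
    · have hle := h.le h𝔏 hQ
      have := HasPermRep.normalCore H
      rwa [le_antisymm hle] at this
      subst hH
      exact Subgroup.normal_le_normalCore (hN := h.normal).2 le_top
    · exact h.hasPermRep_of_sup_eq_top h𝔏 hQ hS (ih H hH)
  · obtain ⟨R, hR⟩ := exists_isRadical h𝔏 hQ (H.subgroupOf (H ⊔ L)).normalCore
    have := (ih _ hS _ _ _ (HasPermRep.normalCore _) hR).induced Subgroup.index_ne_zero_of_finite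
    rwa [h.normalCore_map_eq h𝔏 hQ le_sup_left le_sup_right hR, mul_comm,
      ← Subgroup.relIndex, Subgroup.relIndex_mul_index le_sup_left] at this

/-- A permutation representation with kernel `K` can be replaced by one of the same degree whose
kernel is the radical modulo `K`. -/
theorem IsRadical.hasPermRep (h𝔏 : IsClosed 𝔏) {Q : Type u} [Group Q] [Finite Q]
    (hQ : 𝔏 Q) {n : ℕ} {K L : Subgroup G} (hK : HasPermRep G n K) (h : IsRadical 𝔏 K L) :
    HasPermRep G n L := by
  classical
  induction hm : Nat.card G using Nat.strong_induction_on generalizing G n with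
  | _ m ih =>
    have hKn := hK.normal
    have hLn := h.normal
    obtain ⟨f, hf⟩ := hK
    let act : MulAction G (Fin n) := MulAction.compHom _ f
    have hact (g : G) (x : Fin n) : g • x = f g x := rfl
    let Ω := MulAction.orbitRel.Quotient G (Fin n)
    let H (ω : Ω) : Subgroup G := MulAction.stabilizer G ω.out
    have hΩ : Fintype Ω := Fintype.ofFinite Ω
    have hn : n = ∑ ω, (H ω).index := by
      have := Nat.card_congr (MulAction.selfEquivSigmaOrbitsQuotientStabilizer G (Fin n))
      rw [Nat.card_sigma, Nat.card_fin] at this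
      exact this
    have hKH (ω : Ω) : K ≤ (H ω).normalCore := by
      rw [Subgroup.normal_le_normalCore]
      intro g hg
      rw [← hf, MonoidHom.mem_ker] at hg
      rw [MulAction.mem_stabilizer_iff, hact, hg]
      rfl
    have hHK : ⨅ ω, (H ω).normalCore ≤ K := by
      intro g hg
      rw [← hf, MonoidHom.mem_ker]
      ext1 x
      let ω : Ω := Quotient.mk'' x
      obtain ⟨a, ha⟩ : ω.out ∈ MulAction.orbit G x := by
        rw [← MulAction.orbitRel_apply]
        exact Quotient.exact ω.out_eq
      have h₁ : a * g * a⁻¹ ∈ H ω := Subgroup.mem_iInf.1 hg ω a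
      rw [MulAction.mem_stabilizer_iff, ← ha] at h₁
      change g • x = x
      simpa [mul_smul] using h₁
    choose R hR using fun ω => exists_isRadical h𝔏 hQ (H ω).normalCore
    have hRL : ⨅ ω, R ω = L := by
      apply le_antisymm
      · refine h.max _ (Subgroup.normal_iInf_normal fun ω => (hR ω).normal) ?_
        exact (Section.iInf h𝔏 hQ fun ω => (hR ω).sec.mono (iInf_le R ω)).mono_left h𝔏 hHK
      · exact le_iInf fun ω => (hR ω).max L hLn (h.sec.mono_left h𝔏 (hKH ω))
    rw [hn, ← hRL]
    refine HasPermRep.sum fun ω => (hR ω).hasPermRep_index h𝔏 hQ fun S hS n K L hK hL => ?_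
    refine ih (Nat.card S) ?_ hK hL rfl
    rw [← hm]
    exact lt_of_le_of_ne (Subgroup.card_le_card_group S) fun e => hS (Subgroup.eq_top_of_card_eq S e)

end GroupClass

theorem hasPermRep_minFaithfulDegree (G : Type*) [Group G] [Finite G] :
    HasPermRep G (minFaithfulDegree G) ⊥ := by
  have hne : {n : ℕ | ∃ f : G →* Equiv.Perm (Fin n), Function.Injective f}.Nonempty := by
    obtain ⟨f, hf⟩ := HasPermRep.of_hom (MulAction.toPermHom G G)
    refine ⟨_, f, ?_⟩
    rw [← MonoidHom.ker_eq_bot_iff, hf, MonoidHom.ker_eq_bot_iff]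
    exact MulAction.toPerm_injective
  obtain ⟨f, hf⟩ := Nat.sInf_mem hne
  exact ⟨f, (MonoidHom.ker_eq_bot_iff f).2 hf⟩

/-- Let `𝔏` be a class of finite groups closed under taking subgroups, homomorphic images
and extensions, let `G` be a finite group, and let `N` be the maximal normal `𝔏`-subgroup
of `G`. Then `μ(G) ≥ μ(G/N)`. -/
theorem minFaithfulDegree_quotient_maximal_normal_le
    (𝔏 : (H : Type u) → [inst : Group H] → Prop)
    (hsub : ∀ (H : Type u) [Group H] [Finite H], 𝔏 H → ∀ K : Subgroup H, 𝔏 K)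
    (himg : ∀ (H H' : Type u) [Group H] [Group H'] [Finite H] [Finite H']
      (f : H →* H'), Function.Surjective f → 𝔏 H → 𝔏 H')
    (hext : ∀ (H : Type u) [Group H] [Finite H] (K : Subgroup H) [K.Normal],
      𝔏 K → 𝔏 (H ⧸ K) → 𝔏 H)
    (G : Type u) [Group G] [Finite G] (N : Subgroup G) [N.Normal] (h𝔏N : 𝔏 N)
    (hmax : ∀ M : Subgroup G, M.Normal → 𝔏 M → M ≤ N) :
    minFaithfulDegree (G ⧸ N) ≤ minFaithfulDegree G := by
  have hclosed : GroupClass.IsClosed 𝔏 := ⟨hsub, himg, hext⟩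
  have hrad : GroupClass.IsRadical 𝔏 (⊥ : Subgroup G) N := by
    refine ⟨inferInstance, ⟨N, _, inferInstance, MonoidHom.id N, h𝔏N, ?_⟩, fun M hM h => ?_⟩
    · ext x
      simp
    · refine hmax M hM ?_
      obtain ⟨Q, _, _, φ, hQ, hφ⟩ := h
      have hφ' : Function.Injective φ := by
        rw [← MonoidHom.ker_eq_bot_iff, hφ, Subgroup.bot_subgroupOf]
      exact himg φ.range M (MonoidHom.ofInjective hφ').symm.toMonoidHom
        (MonoidHom.ofInjective hφ').symm.surjective (hsub _ hQ _)
  obtain ⟨f, rfl⟩ := hrad.hasPermRep hclosed h𝔏N (hasPermRep_minFaithfulDegree G)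
  exact Nat.sInf_le ⟨QuotientGroup.kerLift f, QuotientGroup.kerLift_injective f⟩
end
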